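/- Let (A, m, k) be a noetherian local ring and let M be a test module for A. If M has finite upper complete intersection dimension (CI*-dim_A(M) < ∞), then A is a complete intersection ring. -/

import Mathlib

open CategoryTheory IsLocalRing

universe u

/-! ## Homological dimensions -/

/-- Flat dimension at most `n`: `M` is flat, or there is a surjection from a flat
module whose kernel has flat dimension at most `n - 1`. -/
def FlatDimLE (A : Type u) [CommRing A] :
    ℕ → ∀ (M : Type u) [AddCommGroup M] [Module A M], Prop
  | 0 => fun M _ _ => Module.Flat A M
  | n + 1 => fun M _ _ =>
      ∃ (F : Type u) (_ : AddCommGroup F) (_ : Module A F), Module.Flat A F ∧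
        ∃ f : F →ₗ[A] M, Function.Surjective f ∧ FlatDimLE A n (LinearMap.ker f)

/-- Projective dimension at most `n`. -/
def ProjDimLE (A : Type u) [CommRing A] :
    ℕ → ∀ (M : Type u) [AddCommGroup M] [Module A M], Prop
  | 0 => fun M _ _ => Module.Projective A M
  | n + 1 => fun M _ _ =>
      ∃ (P : Type u) (_ : AddCommGroup P) (_ : Module A P), Module.Projective A P ∧
        ∃ f : P →ₗ[A] M, Function.Surjective f ∧ ProjDimLE A n (LinearMap.ker f)

/-- Injective dimension at most `n`. -/
def InjDimLE (A : Type u) [CommRing A] :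
    ℕ → ∀ (M : Type u) [AddCommGroup M] [Module A M], Prop
  | 0 => fun M _ _ => Module.Injective A M
  | n + 1 => fun M _ _ =>
      ∃ (I : Type u) (_ : AddCommGroup I) (_ : Module A I), Module.Injective A I ∧
        ∃ f : M →ₗ[A] I, Function.Injective f ∧ InjDimLE A n (I ⧸ LinearMap.range f)

/-! ## Classes of local rings -/

/-- A Gorenstein (noetherian) local ring: a noetherian local ring having finite injective
dimension as a module over itself. -/
def IsGorensteinLocalRing (A : Type u) [CommRing A] : Prop :=
  IsNoetherianRing A ∧ IsLocalRing A ∧ ∃ n : ℕ, InjDimLE A n A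

/-- A regular local ring: a noetherian local ring whose maximal ideal is generated by
`dim A` elements. -/
def IsRegularLocal (A : Type u) [CommRing A] : Prop :=
  IsNoetherianRing A ∧ IsLocalRing A ∧
    ∃ s : Finset A, (Ideal.span (s : Set A)).IsMaximal ∧
      (s.card : WithBot ℕ∞) = ringKrullDim A

/-- A deformation: a surjective ring homomorphism whose kernel is generated by a
regular sequence. -/
def IsDeformation {Q A' : Type u} [CommRing Q] [CommRing A'] (f : Q →+* A') : Prop :=
  Function.Surjective f ∧
    ∃ rs : List Q, RingTheory.Sequence.IsRegular Q rs ∧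
      RingHom.ker f = Ideal.span {x | x ∈ rs}

/-- A noetherian local ring is complete intersection if its `m`-adic completion is a
quotient of a regular local ring by an ideal generated by a regular sequence. -/
def IsCompleteIntersectionLocalRing (A : Type u) [CommRing A] [IsLocalRing A] : Prop :=
  ∃ (Q : Type u) (_ : CommRing Q), IsRegularLocal Q ∧
    ∃ f : Q →+* AdicCompletion (maximalIdeal A) A, IsDeformation f

/-! ## Tor, test modules -/

/-- Vanishing of `Tor_i^A(M, N)`. -/
def TorVanish (A : Type u) [CommRing A] (i : ℕ)
    (M : Type u) [AddCommGroup M] [Module A M]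
    (N : Type u) [AddCommGroup N] [Module A N] : Prop :=
  Subsingleton (((Tor (ModuleCat.{u} A) i).obj (ModuleCat.of A M)).obj (ModuleCat.of A N))

/-- `M` is a test module for `A`: for every local homomorphism `A → B` of noetherian local
rings and every finitely generated `B`-module `N`, vanishing of `Tor_i^A(M,N)` for all
`i ≫ 0` implies that `N` has finite flat dimension over `A`. -/
def IsTestModule (A : Type u) [CommRing A] [IsLocalRing A] [IsNoetherianRing A]
    (M : Type u) [AddCommGroup M] [Module A M] : Prop :=
  ∀ (B : Type u) [CommRing B] [IsLocalRing B] [IsNoetherianRing B] [Algebra A B],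
    IsLocalHom (algebraMap A B) →
    ∀ (N : Type u) [AddCommGroup N] [Module A N] [Module B N] [IsScalarTower A B N],
      Module.Finite B N →
      (∃ i₀ : ℕ, ∀ i ≥ i₀, TorVanish A i M N) →
      ∃ n : ℕ, FlatDimLE A n N

/-- `M` is a Test module for `A`: for every finitely generated `A`-module `N`, vanishing of
`Tor_i^A(M,N)` for all `i ≫ 0` implies that `N` has finite flat dimension over `A`. -/
def IsCapitalTestModule (A : Type u) [CommRing A] [IsLocalRing A] [IsNoetherianRing A]
    (M : Type u) [AddCommGroup M] [Module A M] : Prop :=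
  ∀ (N : Type u) [AddCommGroup N] [Module A N], Module.Finite A N →
    (∃ i₀ : ℕ, ∀ i ≥ i₀, TorVanish A i M N) →
    ∃ n : ℕ, FlatDimLE A n N

/-! ## Weakly regular homomorphisms and upper CI dimension -/

/-- `A → A'` (given as an algebra) is a weakly regular local homomorphism: it is a local
homomorphism, flat, and the closed fiber `A' ⊗_A k = A'/m A'` is a regular local ring. -/
def IsWeaklyRegularAlgebra (A : Type u) [CommRing A] [IsLocalRing A]
    (A' : Type u) [CommRing A'] [Algebra A A'] : Prop :=
  IsLocalHom (algebraMap A A') ∧ Module.Flat A A' ∧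
    IsRegularLocal (A' ⧸ Ideal.map (algebraMap A A') (maximalIdeal A))

/-- `M` has finite upper complete intersection dimension `CI*-dim_A(M) < ∞`: there are a
weakly regular homomorphism `A → A'` of noetherian local rings and a deformation `Q → A'`
such that `pd_Q (A' ⊗_A M) < ∞`. -/
def CIStarDimFinite (A : Type u) [CommRing A] [IsLocalRing A]
    (M : Type u) [AddCommGroup M] [Module A M] : Prop :=
  ∃ (A' : Type u) (_ : CommRing A') (_ : IsLocalRing A') (_ : IsNoetherianRing A')
    (_ : Algebra A A'), IsWeaklyRegularAlgebra A A' ∧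
    ∃ (Q : Type u) (_ : CommRing Q) (_ : IsLocalRing Q) (_ : IsNoetherianRing Q)
      (f : Q →+* A'), IsDeformation f ∧
        ∃ n : ℕ,
          let _inst : Module Q (TensorProduct A A' M) :=
            Module.compHom (TensorProduct A A' M) f
          ProjDimLE Q n (TensorProduct A A' M)

/-! ## Gorenstein dimension -/

/-- Vanishing of `Ext^i_A(M, N)`. -/
def ExtVanish (A : Type u) [CommRing A] (i : ℕ)
    (M : Type u) [AddCommGroup M] [Module A M]
    (N : Type u) [AddCommGroup N] [Module A N] : Prop :=
  Subsingleton (((Ext A (ModuleCat.{u} A) i).obj (Opposite.op (ModuleCat.of A M))).obj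
    (ModuleCat.of A N))

/-- `G-dim_A M = 0`: the biduality map is an isomorphism and
`Ext^i(M, A) = 0 = Ext^i(M*, A)` for `i > 0`. -/
def GDimZero (A : Type u) [CommRing A] (M : Type u) [AddCommGroup M] [Module A M] : Prop :=
  Function.Bijective (Module.Dual.eval A M) ∧
    (∀ i > 0, ExtVanish A i M A) ∧
    (∀ i > 0, ExtVanish A i (Module.Dual A M) A)

/-- `G-dim_A M ≤ n`: `M` admits a resolution of length `n` by modules of G-dimension `0`. -/
def GDimLE (A : Type u) [CommRing A] :
    ℕ → ∀ (M : Type u) [AddCommGroup M] [Module A M], Prop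
  | 0 => fun M _ _ => GDimZero A M
  | n + 1 => fun M _ _ =>
      ∃ (T : Type u) (_ : AddCommGroup T) (_ : Module A T), GDimZero A T ∧
        ∃ f : T →ₗ[A] M, Function.Surjective f ∧ GDimLE A n (LinearMap.ker f)

/-! ## Complexity -/

/-- The length of a module: the length of the longest chain in its lattice of submodules.
For a module annihilated by the maximal ideal (such as `Tor_n^A(M, k)`) this is its
dimension as a `k`-vector space. -/
noncomputable def moduleLength (A : Type u) [CommRing A]
    (M : Type u) [AddCommGroup M] [Module A M] : WithBot ℕ∞ :=
  Order.krullDim (Submodule A M)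

/-- `cx_A(M) ≤ c`: there exists a real `α` with
`dim_k Tor_n^A(M, k) ≤ α n^(c-1)` for all `n ≫ 0`. -/
def ComplexityLE (A : Type u) [CommRing A] [IsLocalRing A]
    (M : Type u) [AddCommGroup M] [Module A M] (c : ℕ) : Prop :=
  ∃ α : ℝ, ∃ n₀ : ℕ, ∀ n ≥ n₀, ∃ d : ℕ,
    moduleLength A
      (((Tor (ModuleCat.{u} A) n).obj (ModuleCat.of A M)).obj
        (ModuleCat.of A (ResidueField A))) = (d : ℕ∞) ∧
      (d : ℝ) ≤ α * (n : ℝ) ^ ((c : ℤ) - 1)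

/-- The complexity `cx_A(M)`: the least `c` as above. -/
noncomputable def complexity (A : Type u) [CommRing A] [IsLocalRing A]
    (M : Type u) [AddCommGroup M] [Module A M] : ℕ :=
  sInf {c : ℕ | ComplexityLE A M c}

/-- The embedding dimension `dim_k m/m²` of a local ring. -/
noncomputable def embDim (A : Type u) [CommRing A] [IsLocalRing A] : ℕ :=
  Module.finrank (ResidueField A) (CotangentSpace A)

namespace CIT

section snake
open LinearMap TensorProduct

variable {A : Type*} [CommRing A]
variable {K F X N1 P N : Type*} [AddCommGroup K] [AddCommGroup F] [AddCommGroup X]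
  [AddCommGroup N1] [AddCommGroup P] [AddCommGroup N]
  [Module A K] [Module A F] [Module A X] [Module A N1] [Module A P] [Module A N]
  {i : K →ₗ[A] F} {p : F →ₗ[A] X} {j : N1 →ₗ[A] P} {q : P →ₗ[A] N}

theorem sq_comm (f : K →ₗ[A] F) (g : N1 →ₗ[A] P) (x : K ⊗[A] N1) :
    g.lTensor F (f.rTensor N1 x) = f.rTensor P (g.lTensor K x) := by
  rw [← LinearMap.comp_apply, ← LinearMap.comp_apply, LinearMap.lTensor_comp_rTensor,
    LinearMap.rTensor_comp_lTensor]

theorem snake1 (hip : Function.Exact i p) (hp : Function.Surjective p)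
    (hjq : Function.Exact j q) (hq : Function.Surjective q)
    (h1 : Function.Injective (i.rTensor P)) (h2 : Function.Injective (j.lTensor X)) :
    Function.Injective (i.rTensor N) := by
  rw [injective_iff_map_eq_zero]
  intro z hz
  obtain ⟨v, rfl⟩ := LinearMap.lTensor_surjective K hq z
  rw [← sq_comm] at hz
  obtain ⟨w, hw⟩ := (lTensor_exact F hjq hq _).1 hz
  have h3 : p.rTensor N1 w = 0 := by
    apply h2
    rw [sq_comm, hw, map_zero]
    exact (rTensor_exact P hip hp _).2 ⟨v, rfl⟩
  obtain ⟨t, rfl⟩ := (rTensor_exact N1 hip hp _).1 h3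
  rw [sq_comm] at hw
  rw [← h1 hw]
  exact (lTensor_exact K hjq hq _).2 ⟨t, rfl⟩

theorem snake2 (hip : Function.Exact i p) (hp : Function.Surjective p)
    (hjq : Function.Exact j q) (hq : Function.Surjective q)
    (h1 : Function.Injective (j.lTensor F)) (h2 : Function.Injective (i.rTensor N)) :
    Function.Injective (j.lTensor X) := by
  rw [injective_iff_map_eq_zero]
  intro z hz
  obtain ⟨w, rfl⟩ := LinearMap.rTensor_surjective N1 hp z
  rw [sq_comm] at hz
  obtain ⟨v, hv⟩ := (rTensor_exact P hip hp _).1 hz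
  have h3 : q.lTensor K v = 0 := by
    apply h2
    rw [← sq_comm, hv, map_zero]
    exact (lTensor_exact F hjq hq _).2 ⟨w, rfl⟩
  obtain ⟨t, rfl⟩ := (lTensor_exact K hjq hq _).1 h3
  rw [← sq_comm] at hv
  rw [← h1 hv]
  exact (rTensor_exact N1 hip hp _).2 ⟨t, rfl⟩

end snake

open scoped Classical in
/-- a generating set, finite if possible -/
noncomputable def gens (A : Type*) [CommRing A] (X : Type*) [AddCommGroup X] [Module A X] : Set X :=
  if h : (⊤ : Submodule A X).FG then (h.choose : Set X) else Set.univ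

theorem span_gens (A : Type*) [CommRing A] (X : Type*) [AddCommGroup X] [Module A X] :
    Submodule.span A (gens A X) = ⊤ := by
  unfold gens
  split_ifs with h
  · exact h.choose_spec
  · simp

theorem finite_gens (A : Type*) [CommRing A] (X : Type*) [AddCommGroup X] [Module A X]
    [h : Module.Finite A X] : (gens A X).Finite := by
  unfold gens
  rw [dif_pos h.1]
  exact Finset.finite_toSet _

/-- canonical free cover -/
def Fr (A : Type*) [CommRing A] (X : Type*) [AddCommGroup X] [Module A X] : Type _ := gens A X →₀ A

section FrSz
variable (A : Type*) [CommRing A] (X : Type*) [AddCommGroup X] [Module A X]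

noncomputable instance : AddCommGroup (Fr A X) := inferInstanceAs (AddCommGroup (gens A X →₀ A))
noncomputable instance : Module A (Fr A X) := inferInstanceAs (Module A (gens A X →₀ A))
instance : Module.Free A (Fr A X) := inferInstanceAs (Module.Free A (gens A X →₀ A))

noncomputable def cov : Fr A X →ₗ[A] X :=
  (Finsupp.linearCombination A Subtype.val : (gens A X →₀ A) →ₗ[A] X)

theorem cov_surj : Function.Surjective (cov A X) := by
  have : Function.Surjective (Finsupp.linearCombination A Subtype.val : (gens A X →₀ A) →ₗ[A] X) := by
    rw [← LinearMap.range_eq_top, Finsupp.range_linearCombination, Subtype.range_coe, span_gens]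
  exact this

/-- canonical first syzygy -/
def Sz : Type _ := LinearMap.ker (cov A X)

noncomputable instance : AddCommGroup (Sz A X) := inferInstanceAs (AddCommGroup (LinearMap.ker (cov A X)))
noncomputable instance : Module A (Sz A X) := inferInstanceAs (Module A (LinearMap.ker (cov A X)))

noncomputable def szi : Sz A X →ₗ[A] Fr A X := (LinearMap.ker (cov A X)).subtype

theorem szi_inj : Function.Injective (szi A X) := Submodule.subtype_injective _

theorem sz_exact : Function.Exact (szi A X) (cov A X) := LinearMap.exact_subtype_ker_map _

theorem fr_finite [Module.Finite A X] : Module.Finite A (Fr A X) := by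
  have := (finite_gens A X).to_subtype
  exact inferInstanceAs (Module.Finite A (gens A X →₀ A))

theorem sz_finite [IsNoetherianRing A] [Module.Finite A X] : Module.Finite A (Sz A X) := by
  have := fr_finite A X
  exact Module.Finite.of_injective (szi A X) (szi_inj A X)

end FrSz

/-- Vanishing of `Tor_1`. -/
def T1 (A : Type*) [CommRing A] (X : Type*) [AddCommGroup X] [Module A X]
    (N : Type*) [AddCommGroup N] [Module A N] : Prop :=
  Function.Injective ((szi A X).rTensor N)

section T1
variable {A : Type*} [CommRing A]
variable {K F X N1 P N : Type*} [AddCommGroup K] [AddCommGroup F] [AddCommGroup X]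
  [AddCommGroup N1] [AddCommGroup P] [AddCommGroup N]
  [Module A K] [Module A F] [Module A X] [Module A N1] [Module A P] [Module A N]
  {i : K →ₗ[A] F} {p : F →ₗ[A] X} {j : N1 →ₗ[A] P} {q : P →ₗ[A] N}

theorem T1_iff_right (hj : Function.Injective j) (hjq : Function.Exact j q)
    (hq : Function.Surjective q) [Module.Flat A P] :
    T1 A X N ↔ Function.Injective (j.lTensor X) :=
  ⟨fun h => snake2 (sz_exact A X) (cov_surj A X) hjq hq
    (Module.Flat.lTensor_preserves_injective_linearMap _ hj) h,
  fun h => snake1 (sz_exact A X) (cov_surj A X) hjq hq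
    (Module.Flat.rTensor_preserves_injective_linearMap _ (szi_inj A X)) h⟩

theorem T1.left (h : T1 A X N) (hi : Function.Injective i) (hip : Function.Exact i p)
    (hp : Function.Surjective p) : Function.Injective (i.rTensor N) :=
  snake1 hip hp (sz_exact A N) (cov_surj A N)
    (Module.Flat.rTensor_preserves_injective_linearMap _ hi)
    ((T1_iff_right (szi_inj A N) (sz_exact A N) (cov_surj A N)).1 h)

theorem T1_of_left (h : T1 A F N) (hip : Function.Exact i p)
    (hp : Function.Surjective p) (h2 : Function.Injective (i.rTensor N)) : T1 A X N :=
  (T1_iff_right (szi_inj A N) (sz_exact A N) (cov_surj A N)).2 <|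
  snake2 hip hp (sz_exact A N) (cov_surj A N)
    ((T1_iff_right (szi_inj A N) (sz_exact A N) (cov_surj A N)).1 h) h2

theorem T1_flat_left [Module.Flat A F] : T1 A F N :=
  (T1_iff_right (szi_inj A N) (sz_exact A N) (cov_surj A N)).2 <|
    Module.Flat.lTensor_preserves_injective_linearMap _ (szi_inj A N)

theorem T1_flat_right [Module.Flat A N] : T1 A X N :=
  Module.Flat.rTensor_preserves_injective_linearMap _ (szi_inj A X)

theorem shift1 (hi : Function.Injective i) (hip : Function.Exact i p)
    (hp : Function.Surjective p) (hj : Function.Injective j) (hjq : Function.Exact j q)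
    (hq : Function.Surjective q) [Module.Flat A P] (h1 : T1 A X N1) (h2 : T1 A F N) :
    T1 A K N := by
  rw [T1_iff_right hj hjq hq] at h2 ⊢
  have h3 := h1.left hi hip hp
  have h4 : Function.Injective (i.rTensor P ∘ j.lTensor K) := by
    have : (i.rTensor P ∘ j.lTensor K) = j.lTensor F ∘ i.rTensor N1 := by
      funext x; exact (sq_comm i j x).symm
    rw [this]
    exact h2.comp h3
  exact h4.of_comp

theorem shift2 (hi : Function.Injective i) (hip : Function.Exact i p)
    (hp : Function.Surjective p) (hj : Function.Injective j) (hjq : Function.Exact j q)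
    (hq : Function.Surjective q) [Module.Flat A P] (h1 : T1 A K N) (h2 : T1 A F N1) :
    T1 A X N1 := by
  rw [T1_iff_right hj hjq hq] at h1
  apply T1_of_left h2 hip hp
  have h4 : Function.Injective (j.lTensor F ∘ i.rTensor N1) := by
    have : (i.rTensor P ∘ j.lTensor K) = j.lTensor F ∘ i.rTensor N1 := by
      funext x; exact (sq_comm i j x).symm
    rw [← this]
    exact (Module.Flat.rTensor_preserves_injective_linearMap _ hi).comp h1
  exact h4.of_comp

theorem T1_shift (hj : Function.Injective j) (hjq : Function.Exact j q)
    (hq : Function.Surjective q) [Module.Flat A P] : T1 A (Sz A X) N ↔ T1 A X N1 :=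
  ⟨fun h => shift2 (szi_inj A X) (sz_exact A X) (cov_surj A X) hj hjq hq h
    T1_flat_left,
   fun h => shift1 (szi_inj A X) (sz_exact A X) (cov_surj A X) hj hjq hq h
    T1_flat_left⟩

theorem T1_shift' : T1 A (Sz A X) N ↔ T1 A X (Sz A N) :=
  T1_shift (szi_inj A N) (sz_exact A N) (cov_surj A N)

theorem T1_congr_left {X' : Type*} [AddCommGroup X'] [Module A X'] (e : X ≃ₗ[A] X')
    (h : T1 A X N) : T1 A X' N := by
  have h1 := h.left (i := (szi A X)) (p := cov A X) (szi_inj A X)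
    (sz_exact A X) (cov_surj A X)
  refine T1_of_left (i := (szi A X)) (p := e.toLinearMap ∘ₗ cov A X) T1_flat_left ?_ ?_ h1
  · intro x
    rw [← sz_exact A X x]; simp
  · exact e.surjective.comp (cov_surj A X)

/-- a retract in the second variable -/
theorem T1_retract_right {N' : Type*} [AddCommGroup N'] [Module A N'] (s : N' →ₗ[A] N)
    (r : N →ₗ[A] N') (hrs : r ∘ₗ s = LinearMap.id) (h : T1 A X N) : T1 A X N' := by
  have h1 : Function.Injective (s.lTensor (Sz A X)) := by
    apply Function.LeftInverse.injective (g := r.lTensor (Sz A X))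
    intro x
    rw [← LinearMap.comp_apply, ← LinearMap.lTensor_comp, hrs]; simp
  have h4 : Function.Injective (s.lTensor (Fr A X) ∘ (szi A X).rTensor N') := by
    have : s.lTensor (Fr A X) ∘ (szi A X).rTensor N'
       = (szi A X).rTensor N ∘ s.lTensor (Sz A X) := by
      funext x; exact (sq_comm _ s x)
    rw [this]
    exact Function.Injective.comp h h1
  exact h4.of_comp

end T1

theorem flat_of_T1 {A : Type u} [CommRing A] {N : Type u} [AddCommGroup N] [Module A N]
    (h : ∀ I : Ideal A, T1 A (A ⧸ I) N) : Module.Flat A N := by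
  rw [Module.Flat.iff_rTensor_injective']
  intro I
  exact (h I).left (p := I.mkQ) (Submodule.subtype_injective _)
    (LinearMap.exact_subtype_mkQ I) (Submodule.mkQ_surjective _)

theorem flat_of_T1_residueField {A : Type u} [CommRing A] [IsLocalRing A] [IsNoetherianRing A]
    {N : Type u} [AddCommGroup N] [Module A N] [Module.Finite A N]
    (h : T1 A (ResidueField A) N) : Module.Flat A N := by
  rw [T1_iff_right (szi_inj A N) (sz_exact A N) (cov_surj A N)] at h
  have := fr_finite A N
  have := sz_finite A N
  have := Module.free_of_lTensor_residueField_injective _ _ (cov_surj A N) (sz_exact A N) h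
  infer_instance

end CIT

namespace CIT

/-- Vanishing of `Tor_{n+1}`. -/
def TT (A : Type u) [CommRing A] : ℕ → ∀ (X : Type u) [AddCommGroup X] [Module A X]
    (N : Type u) [AddCommGroup N] [Module A N], Prop
  | 0 => fun X _ _ N _ _ => T1 A X N
  | n + 1 => fun X _ _ N _ _ => TT A n (Sz A X) N

section
variable {A : Type u} [CommRing A]
variable {K F X N1 P N : Type u} [AddCommGroup K] [AddCommGroup F] [AddCommGroup X]
  [AddCommGroup N1] [AddCommGroup P] [AddCommGroup N]
  [Module A K] [Module A F] [Module A X] [Module A N1] [Module A P] [Module A N]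
  {i : K →ₗ[A] F} {p : F →ₗ[A] X} {j : N1 →ₗ[A] P} {q : P →ₗ[A] N}

theorem TT_shift (hj : Function.Injective j) (hjq : Function.Exact j q)
    (hq : Function.Surjective q) [Module.Flat A P] (n : ℕ) : TT A (n + 1) X N ↔ TT A n X N1 := by
  induction n generalizing X with
  | zero => exact T1_shift hj hjq hq
  | succ n ih => exact ih

theorem TT_shift' (n : ℕ) : TT A (n + 1) X N ↔ TT A n X (Sz A N) :=
  TT_shift (szi_inj A N) (sz_exact A N) (cov_surj A N) n

theorem exists_syz (n : ℕ) (N : Type u) [AddCommGroup N] [Module A N] :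
    ∃ (N' : Type u) (_ : AddCommGroup N') (_ : Module A N'),
      (∀ (j : ℕ) (X : Type u) [AddCommGroup X] [Module A X], TT A (j + n) X N ↔ TT A j X N') ∧
      (IsNoetherianRing A → Module.Finite A N → Module.Finite A N') := by
  induction n generalizing N with
  | zero => exact ⟨N, _, _, fun j X _ _ => Iff.rfl, fun _ h => h⟩
  | succ n ih =>
    obtain ⟨N', _, _, h, hf⟩ := ih (Sz A N)
    refine ⟨N', _, _, fun j X _ _ => ?_, fun _ _ => hf ‹_› (sz_finite A N)⟩
    rw [← h, ← add_assoc, TT_shift']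

theorem TT_shift1 (hi : Function.Injective i) (hip : Function.Exact i p)
    (hp : Function.Surjective p) (n : ℕ) (h1 : TT A (n + 1) X N) (h2 : TT A n F N) :
    TT A n K N := by
  obtain ⟨N', _, _, h, -⟩ := exists_syz (A := A) n N
  rw [← zero_add n, h] at h2 ⊢
  rw [add_comm, h 1] at h1
  rw [TT_shift'] at h1
  exact shift1 hi hip hp (szi_inj A N') (sz_exact A N') (cov_surj A N') h1 h2

theorem TT_shift2 (hi : Function.Injective i) (hip : Function.Exact i p)
    (hp : Function.Surjective p) (n : ℕ) (h1 : TT A n K N) (h2 : TT A (n + 1) F N) :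
    TT A (n + 1) X N := by
  obtain ⟨N', _, _, h, -⟩ := exists_syz (A := A) n N
  rw [← zero_add n, h] at h1
  rw [add_comm, h 1, TT_shift'] at h2 ⊢
  exact shift2 hi hip hp (szi_inj A N') (sz_exact A N') (cov_surj A N') h1 h2

theorem TT_flat_right [Module.Flat A N] (n : ℕ) : TT A n X N := by
  induction n generalizing X with
  | zero => exact T1_flat_right
  | succ n ih => exact ih

theorem TT_flat_left [Module.Flat A X] (n : ℕ) : TT A n X N := by
  induction n generalizing N with
  | zero => exact T1_flat_left
  | succ n ih => rw [TT_shift']; exact ih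

theorem TT_congr_left {X' : Type u} [AddCommGroup X'] [Module A X'] (e : X ≃ₗ[A] X') (n : ℕ)
    (h : TT A n X N) : TT A n X' N := by
  induction n generalizing N with
  | zero => exact T1_congr_left e h
  | succ n ih => rw [TT_shift'] at h ⊢; exact ih h

theorem TT_retract_right {N' : Type u} [AddCommGroup N'] [Module A N'] (s : N' →ₗ[A] N)
    (r : N →ₗ[A] N') (hrs : r ∘ₗ s = LinearMap.id) (n : ℕ) (h : TT A n X N) : TT A n X N' := by
  induction n generalizing X with
  | zero => exact T1_retract_right s r hrs h
  | succ n ih => exact ih h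

end

section
variable {A : Type u} [CommRing A]

theorem TT_of_flatDimLE (n : ℕ) (N : Type u) [AddCommGroup N] [Module A N] (h : FlatDimLE A n N)
    (X : Type u) [AddCommGroup X] [Module A X] : TT A n X N := by
  induction n generalizing N X with
  | zero => have : Module.Flat A N := h; exact TT_flat_right 0
  | succ n ih =>
    obtain ⟨F, _, _, hF, f, hf, hk⟩ := h
    rw [TT_shift (Submodule.subtype_injective _) (LinearMap.exact_subtype_ker_map f) hf]
    exact ih _ hk _

theorem TT_mono (n m : ℕ) (hnm : n ≤ m) (N : Type u) [AddCommGroup N] [Module A N]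
    (h : ∀ (X : Type u) [AddCommGroup X] [Module A X], TT A n X N)
    (X : Type u) [AddCommGroup X] [Module A X] : TT A m X N := by
  induction m, hnm using Nat.le_induction generalizing X with
  | base => exact h X
  | succ m _ ih => exact ih _

theorem flatDimLE_of_TT (n : ℕ) (N : Type u) [AddCommGroup N] [Module A N]
    (h : ∀ (X : Type u) [AddCommGroup X] [Module A X], TT A n X N) : FlatDimLE A n N := by
  induction n generalizing N with
  | zero => exact flat_of_T1 fun I => h _
  | succ n ih =>
    refine ⟨Fr A N, _, _, inferInstance, cov A N, cov_surj A N, ?_⟩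
    exact ih (Sz A N) fun X _ _ => (TT_shift' n).1 (h X)

theorem flatDimLE_of_TT_residueField [IsLocalRing A] [IsNoetherianRing A] (n : ℕ)
    (N : Type u) [AddCommGroup N] [Module A N] [Module.Finite A N]
    (h : TT A n (ResidueField A) N) : FlatDimLE A n N := by
  induction n generalizing N with
  | zero => exact flat_of_T1_residueField h
  | succ n ih =>
    have := sz_finite A N
    exact ⟨Fr A N, _, _, inferInstance, cov A N, cov_surj A N,
      ih (Sz A N) ((TT_shift' n).1 h)⟩

theorem TT_of_projDimLE (n : ℕ) (X : Type u) [AddCommGroup X] [Module A X] (h : ProjDimLE A n X)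
    (N : Type u) [AddCommGroup N] [Module A N] : TT A n X N := by
  induction n generalizing X with
  | zero => have : Module.Projective A X := h; exact TT_flat_left 0
  | succ n ih =>
    obtain ⟨F, _, _, hF, f, hf, hk⟩ := h
    exact TT_shift2 (Submodule.subtype_injective _) (LinearMap.exact_subtype_ker_map f) hf n
      (ih _ hk) (TT_flat_left _)

theorem TT_of_projDimLE' (n m : ℕ) (hnm : n ≤ m) (X : Type u) [AddCommGroup X] [Module A X]
    (h : ProjDimLE A n X) (N : Type u) [AddCommGroup N] [Module A N] : TT A m X N := by
  induction m, hnm using Nat.le_induction generalizing N with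
  | base => exact TT_of_projDimLE n X h N
  | succ m _ ih => rw [TT_shift']; exact ih _

theorem exact_of_TT (n : ℕ) (P : ℕ → Type u) [∀ i, AddCommGroup (P i)] [∀ i, Module A (P i)]
    [∀ i, Module.Flat A (P i)] (d : ∀ i, P (i + 1) →ₗ[A] P i)
    (hd : ∀ i, Function.Exact (d (i + 1)) (d i)) (N : Type u) [AddCommGroup N] [Module A N]
    (π : P 0 →ₗ[A] N) (hπ : Function.Surjective π) (h0 : Function.Exact (d 0) π)
    (X : Type u) [AddCommGroup X] [Module A X] (h : TT A n X N) :
    Function.Exact ((d (n + 1)).lTensor X) ((d n).lTensor X) := by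
  induction n generalizing P N with
  | zero =>
    have hr : ∀ x, d 0 x ∈ LinearMap.ker π := fun x => (h0 _).2 ⟨x, rfl⟩
    let d' : P 1 →ₗ[A] LinearMap.ker π := (d 0).codRestrict _ hr
    have hd' : Function.Surjective d' := by
      rintro ⟨y, hy⟩
      obtain ⟨x, hx⟩ := (h0 y).1 hy
      exact ⟨x, Subtype.ext hx⟩
    have e : Function.Exact (d 1) d' := by
      intro x
      rw [← hd 0 x]
      exact Subtype.ext_iff
    have h1 := lTensor_exact X e hd'
    have h2 := (T1_iff_right (X := X) (Submodule.subtype_injective _)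
      (LinearMap.exact_subtype_ker_map π) hπ).1 h
    have h3 : d 0 = (LinearMap.ker π).subtype ∘ₗ d' := rfl
    intro x
    rw [← h1 x, h3, LinearMap.lTensor_comp, LinearMap.comp_apply]
    exact map_eq_zero_iff _ h2
  | succ n ih =>
    have hr : ∀ x, d 0 x ∈ LinearMap.ker π := fun x => (h0 _).2 ⟨x, rfl⟩
    let d' : P 1 →ₗ[A] LinearMap.ker π := (d 0).codRestrict _ hr
    have hd' : Function.Surjective d' := by
      rintro ⟨y, hy⟩
      obtain ⟨x, hx⟩ := (h0 y).1 hy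
      exact ⟨x, Subtype.ext hx⟩
    have e : Function.Exact (d 1) d' := by
      intro x
      rw [← hd 0 x]
      exact Subtype.ext_iff
    rw [TT_shift (Submodule.subtype_injective _) (LinearMap.exact_subtype_ker_map π) hπ] at h
    exact ih (fun i => P (i + 1)) (fun i => d (i + 1)) (fun i => hd (i + 1)) _ d' hd' e h

end
end CIT

namespace CIT

theorem torVanish_of_TT {A : Type u} [CommRing A] (n : ℕ) (X N : Type u) [AddCommGroup X]
    [Module A X] [AddCommGroup N] [Module A N] (h : TT A n X N) : TorVanish A (n + 1) X N := by
  unfold TorVanish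
  let P : ProjectiveResolution (ModuleCat.of A N) := projectiveResolution _
  let G := MonoidalCategory.tensorLeft (ModuleCat.of A X)
  have e : ((Tor (ModuleCat.{u} A) (n + 1)).obj (ModuleCat.of A X)).obj (ModuleCat.of A N) ≅ _ :=
    P.isoLeftDerivedObj G (n + 1)
  rw [← ModuleCat.isZero_iff_subsingleton]
  refine Limits.IsZero.of_iso ?_ e
  have : ((G.mapHomologicalComplex _).obj P.complex).ExactAt (n + 1) := by
    rw [HomologicalComplex.exactAt_iff' _ (n + 2) (n + 1) n (by simp) (by simp)]
    rw [ShortComplex.ShortExact.moduleCat_exact_iff_function_exact]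
    have hfl : ∀ i, Module.Flat A (P.complex.X i) := fun i => by
      have := P.projective i
      have : Module.Projective A (P.complex.X i) := (IsProjective.iff_projective _).2 this
      infer_instance
    have := exact_of_TT n (fun i => P.complex.X i) (fun i => (P.complex.d (i + 1) i).hom)
      (fun i => (ShortComplex.ShortExact.moduleCat_exact_iff_function_exact _).1 (P.exact_succ i)) N
      (P.π.f 0).hom ((ModuleCat.epi_iff_surjective _).1 inferInstance)
      ((ShortComplex.ShortExact.moduleCat_exact_iff_function_exact _).1 P.exact₀) X h
    exact this
  exact this.isZero_homology

end CIT

namespace CIT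
open TensorProduct

section
variable {A : Type u} [CommRing A]

theorem T1_comm (X N : Type u) [AddCommGroup X] [Module A X] [AddCommGroup N] [Module A N] :
    T1 A X N ↔ T1 A N X := by
  rw [T1_iff_right (X := N) (szi_inj A X) (sz_exact A X) (cov_surj A X)]
  unfold T1
  have h : (⇑((szi A X).lTensor N) : _ → _) =
      (TensorProduct.comm A (Fr A X) N) ∘ ((szi A X).rTensor N) ∘
        (TensorProduct.comm A N (Sz A X)) := by
    funext x
    simp only [Function.comp]
    rw [LinearMap.lTensor, LinearMap.rTensor]
    have := TensorProduct.map_comm (R := A) (LinearMap.id (M := N)) (szi A X)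
      (TensorProduct.comm A N (Sz A X) x)
    simp at this
    rw [← this]
  rw [h]
  simp

theorem TT_comm (n : ℕ) (X N : Type u) [AddCommGroup X] [Module A X] [AddCommGroup N]
    [Module A N] : TT A n X N ↔ TT A n N X := by
  induction n generalizing X with
  | zero => exact T1_comm X N
  | succ n ih => rw [TT_shift' (X := N)]; exact ih _

theorem TT_regular (rs : List A) (n : ℕ) (D N : Type u) [AddCommGroup D] [Module A D]
    [AddCommGroup N] [Module A N] (hrs : RingTheory.Sequence.IsWeaklyRegular D rs)
    (h : ∀ i ≥ n, TT A i D N) :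
    ∀ i ≥ n + rs.length, TT A i (D ⧸ (Ideal.ofList rs • ⊤ : Submodule A D)) N := by
  induction rs generalizing n D with
  | nil =>
    intro i hi
    refine TT_congr_left ?_ i (h i hi)
    exact (Submodule.quotEquivOfEqBot _ (by simp)).symm
  | cons r rs ih =>
    rw [RingTheory.Sequence.isWeaklyRegular_cons_iff] at hrs
    have h1 : ∀ i ≥ n + 1, TT A i (QuotSMulTop r D) N := by
      intro i hi
      obtain ⟨i, rfl⟩ : ∃ k, i = k + 1 := ⟨i - 1, by omega⟩
      refine TT_shift2 (i := LinearMap.lsmul A D r) (p := Submodule.mkQ _) hrs.1 ?_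
        (Submodule.mkQ_surjective _) i (h i (by omega)) (h _ (by omega))
      intro x
      rw [Submodule.mkQ_apply, Submodule.Quotient.mk_eq_zero]
      rw [Submodule.mem_smul_pointwise_iff_exists]
      simp
    intro i hi
    refine TT_congr_left (Submodule.quotOfListConsSMulTopEquivQuotSMulTopInner D r rs).symm i ?_
    exact ih (n + 1) (QuotSMulTop r D) hrs.2 h1 i (by simp at hi; omega)

end

section BC
variable {S T : Type u} [CommRing S] [CommRing T] [Algebra S T]

theorem BC_inj {X K F : Type u} [AddCommGroup X] [Module S X] [Module T X] [IsScalarTower S T X]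
    [AddCommGroup K] [Module S K] [AddCommGroup F] [Module S F] (i : K →ₗ[S] F) :
    Function.Injective (i.lTensor X) ↔ Function.Injective ((i.baseChange T).lTensor X) := by
  have h : (i.lTensor X) ∘ (AlgebraTensorModule.cancelBaseChange S T T X K) =
      (AlgebraTensorModule.cancelBaseChange S T T X F) ∘ ((i.baseChange T).lTensor X) := by
    funext x
    induction x using TensorProduct.induction_on with
    | zero => simp
    | tmul x y =>
      induction y using TensorProduct.induction_on with
      | zero => simp
      | tmul t k => simp
      | add a b ha hb => simp only [tmul_add, Function.comp, map_add] at *; rw [ha, hb]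
    | add a b ha hb => simp only [Function.comp, map_add] at *; rw [ha, hb]
  rw [← EquivLike.injective_comp (AlgebraTensorModule.cancelBaseChange S T T X K), h,
    EquivLike.comp_injective]

theorem BC_exact {K F O : Type u} [AddCommGroup O] [Module S O]
    [AddCommGroup K] [Module S K] [AddCommGroup F] [Module S F] (i : K →ₗ[S] F) (p : F →ₗ[S] O)
    (h : Function.Exact i p) (hp : Function.Surjective p) :
    Function.Exact (i.baseChange T) (p.baseChange T) ∧
      Function.Surjective (p.baseChange T) :=
  ⟨lTensor_exact T h hp, LinearMap.lTensor_surjective T hp⟩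

theorem BC (n : ℕ) (X O : Type u) [AddCommGroup X] [Module S X] [Module T X] [IsScalarTower S T X]
    [AddCommGroup O] [Module S O] (h : ∀ i, TT S i T O) :
    TT S n X O ↔ TT T n X (T ⊗[S] O) := by
  have h0 : Function.Injective ((szi S O).baseChange T) :=
    (T1_iff_right (szi_inj S O) (sz_exact S O) (cov_surj S O)).1 (h 0)
  obtain ⟨h1, h2⟩ := BC_exact (T := T) _ _ (sz_exact S O) (cov_surj S O)
  induction n generalizing O with
  | zero =>
    show T1 S X O ↔ T1 T X (T ⊗[S] O)
    rw [T1_iff_right (szi_inj S O) (sz_exact S O) (cov_surj S O), T1_iff_right h0 h1 h2]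
    exact BC_inj _
  | succ n ih =>
    have h' : ∀ i, TT S i T (Sz S O) := fun i => (TT_shift' i).1 (h (i + 1))
    rw [TT_shift', TT_shift h0 h1 h2]
    obtain ⟨h3, h4⟩ := BC_exact (T := T) _ _ (sz_exact S (Sz S O)) (cov_surj S (Sz S O))
    refine ih (Sz S O) h' ?_ h3 h4
    exact (T1_iff_right (szi_inj S _) (sz_exact S _) (cov_surj S _)).1 (h' 0)

end BC

theorem TT_congr_right {A : Type u} [CommRing A] {X N N' : Type u} [AddCommGroup X] [Module A X]
    [AddCommGroup N] [Module A N] [AddCommGroup N'] [Module A N'] (e : N ≃ₗ[A] N') (n : ℕ) :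
    TT A n X N ↔ TT A n X N' := by
  rw [TT_comm, TT_comm n X]
  exact ⟨TT_congr_left e n, TT_congr_left e.symm n⟩

theorem BC2 (A A' Q : Type u) [CommRing A] [CommRing A'] [CommRing Q] [Algebra A A'] [Algebra Q A']
    [Module.Flat A A'] (O : Type u) [AddCommGroup O] [Module Q O] (h : ∀ i, TT Q i A' O)
    (N : Type u) [AddCommGroup N] [Module A N] [Module A' N] [IsScalarTower A A' N]
    (eN : N ≃ₗ[A'] A' ⊗[Q] O)
    (Y : Type u) [AddCommGroup Y] [Module A Y]
    (L : Type u) [AddCommGroup L] [Module Q L] [Module A' L] [IsScalarTower Q A' L]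
    (eL : L ≃ₗ[A'] A' ⊗[A] Y) (n : ℕ) :
    TT A n Y N ↔ TT Q n L O := by
  have h1 := BC (S := Q) (T := A') n L O h
  have h2 := BC (S := A) (T := A') n N Y fun i => TT_flat_left i
  rw [h1, TT_comm, h2, TT_comm, TT_congr_right eN, TT_comm, ← TT_congr_right eL, TT_comm]

end CIT

namespace CIT
open TensorProduct

theorem exists_restrict (A A' : Type u) [CommRing A] [CommRing A'] [Algebra A A'] (L : Type u)
    [AddCommGroup L] [Module A' L] : ∃ (N : Type u) (_ : AddCommGroup N) (_ : Module A N)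
      (_ : Module A' N) (_ : IsScalarTower A A' N), Nonempty (N ≃ₗ[A'] L) := by
  let _ := Module.compHom L (algebraMap A A')
  exact ⟨L, inferInstance, inferInstance, inferInstance, ⟨fun a b c => by
    rw [Algebra.smul_def, mul_smul]; rfl⟩, ⟨LinearEquiv.refl _ _⟩⟩

theorem TT_deformation (Q A' : Type u) [CommRing Q] [CommRing A'] [Algebra Q A']
    (hs : Function.Surjective (algebraMap Q A')) (rs : List Q)
    (hrs : RingTheory.Sequence.IsWeaklyRegular Q rs)
    (hk : RingHom.ker (algebraMap Q A') = Ideal.ofList rs) (i : ℕ) (hi : rs.length ≤ i)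
    (N : Type u) [AddCommGroup N] [Module Q N] : TT Q i A' N := by
  have h := TT_regular rs 0 Q N hrs (fun i _ => TT_flat_left i) i (by omega)
  refine TT_congr_left ?_ i h
  have hk' : LinearMap.ker (Algebra.linearMap Q A') = (Ideal.ofList rs • ⊤ : Submodule Q Q) := by
    rw [Ideal.smul_top_eq_map]
    ext x
    simp [← hk, RingHom.mem_ker]
  exact (Submodule.quotEquivOfEq _ _ hk').symm.trans
    (LinearMap.quotKerEquivOfSurjective (Algebra.linearMap Q A') hs)

theorem TT_residue (Q D : Type u) [CommRing Q] [CommRing D] [IsLocalRing Q] [IsLocalRing D]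
    [Algebra Q D] (hs : Function.Surjective (algebraMap Q D)) (ys : List D)
    (hys : RingTheory.Sequence.IsWeaklyRegular D ys) (hm : Ideal.ofList ys = maximalIdeal D)
    (n : ℕ) (N : Type u) [AddCommGroup N] [Module Q N] (h : ∀ i ≥ n, TT Q i D N) :
    ∃ i, TT Q i (ResidueField Q) N := by
  obtain ⟨zs, rfl⟩ : ∃ zs : List Q, zs.map (algebraMap Q D) = ys :=
    (List.map_surjective_iff.2 hs) ys
  rw [RingTheory.Sequence.isWeaklyRegular_map_algebraMap_iff] at hys
  refine ⟨_, TT_congr_left ?_ _ (TT_regular zs n D N hys h _ le_rfl)⟩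
  let g : Q →ₗ[Q] D ⧸ (Ideal.ofList zs • ⊤ : Submodule Q D) :=
    (Submodule.mkQ _) ∘ₗ Algebra.linearMap Q D
  have hg : Function.Surjective g := (Submodule.mkQ_surjective _).comp hs
  have hk : LinearMap.ker g = maximalIdeal Q := by
    ext q
    simp only [g, LinearMap.mem_ker, LinearMap.comp_apply, Submodule.mkQ_apply,
      Submodule.Quotient.mk_eq_zero, Algebra.linearMap_apply]
    rw [Ideal.smul_top_eq_map, Submodule.restrictScalars_mem, Ideal.map_ofList, hm]
    have : IsLocalHom (algebraMap Q D) := hs.isLocalHom _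
    rw [mem_maximalIdeal, mem_maximalIdeal, mem_nonunits_iff, mem_nonunits_iff,
      isUnit_map_iff]
  exact ((Submodule.quotEquivOfEq _ _ hk).symm.trans (LinearMap.quotKerEquivOfSurjective g hg)).symm

theorem test_step (A M : Type u) [CommRing A] [IsLocalRing A] [IsNoetherianRing A]
    [AddCommGroup M] [Module A M] (htest : IsTestModule A M)
    (A' : Type u) [CommRing A'] [IsLocalRing A'] [IsNoetherianRing A'] [Algebra A A']
    [Module.Flat A A'] (hloc : IsLocalHom (algebraMap A A'))
    (ys : List (A' ⧸ Ideal.map (algebraMap A A') (maximalIdeal A)))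
    [IsLocalRing (A' ⧸ Ideal.map (algebraMap A A') (maximalIdeal A))]
    (hys : RingTheory.Sequence.IsWeaklyRegular
      (A' ⧸ Ideal.map (algebraMap A A') (maximalIdeal A)) ys)
    (hm : Ideal.ofList ys = maximalIdeal (A' ⧸ Ideal.map (algebraMap A A') (maximalIdeal A)))
    (Q : Type u) [CommRing Q] [IsLocalRing Q] [IsNoetherianRing Q] (f : Q →+* A')
    (hf : Function.Surjective f) (rs : List Q)
    (hrs : RingTheory.Sequence.IsWeaklyRegular Q rs) (hk : RingHom.ker f = Ideal.ofList rs)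
    (L : Type u) [AddCommGroup L] [Module A' L] (e : L ≃ₗ[A'] A' ⊗[A] M) (n : ℕ)
    (hp : letI := Module.compHom L f; ProjDimLE Q n L) : ∃ n, FlatDimLE Q n (ResidueField Q) := by
  let _ : Algebra Q A' := f.toAlgebra
  let _ : Module Q L := Module.compHom L f
  have : IsScalarTower Q A' L := ⟨fun a b c => by
    rw [Algebra.smul_def, mul_smul]; rfl⟩
  have hA' := TT_deformation Q A' hf rs hrs hk
  obtain ⟨O, _, _, hO, hOf⟩ := exists_syz (A := Q) rs.length (ResidueField Q)
  have hOf' := hOf inferInstance inferInstance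
  have hO' : ∀ i, TT Q i A' O := fun i => (hO i A').1 (hA' _ (by omega) _)
  obtain ⟨N, _, _, _, _, ⟨eN⟩⟩ := exists_restrict A A' (A' ⊗[Q] O)
  have hN : Module.Finite A' N := Module.Finite.equiv eN.symm
  have hTor : ∃ i₀ : ℕ, ∀ i ≥ i₀, TorVanish A i M N := by
    refine ⟨n + 1, fun i hi => ?_⟩
    obtain ⟨i, rfl⟩ : ∃ k, i = k + 1 := ⟨i - 1, by omega⟩
    apply torVanish_of_TT
    rw [BC2 A A' Q O hO' N eN M L e]
    exact TT_of_projDimLE' n i (by omega) L hp O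
  obtain ⟨n', hn'⟩ := htest A' hloc N hN hTor
  have hT : ∀ i ≥ n', TT A i (A ⧸ maximalIdeal A) N := fun i hi =>
    TT_mono n' i hi N (fun X _ _ => TT_of_flatDimLE n' N hn' X) _
  let D := A' ⧸ Ideal.map (algebraMap A A') (maximalIdeal A)
  have eD : D ≃ₗ[A'] A' ⊗[A] (A ⧸ maximalIdeal A) := (Algebra.TensorProduct.quotIdealMapEquivTensorQuot A' (maximalIdeal A)).toLinearEquiv
  have hT2 : ∀ i ≥ n' + rs.length, TT Q i D (ResidueField Q) := by
    intro i hi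
    obtain ⟨j, rfl⟩ : ∃ k, i = k + rs.length := ⟨i - rs.length, by omega⟩
    rw [hO, ← BC2 A A' Q O hO' N eN _ D eD]
    exact hT j (by omega)
  obtain ⟨i, hi⟩ := TT_residue Q D (Ideal.Quotient.mk_surjective.comp hf) ys hys hm _ _ hT2
  exact ⟨i, flatDimLE_of_TT_residueField i _ hi⟩

end CIT

namespace CIT
open TensorProduct RingTheory.Sequence

/-- the maximal ideal is generated by a regular sequence of length `n` -/
def RegMax (Q : Type u) [CommRing Q] [IsLocalRing Q] (n : ℕ) : Prop :=
  ∃ rs : List Q, IsWeaklyRegular Q rs ∧ Ideal.ofList rs = maximalIdeal Q ∧ rs.length = n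

theorem smulRegular_weak_cons {Q : Type u} [CommRing Q] {x : Q} (hx : IsSMulRegular Q x)
    (zs : List Q) :
    IsWeaklyRegular Q (x :: zs) ↔ IsWeaklyRegular (Q ⧸ Ideal.span {x})
      (zs.map (algebraMap Q (Q ⧸ Ideal.span {x}))) := by
  rw [isWeaklyRegular_cons_iff, and_iff_right hx, isWeaklyRegular_map_algebraMap_iff]
  refine (Submodule.quotEquivOfEq _ _ ?_).isWeaklyRegular_congr zs
  simp [← Submodule.ideal_span_singleton_smul]

theorem nontrivial_quot {Q : Type u} [CommRing Q] [IsLocalRing Q] {I : Ideal Q}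
    (hI : I ≤ maximalIdeal Q) : Nontrivial (Q ⧸ I) :=
  Ideal.Quotient.nontrivial_iff.2 (fun h => (maximalIdeal.isMaximal Q).ne_top (top_le_iff.1 (h ▸ hI)))

theorem local_quot {Q : Type u} [CommRing Q] [IsLocalRing Q] {I : Ideal Q}
    (hI : I ≤ maximalIdeal Q) : IsLocalRing (Q ⧸ I) :=
  have := nontrivial_quot hI
  .of_surjective' _ Ideal.Quotient.mk_surjective

theorem span_singleton_le_max {Q : Type u} [CommRing Q] [IsLocalRing Q] {x : Q}
    (hx : x ∈ maximalIdeal Q) : Ideal.span {x} ≤ maximalIdeal Q := by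
  rwa [Ideal.span_singleton_le_iff_mem]

theorem map_maximalIdeal_quot {Q : Type u} [CommRing Q] [IsLocalRing Q] (I : Ideal Q)
    [IsLocalRing (Q ⧸ I)] :
    (maximalIdeal Q).map (algebraMap Q (Q ⧸ I)) = maximalIdeal (Q ⧸ I) := by
  have h : Function.Surjective (algebraMap Q (Q ⧸ I)) := Ideal.Quotient.mk_surjective
  have : IsLocalHom (algebraMap Q (Q ⧸ I)) := h.isLocalHom _
  rw [← (IsLocalRing.maximalIdeal_comap (algebraMap Q (Q ⧸ I))), Ideal.map_comap_of_surjective _ h]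

theorem regMax_cons {Q : Type u} [CommRing Q] [IsLocalRing Q] {x : Q} (hx : x ∈ maximalIdeal Q)
    (hreg : IsSMulRegular Q x) [IsLocalRing (Q ⧸ Ideal.span {x})] {n : ℕ}
    (h : RegMax (Q ⧸ Ideal.span {x}) n) : RegMax Q (n + 1) := by
  obtain ⟨ys, h1, h2, h3⟩ := h
  obtain ⟨zs, rfl⟩ : ∃ zs : List Q, zs.map (algebraMap Q (Q ⧸ Ideal.span {x})) = ys :=
    (List.map_surjective_iff.2 Ideal.Quotient.mk_surjective) ys
  refine ⟨x :: zs, (smulRegular_weak_cons hreg zs).2 h1, ?_, by simpa using h3⟩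
  rw [← Ideal.map_ofList] at h2
  have h4 := congrArg (Ideal.comap (algebraMap Q (Q ⧸ Ideal.span {x}))) h2
  have h : Function.Surjective (algebraMap Q (Q ⧸ Ideal.span {x})) := Ideal.Quotient.mk_surjective
  have : IsLocalHom (algebraMap Q (Q ⧸ Ideal.span {x})) := h.isLocalHom _
  rw [IsLocalRing.maximalIdeal_comap, Ideal.comap_map_of_surjective _ h, ← RingHom.ker_eq_comap_bot,
    Ideal.Quotient.algebraMap_eq, Ideal.mk_ker] at h4
  rw [Ideal.ofList_cons, sup_comm, h4]

theorem regMax_zero {Q : Type u} [CommRing Q] [IsLocalRing Q] (h : maximalIdeal Q = ⊥) :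
    RegMax Q 0 := ⟨[], by simp, by simp [h], rfl⟩

/-- existence of a good element -/
theorem exists_good {Q : Type u} [CommRing Q] [IsLocalRing Q] [IsNoetherianRing Q]
    (S : Set (Ideal Q)) (hS : S.Finite) (hp : ∀ p ∈ S, p.IsPrime) (hm : maximalIdeal Q ∉ S)
    (h0 : maximalIdeal Q ≠ ⊥) :
    ∃ x ∈ maximalIdeal Q, x ∉ maximalIdeal Q ^ 2 ∧ ∀ p ∈ S, x ∉ p := by
  by_contra! hcon
  have h1 : (maximalIdeal Q : Set Q) ⊆ ⋃ i ∈ insert (maximalIdeal Q ^ 2) S, ((i : Ideal Q) : Set Q) := by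
    intro x hx
    by_cases h : x ∈ maximalIdeal Q ^ 2
    · simp [h]
    · obtain ⟨p, hpS, hxp⟩ := hcon x hx h
      simp only [Set.mem_iUnion]
      exact ⟨p, Or.inr hpS, hxp⟩
  have h2 := Ideal.subset_union_prime_finite (I := maximalIdeal Q) (hS.insert (maximalIdeal Q ^ 2))
    (f := id) (maximalIdeal Q ^ 2) (maximalIdeal Q ^ 2) ?_
  · obtain ⟨p, hp1, hp2⟩ := h2.1 h1
    rcases hp1 with rfl | hp1
    · apply h0
      refine Submodule.eq_bot_of_le_smul_of_le_jacobson_bot (maximalIdeal Q) _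
        (IsNoetherian.noetherian _) ?_ (maximalIdeal_le_jacobson _)
      rw [smul_eq_mul, ← pow_two]; exact hp2
    · have := hp p hp1
      exact hm ((IsLocalRing.eq_maximalIdeal ((maximalIdeal.isMaximal Q).eq_of_le this.ne_top hp2 ▸
        maximalIdeal.isMaximal Q : p.IsMaximal)) ▸ hp1)
  · intro i hi hi1 hi2
    rcases hi with rfl | hi
    · exact absurd rfl hi1
    · exact hp i hi

theorem finrank_quot_succ {Q : Type u} [CommRing Q] [IsLocalRing Q] [IsNoetherianRing Q] {x : Q}
    (hx : x ∈ maximalIdeal Q) (hx2 : x ∉ maximalIdeal Q ^ 2) [IsLocalRing (Q ⧸ Ideal.span {x})] :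
    (maximalIdeal (Q ⧸ Ideal.span {x})).spanFinrank + 1 ≤ (maximalIdeal Q).spanFinrank := by
  have hfg : (maximalIdeal Q).FG := IsNoetherian.noetherian _
  have hfin := Submodule.FG.finite_generators hfg
  set s : Finset Q := hfin.toFinset with hs
  have hspan : Ideal.span (s : Set Q) = maximalIdeal Q := by
    rw [hs, Set.Finite.coe_toFinset]; exact (maximalIdeal Q).span_generators
  have hcard : s.card = (maximalIdeal Q).spanFinrank := by
    rw [← Submodule.FG.generators_ncard hfg, Set.ncard_eq_toFinset_card _ hfin]
  rw [← hcard]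
  have hx' := hx
  rw [← hspan] at hx'
  obtain ⟨a, -, ha⟩ := Submodule.mem_span_finset.1 hx'
  obtain ⟨y, hy, hay⟩ : ∃ y ∈ s, IsUnit (a y) := by
    by_contra! hcon
    apply hx2
    rw [← ha, pow_two]
    refine Ideal.sum_mem _ fun y hy => Ideal.mul_mem_mul (hcon y hy) ?_
    rw [← hspan]; exact Ideal.subset_span hy
  classical
  have hle : maximalIdeal (Q ⧸ Ideal.span {x}) =
      Ideal.span ((s.erase y).image (algebraMap Q (Q ⧸ Ideal.span {x})) : Set (Q ⧸ Ideal.span {x})) := by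
    rw [← map_maximalIdeal_quot, ← hspan, Ideal.map_span]
    apply le_antisymm
    · rw [Ideal.span_le]
      rintro _ ⟨z, hz, rfl⟩
      by_cases hzy : z = y
      · subst hzy
        obtain ⟨u, hu⟩ := hay
        have h1 : ∑ w ∈ s, (algebraMap Q (Q ⧸ Ideal.span {x})) (a w • w) = 0 := by
          rw [← map_sum, ha, Ideal.Quotient.algebraMap_eq, Ideal.Quotient.eq_zero_iff_mem]
          exact Ideal.mem_span_singleton_self x
        rw [← Finset.add_sum_erase _ _ hy] at h1
        have h2 : algebraMap Q (Q ⧸ Ideal.span {x}) z = algebraMap Q (Q ⧸ Ideal.span {x}) ↑u⁻¹ *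
            algebraMap Q (Q ⧸ Ideal.span {x}) (a z • z) := by
          rw [← map_mul, ← hu]; simp
        rw [SetLike.mem_coe, h2, eq_neg_of_add_eq_zero_left h1]
        refine Ideal.mul_mem_left _ _ (neg_mem (Ideal.sum_mem _ fun w hw => ?_))
        rw [smul_eq_mul, map_mul]
        refine Ideal.mul_mem_left _ _ (Ideal.subset_span ?_)
        exact Finset.mem_image_of_mem _ hw
      · refine Ideal.subset_span ?_
        exact Finset.mem_image_of_mem _ (Finset.mem_erase.2 ⟨hzy, hz⟩)
    · apply Ideal.span_mono
      intro w hw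
      rw [Finset.mem_coe, Finset.mem_image] at hw
      obtain ⟨z, hz, rfl⟩ := hw
      exact ⟨z, Finset.mem_of_mem_erase hz, rfl⟩
  rw [hle]
  have h1 := Submodule.spanFinrank_span_le_ncard_of_finite (R := Q ⧸ Ideal.span {x})
    (((s.erase y).image (algebraMap Q (Q ⧸ Ideal.span {x}))).finite_toSet)
  rw [Set.ncard_coe_finset] at h1
  have h2 := Finset.card_image_le (s := s.erase y) (f := algebraMap Q (Q ⧸ Ideal.span {x}))
  rw [Finset.card_erase_of_mem hy] at h2
  have : 0 < s.card := Finset.card_pos.2 ⟨y, hy⟩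
  have h3 := h1.trans h2
  change Submodule.spanFinrank (Submodule.span _ _) + 1 ≤ _
  omega

end CIT

namespace CIT
open TensorProduct RingTheory.Sequence

theorem dim_le_quot_succ {Q : Type u} [CommRing Q] [IsLocalRing Q] [IsNoetherianRing Q] {x : Q}
    (hx : x ∈ maximalIdeal Q) : ringKrullDim Q ≤ ringKrullDim (Q ⧸ Ideal.span {x}) + 1 := by
  have := ringKrullDim_le_ringKrullDim_quotient_add_card {x} (R := Q) (by
    rw [ringJacobson_eq_maximalIdeal]; simpa using hx)
  rw [Finset.coe_singleton] at this
  simpa using this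

theorem regular_domain (n : ℕ) (D : Type u) [CommRing D] [IsLocalRing D] [IsNoetherianRing D]
    (h1 : (maximalIdeal D).spanFinrank ≤ n) (h2 : (n : WithBot ℕ∞) ≤ ringKrullDim D) :
    IsDomain D ∧ RegMax D n := by
  induction n generalizing D with
  | zero =>
    have h3 : maximalIdeal D = ⊥ := by
      rw [Nat.le_zero] at h1
      have h4 := Submodule.FG.generators_ncard (IsNoetherian.noetherian (maximalIdeal D))
      rw [h1, Set.ncard_eq_zero (Submodule.FG.finite_generators (IsNoetherian.noetherian _))] at h4
      rw [← (maximalIdeal D).span_generators, h4, Submodule.span_empty]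
    refine ⟨?_, regMax_zero h3⟩
    rw [← isField_iff_maximalIdeal_eq] at h3
    exact h3.isDomain
  | succ n ih =>
    have hm : maximalIdeal D ∉ minimalPrimes D := by
      intro h
      have h3 := Ideal.height_eq_zero_iff.2 h
      rw [← maximalIdeal_height_eq_ringKrullDim, h3] at h2
      norm_cast at h2
    have h0 : maximalIdeal D ≠ ⊥ := by
      intro h
      apply hm
      rw [h] at hm ⊢
      have : IsDomain D := by
        rw [← isField_iff_maximalIdeal_eq] at h
        exact h.isDomain
      rw [IsDomain.minimalPrimes_eq_singleton_bot]
      rfl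
    obtain ⟨x, hx, hx2, hxp⟩ := exists_good (minimalPrimes D)
      (minimalPrimes.finite_of_isNoetherianRing D) (fun p hp => hp.1.1) hm h0
    have := local_quot (span_singleton_le_max hx)
    have h3 := finrank_quot_succ hx hx2
    have h4 := dim_le_quot_succ hx
    obtain ⟨h5, h6⟩ := ih (D ⧸ Ideal.span {x}) (by omega) (by
      have := h2.trans h4
      push_cast at this
      exact ENat.WithBot.add_le_add_one_right_iff.1 this)
    have hpr : (Ideal.span {x}).IsPrime := (Ideal.Quotient.isDomain_iff_prime _).1 h5
    obtain ⟨P, hP, hPx⟩ := Ideal.exists_minimalPrimes_le (I := ⊥) (J := Ideal.span {x}) bot_le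
    have hPp : P.IsPrime := hP.1.1
    have hPb : P = ⊥ := by
      refine Submodule.eq_bot_of_le_smul_of_le_jacobson_bot (maximalIdeal D) _
        (IsNoetherian.noetherian _) ?_ (maximalIdeal_le_jacobson _)
      intro p hp
      obtain ⟨q, rfl⟩ := Ideal.mem_span_singleton'.1 (hPx hp)
      rw [mul_comm]
      exact Submodule.smul_mem_smul hx ((hPp.mem_or_mem hp).resolve_right (hxp P hP))
    have hdom : IsDomain D := by
      subst hPb
      exact IsDomain.of_bot_isPrime D
    refine ⟨hdom, regMax_cons hx ?_ h6⟩
    have : x ≠ 0 := fun h => hx2 (h ▸ zero_mem _)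
    exact fun a b h => mul_left_cancel₀ this h

theorem regularLocal_iff (D : Type u) [CommRing D] [IsLocalRing D] [IsNoetherianRing D] 
    (h : IsRegularLocal D) : ∃ n : ℕ, ringKrullDim D = n ∧ IsDomain D ∧ RegMax D n := by
  obtain ⟨-, -, s, hs, hc⟩ := h
  have := eq_maximalIdeal hs
  refine ⟨s.card, hc.symm, regular_domain _ D ?_ hc.le⟩
  rw [← this]
  have := Submodule.spanFinrank_span_le_ncard_of_finite (R := D) s.finite_toSet
  rwa [Set.ncard_coe_finset] at this

theorem RegMax.dim {D : Type u} [CommRing D] [IsLocalRing D] [IsNoetherianRing D] {n : ℕ}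
    (h : RegMax D n) : ringKrullDim D = n := by
  obtain ⟨rs, h1, h2, rfl⟩ := h
  have hreg : IsRegular D rs := by
    refine (IsLocalRing.isRegular_iff_isWeaklyRegular_of_subset_maximalIdeal ?_).2 ?_
    rotate_left
    · exact h1
    · intro r hr
      rw [← h2]; exact Ideal.subset_span hr
  have h3 := ringKrullDim_add_length_eq_ringKrullDim_of_isRegular rs hreg
  have h4 : ringKrullDim (D ⧸ Ideal.ofList rs) = 0 := by
    rw [h2]
    exact ringKrullDim_eq_zero_of_field (ResidueField D)
  rw [← h3, h4, zero_add]

theorem RegMax.isRegularLocal {D : Type u} [CommRing D] [IsLocalRing D] [IsNoetherianRing D] {n : ℕ}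
    (h : RegMax D n) : IsRegularLocal D := by
  classical
  have hd := h.dim
  obtain ⟨rs, h1, h2, h3⟩ := h
  have hsp : Ideal.span (rs.toFinset : Set D) = maximalIdeal D := by
    rw [← h2, Ideal.ofList]
    congr 1; ext; simp
  refine ⟨inferInstance, inferInstance, rs.toFinset, ?_, ?_⟩
  · rw [hsp]; infer_instance
  · apply le_antisymm
    · rw [hd, ← h3]
      exact_mod_cast List.toFinset_card_le rs
    · refine (ringKrullDim_le_spanFinrank_maximalIdeal D).trans ?_
      rw [← hsp]
      have := Submodule.spanFinrank_span_le_ncard_of_finite (R := D) rs.toFinset.finite_toSet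
      rw [Set.ncard_coe_finset] at this
      exact_mod_cast this

end CIT

namespace CIT
set_option linter.unusedSectionVars false
open TensorProduct RingTheory.Sequence

section serre
variable {Q : Type u} [CommRing Q] [IsLocalRing Q] [IsNoetherianRing Q]

theorem max_eq_bot_of_flat (h : Module.Flat Q (ResidueField Q)) : maximalIdeal Q = ⊥ := by
  have : Module.Finite Q (ResidueField Q) := Module.Finite.of_surjective
    (Algebra.linearMap Q (ResidueField Q)) residue_surjective
  have hfree : Module.Free Q (ResidueField Q) := Module.free_of_flat_of_isLocalRing
  rw [eq_bot_iff]
  intro a ha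
  have hf : FaithfulSMul Q (ResidueField Q) := inferInstance
  apply hf.eq_of_smul_eq_smul (α := ResidueField Q)
  intro z
  rw [zero_smul, Algebra.smul_def]
  have : algebraMap Q (ResidueField Q) a = 0 := (residue_eq_zero_iff a).2 ha
  rw [this, zero_mul]

theorem serre_socle (s : Q) (hs : s ≠ 0) (hsm : ∀ a ∈ maximalIdeal Q, a * s = 0) (d : ℕ)
    (h : FlatDimLE Q d (ResidueField Q)) : maximalIdeal Q = ⊥ := by
  have hfin : Module.Finite Q (ResidueField Q) := Module.Finite.of_surjective
    (Algebra.linearMap Q (ResidueField Q)) residue_surjective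
  induction d with
  | zero => exact max_eq_bot_of_flat h
  | succ d ih =>
    apply ih
    apply flatDimLE_of_TT_residueField
    let i : ResidueField Q →ₗ[Q] Q := Submodule.liftQ (maximalIdeal Q) (LinearMap.toSpanSingleton Q Q s)
      (fun a ha => by simpa using hsm a ha)
    have hi : Function.Injective i := by
      rw [injective_iff_map_eq_zero]
      intro z hz
      obtain ⟨a, rfl⟩ := residue_surjective z
      have h1 : a * s = 0 := hz
      rw [residue_eq_zero_iff]
      by_contra ha
      have hu : IsUnit a := by simpa using ha
      exact hs ((hu.mul_right_eq_zero).1 h1)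
    exact TT_shift1 (p := (LinearMap.range i).mkQ) hi (by
      rw [LinearMap.exact_iff]; simp) (Submodule.mkQ_surjective _) d
      (TT_of_flatDimLE _ _ h _) (TT_flat_left d)

theorem T1_quot_span (x : Q) (N : Type u) [AddCommGroup N] [Module Q N] (hx : IsSMulRegular N x) :
    T1 Q (Q ⧸ Ideal.span {x}) N := by
  refine T1_of_left (i := LinearMap.lsmul Q Q x) (p := (Ideal.span {x} : Submodule Q Q).mkQ)
    T1_flat_left ?_ (Submodule.mkQ_surjective _) ?_
  · rw [LinearMap.exact_iff, Submodule.ker_mkQ]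
    ext y
    simp only [Ideal.mem_span_singleton', LinearMap.mem_range, LinearMap.lsmul_apply, smul_eq_mul]
    simp only [mul_comm]
  · have h1 : IsSMulRegular (Q ⊗[Q] N) x := ((TensorProduct.lid Q N).isSMulRegular_congr x).2 hx
    intro a b hab
    apply h1
    have : ∀ c : Q ⊗[Q] N, (LinearMap.lsmul Q Q x).rTensor N c = x • c := by
      intro c
      induction c using TensorProduct.induction_on with
      | zero => simp
      | tmul a b => simp [TensorProduct.smul_tmul']
      | add a b ha hb => rw [map_add, ha, hb, smul_add]
    simpa only [this] using hab

theorem exists_functional (x : Q) (hx : x ∈ maximalIdeal Q) (hx2 : x ∉ maximalIdeal Q ^ 2) :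
    ∃ g : maximalIdeal Q →ₗ[Q] ResidueField Q, g ⟨x, hx⟩ = 1 := by
  let v : CotangentSpace Q := (maximalIdeal Q).toCotangent ⟨x, hx⟩
  have hv : v ≠ 0 := by
    intro h
    exact hx2 ((Ideal.toCotangent_eq_zero _ _).1 h)
  obtain ⟨f, hf⟩ := LinearMap.exists_leftInverse_of_injective
    (LinearMap.toSpanSingleton (ResidueField Q) (CotangentSpace Q) v)
    (LinearMap.ker_toSpanSingleton _ hv)
  refine ⟨(f.restrictScalars Q) ∘ₗ (maximalIdeal Q).toCotangent, ?_⟩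
  have := LinearMap.congr_fun hf 1
  simpa using this

theorem serre_step (x : Q) (hx : x ∈ maximalIdeal Q) (hx2 : x ∉ maximalIdeal Q ^ 2)
    (hreg : IsSMulRegular Q x) [IsLocalRing (Q ⧸ Ideal.span {x})] (d : ℕ)
    (h : FlatDimLE Q d (ResidueField Q)) :
    FlatDimLE (Q ⧸ Ideal.span {x}) d (ResidueField (Q ⧸ Ideal.span {x})) := by
  set R := Q ⧸ Ideal.span {x} with hR
  have hfin : Module.Finite R (ResidueField R) := Module.Finite.of_surjective
    (Algebra.linearMap R (ResidueField R)) residue_surjective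
  have hall : ∀ i, TT Q i R (maximalIdeal Q) := by
    rintro (_ | i)
    · refine T1_quot_span x _ ?_
      intro a b hab
      apply Subtype.ext
      exact hreg (congrArg Subtype.val hab)
    · refine TT_deformation Q R Ideal.Quotient.mk_surjective [x] ?_ ?_ (i + 1) (by simp) _
      · exact (isWeaklyRegular_singleton_iff _ _).2 hreg
      · rw [Ideal.ofList_singleton]; exact Ideal.mk_ker
  have h1 : TT Q d (ResidueField R) (maximalIdeal Q) := by
    rw [← TT_shift (N := ResidueField Q) (j := (maximalIdeal Q).subtype)
      (q := Algebra.linearMap Q (ResidueField Q))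
      (Submodule.subtype_injective _) ?_ residue_surjective d]
    · exact TT_mono d (d + 1) (by omega) _ (fun X _ _ => TT_of_flatDimLE d _ h X) _
    · intro y
      simp only [Algebra.linearMap_apply, Submodule.subtype_apply, Set.mem_range, Subtype.exists,
        exists_prop, exists_eq_right]
      exact residue_eq_zero_iff y
  have h2 := (BC (S := Q) (T := R) d (ResidueField R) (maximalIdeal Q) hall).1 h1
  apply flatDimLE_of_TT_residueField
  have hmax : ∀ a ∈ maximalIdeal R, ∃ q ∈ maximalIdeal Q, Ideal.Quotient.mk (Ideal.span {x}) q = a := by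
    intro a ha
    rw [← map_maximalIdeal_quot (Ideal.span {x})] at ha
    obtain ⟨q, hq, rfl⟩ := (Ideal.mem_map_iff_of_surjective _ Ideal.Quotient.mk_surjective).1 ha
    exact ⟨q, hq, rfl⟩
  have hmem : ∀ q ∈ maximalIdeal Q, Ideal.Quotient.mk (Ideal.span {x}) q ∈ maximalIdeal R := by
    intro q hq
    rw [← map_maximalIdeal_quot (Ideal.span {x})]
    exact Ideal.mem_map_of_mem _ hq
  let s : ResidueField R →ₗ[R] R ⊗[Q] (maximalIdeal Q) :=
    Submodule.liftQ (maximalIdeal R) (LinearMap.toSpanSingleton R _ ((1 : R) ⊗ₜ[Q] (⟨x, hx⟩ : maximalIdeal Q)))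
      (fun a ha => by
        obtain ⟨q, hq, rfl⟩ := hmax a ha
        rw [LinearMap.mem_ker, LinearMap.toSpanSingleton_apply, TensorProduct.smul_tmul']
        have e1 : (Ideal.Quotient.mk (Ideal.span {x}) q : R) • (1 : R) = q • (1 : R) := by
          rw [Algebra.smul_def]; rfl
        rw [e1, TensorProduct.smul_tmul]
        have e2 : q • (⟨x, hx⟩ : maximalIdeal Q) = x • ⟨q, hq⟩ := by
          apply Subtype.ext; exact mul_comm _ _
        rw [e2, ← TensorProduct.smul_tmul]
        have e3 : x • (1 : R) = 0 := by
          rw [Algebra.smul_def, mul_one]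
          exact Ideal.Quotient.eq_zero_iff_mem.2 (Ideal.mem_span_singleton_self x)
        rw [e3, TensorProduct.zero_tmul])
  obtain ⟨g, hg⟩ := exists_functional x hx hx2
  let ψ : ResidueField Q →ₗ[Q] ResidueField R :=
    Submodule.liftQ (maximalIdeal Q) (Algebra.linearMap Q (ResidueField R)) (fun a ha => by
      rw [LinearMap.mem_ker, Algebra.linearMap_apply, IsScalarTower.algebraMap_apply Q R]
      exact (residue_eq_zero_iff _).2 (hmem a ha))
  have hψ : ψ 1 = 1 := by
    show algebraMap Q (ResidueField R) 1 = 1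
    exact map_one _
  let r : R ⊗[Q] (maximalIdeal Q) →ₗ[R] ResidueField R := LinearMap.liftBaseChange R (ψ ∘ₗ g)
  refine TT_retract_right s r ?_ d h2
  ext z
  obtain ⟨a, rfl⟩ := residue_surjective z
  have e1 : s (residue R a) = a • ((1 : R) ⊗ₜ[Q] (⟨x, hx⟩ : maximalIdeal Q)) := rfl
  rw [LinearMap.comp_apply, e1, map_smul]
  have e2 : r ((1 : R) ⊗ₜ[Q] (⟨x, hx⟩ : maximalIdeal Q)) = 1 := by
    simp [r, hg, hψ]
  rw [e2, Algebra.smul_def, mul_one]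
  rfl
end serre

theorem serre (n : ℕ) (Q : Type u) [CommRing Q] [IsLocalRing Q] [IsNoetherianRing Q]
    (hn : (maximalIdeal Q).spanFinrank ≤ n) (d : ℕ)
    (h : FlatDimLE Q d (ResidueField Q)) : ∃ n, RegMax Q n := by
  induction n generalizing Q with
  | zero =>
    refine ⟨0, regMax_zero ?_⟩
    rw [Nat.le_zero] at hn
    have h4 := Submodule.FG.generators_ncard (IsNoetherian.noetherian (maximalIdeal Q))
    rw [hn, Set.ncard_eq_zero (Submodule.FG.finite_generators (IsNoetherian.noetherian _))] at h4
    rw [← (maximalIdeal Q).span_generators, h4, Submodule.span_empty]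
  | succ n ih =>
    by_cases h0 : maximalIdeal Q = ⊥
    · exact ⟨0, regMax_zero h0⟩
    by_cases hm : maximalIdeal Q ∈ associatedPrimes Q Q
    · exfalso
      obtain ⟨-, s, hs⟩ := isAssociatedPrime_iff.1 hm
      have hs' : ∀ a, a ∈ maximalIdeal Q ↔ a * s = 0 := by
        intro a
        rw [hs, Submodule.mem_colon_singleton]; simp
      refine h0 (serre_socle s ?_ (fun a ha => (hs' a).1 ha) d h)
      rintro rfl
      exact (Ideal.ne_top_iff_one _).1 (maximalIdeal.isMaximal Q).ne_top ((hs' 1).2 (mul_zero 1))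
    obtain ⟨x, hx, hx2, hxp⟩ := exists_good (associatedPrimes Q Q)
      (associatedPrimes.finite Q Q) (fun p hp => hp.isPrime) hm h0
    have hreg : IsSMulRegular Q x := by
      have := biUnion_associatedPrimes_eq_compl_nonZeroDivisors Q
      have hx3 : x ∈ nonZeroDivisors Q := by
        by_contra hc
        have hc' : x ∈ ((nonZeroDivisors Q : Set Q))ᶜ := hc
        rw [← this] at hc'
        simp only [Set.mem_iUnion] at hc'
        obtain ⟨p, hp, hxp'⟩ := hc'
        exact hxp p hp hxp'
      intro a b hab
      exact (mul_cancel_left_mem_nonZeroDivisors hx3).1 hab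
    have := local_quot (span_singleton_le_max hx)
    have h3 := finrank_quot_succ hx hx2
    obtain ⟨m, hm⟩ := ih (Q ⧸ Ideal.span {x}) (by omega) (serre_step x hx hx2 hreg d h)
    exact ⟨m + 1, regMax_cons hx hreg hm⟩

end CIT

namespace CIT
set_option linter.unusedSectionVars false
open RingTheory.Sequence Pointwise

section cm
variable {R : Type u} [CommRing R] [IsLocalRing R] [IsNoetherianRing R]

def Dep (R : Type u) [CommRing R] [IsLocalRing R] (M : Type u) [AddCommGroup M] [Module R M]
    (n : ℕ) : Prop :=
  ∃ rs : List R, rs.length = n ∧ (∀ r ∈ rs, r ∈ maximalIdeal R) ∧ IsRegular M rs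

theorem smul_top_lt (M : Type u) [AddCommGroup M] [Module R M] [Module.Finite R M] [Nontrivial M] :
    maximalIdeal R • (⊤ : Submodule R M) < ⊤ := by
  rw [lt_top_iff_ne_top]
  intro h
  have := Submodule.eq_bot_of_le_smul_of_le_jacobson_bot (maximalIdeal R) (⊤ : Submodule R M)
    Module.Finite.fg_top h.ge (maximalIdeal_le_jacobson _)
  exact top_ne_bot this

theorem dep_quot (M : Type u) [AddCommGroup M] [Module R M] [Module.Finite R M] [Nontrivial M]
    (n : ℕ) (h : Dep R M (n + 1)) (a : R) (ha : a ∈ maximalIdeal R) (hreg : IsSMulRegular M a) :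
    Dep R (QuotSMulTop a M) n := by
  obtain ⟨rs, hl, hm, hr⟩ := h
  have hnt : Nontrivial (QuotSMulTop a M) := nontrivial_quotSMulTop_of_mem_maximalIdeal _ ha
  let N := ModuleCat.of R (R ⧸ maximalIdeal R)
  have hN : Module.support R N = PrimeSpectrum.zeroLocus (maximalIdeal R) := by
    rw [Module.support_eq_zeroLocus]
    congr 2
    exact Ideal.annihilator_quotient
  have hfin : Module.Finite R N := inferInstanceAs (Module.Finite R (R ⧸ maximalIdeal R))
  have hext := ModuleCat.subsingleton_ext_of_exists_isRegular (maximalIdeal R) N hN.le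
    (ModuleCat.of R M) (smul_top_lt M) rs hm hr
  have hf2 : Module.Finite R (ModuleCat.of R (QuotSMulTop a M)) :=
    inferInstanceAs (Module.Finite R (QuotSMulTop a M))
  refine ModuleCat.exists_isRegular_of_exists_subsingleton_ext (maximalIdeal R) n
    (ModuleCat.of R (QuotSMulTop a M)) (smul_top_lt (QuotSMulTop a M)) N hN ?_
  intro i hi
  have zero1 := AddCommGrpCat.isZero_of_iff_subsingleton.mpr (hext i (by omega))
  have zero2 := AddCommGrpCat.isZero_of_iff_subsingleton.mpr (hext (i + 1) (by omega))
  exact AddCommGrpCat.subsingleton_of_isZero <| ShortComplex.Exact.isZero_of_both_zeros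
        ((Abelian.Ext.covariant_sequence_exact₃' N
          (hreg.smulShortComplex_shortExact (M := ModuleCat.of R M))) i (i + 1) rfl)
        (zero1.eq_zero_of_src _) (zero2.eq_zero_of_tgt _)

theorem dim_quot_prime_succ (p q : Ideal R) (hp : p.IsPrime) (hpq : p ≤ q) (x : R) (hx : x ∈ q)
    (hxp : x ∉ p) : ringKrullDim (R ⧸ q) + 1 ≤ ringKrullDim (R ⧸ p) := by
  refine ringKrullDim_succ_le_of_surjective (Ideal.Quotient.factor hpq)
    (Ideal.Quotient.factor_surjective hpq) (r := Ideal.Quotient.mk p x) ?_ ?_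
  · rw [mem_nonZeroDivisors_iff_ne_zero]
    rwa [Ne, Ideal.Quotient.eq_zero_iff_mem]
  · simpa [Ideal.Quotient.eq_zero_iff_mem] using hx

theorem ass_dim (rs : List R) (M : Type u) [AddCommGroup M] [Module R M] [Module.Finite R M]
    (hrs : IsWeaklyRegular M rs) (hm : ∀ r ∈ rs, r ∈ maximalIdeal R) (p : Ideal R)
    (hp : IsAssociatedPrime p M) : (rs.length : WithBot ℕ∞) ≤ ringKrullDim (R ⧸ p) := by
  induction rs generalizing M p with
  | nil =>
    have := hp.isPrime
    have : Nontrivial (R ⧸ p) := Ideal.Quotient.nontrivial_iff.2 this.ne_top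
    simpa using ringKrullDim_nonneg_of_nontrivial
  | cons x rs ih =>
    rw [isWeaklyRegular_cons_iff] at hrs
    have hpr := hp.isPrime
    obtain ⟨-, m, hpm⟩ := isAssociatedPrime_iff.1 hp
    have hmem : ∀ a, a ∈ p ↔ a • m = 0 := by
      intro a; rw [hpm, Submodule.mem_colon_singleton]; simp
    have hm0 : m ≠ 0 := by
      rintro rfl
      exact (Ideal.ne_top_iff_one _).1 hpr.ne_top ((hmem 1).2 (smul_zero _))
    have hxp : x ∉ p := fun h => hm0 (hrs.1.right_eq_zero_of_smul ((hmem x).1 h))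
    -- the submodule killed by p
    let N : Submodule R M :=
      { carrier := {y | ∀ a ∈ p, a • y = 0}
        add_mem' := fun {y z} hy hz a ha => by rw [smul_add, hy a ha, hz a ha, add_zero]
        zero_mem' := fun a _ => smul_zero a
        smul_mem' := fun c y hy a ha => by rw [smul_comm, hy a ha, smul_zero] }
    obtain ⟨y, hyN, hy⟩ : ∃ y ∈ N, y ∉ x • (⊤ : Submodule R M) := by
      by_contra! hcon
      have : N = ⊥ := by
        refine Submodule.eq_bot_of_le_smul_of_le_jacobson_bot (maximalIdeal R) N
          (IsNoetherian.noetherian _) ?_ (maximalIdeal_le_jacobson _)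
        intro y hy
        obtain ⟨z, -, rfl⟩ := (Submodule.mem_smul_pointwise_iff_exists _ _ _).1 (hcon y hy)
        refine Submodule.smul_mem_smul (hm x (by simp)) ?_
        intro a ha
        apply hrs.1.right_eq_zero_of_smul
        rw [smul_comm]; exact hy a ha
      apply hm0
      have hmN : m ∈ N := fun a ha => (hmem a).1 ha
      rw [this] at hmN
      exact hmN
    obtain ⟨q, hq, hle⟩ := exists_le_isAssociatedPrime_of_isNoetherianRing R
      (Submodule.Quotient.mk y : QuotSMulTop x M) (by
        rw [Ne, Submodule.Quotient.mk_eq_zero]; exact hy)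
    have h1 : ∀ a, a • y ∈ x • (⊤ : Submodule R M) → a ∈ q := by
      intro a ha
      apply hle
      rw [Submodule.mem_colon_singleton, Submodule.mem_bot, ← Submodule.Quotient.mk_smul,
        Submodule.Quotient.mk_eq_zero]
      exact ha
    have h2 := dim_quot_prime_succ p q hpr (fun a ha => h1 a (by rw [hyN a ha]; exact zero_mem _)) x
      (h1 x (Submodule.smul_mem_pointwise_smul _ _ _ trivial)) hxp
    have h3 := ih (QuotSMulTop x M) hrs.2 (fun r hr => hm r (by simp [hr])) q hq
    refine le_trans ?_ h2
    rw [List.length_cons]; push_cast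
    gcongr

theorem supportDim_le_list (as : List R) (M : Type u) [AddCommGroup M] [Module R M]
    [Module.Finite R M] (hm : ∀ r ∈ as, r ∈ maximalIdeal R) :
    Module.supportDim R M ≤
      Module.supportDim R (M ⧸ (Ideal.ofList as • ⊤ : Submodule R M)) + as.length := by
  induction as generalizing M with
  | nil =>
    rw [Module.supportDim_eq_of_equiv (Submodule.quotEquivOfEqBot (Ideal.ofList [] • ⊤ : Submodule R M) (by simp))]
    simp
  | cons a as ih =>
    rw [Module.supportDim_eq_of_equiv (Submodule.quotOfListConsSMulTopEquivQuotSMulTopInner M a as)]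
    refine (Module.supportDim_le_supportDim_quotSMulTop_succ (hm a (by simp))).trans ?_
    have := ih (QuotSMulTop a M) (fun r hr => hm r (by simp [hr]))
    rw [List.length_cons]; push_cast
    rw [← add_assoc]
    gcongr

theorem cm_main (as : List R) (n : ℕ) (M : Type u) [AddCommGroup M] [Module R M]
    [Module.Finite R M] [Nontrivial M] (hm : ∀ r ∈ as, r ∈ maximalIdeal R) (hd : Dep R M n)
    (h : Module.supportDim R (M ⧸ (Ideal.ofList as • ⊤ : Submodule R M)) + as.length ≤ n) :
    IsWeaklyRegular M as := by
  induction as generalizing n M with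
  | nil => simp
  | cons a as ih =>
    rw [Module.supportDim_eq_of_equiv (Submodule.quotOfListConsSMulTopEquivQuotSMulTopInner M a as)]
      at h
    have ha := hm a (by simp)
    have has : ∀ r ∈ as, r ∈ maximalIdeal R := fun r hr => hm r (by simp [hr])
    have h1 := supportDim_le_list as (QuotSMulTop a M) has
    rw [List.length_cons] at h; push_cast at h
    rw [← add_assoc] at h
    have h2 : Module.supportDim R (QuotSMulTop a M) + 1 ≤ n := by
      refine le_trans ?_ h
      gcongr
    have hnt : Nontrivial (QuotSMulTop a M) := nontrivial_quotSMulTop_of_mem_maximalIdeal _ ha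
    have hreg : IsSMulRegular M a := by
      have key : ∀ p, IsAssociatedPrime p M → a ∉ p := by
        intro p hp hap
        obtain ⟨rs, hl, hrm, hrr⟩ := hd
        have h3 := ass_dim rs M hrr.toIsWeaklyRegular hrm p hp
        rw [hl] at h3
        have h4 : ringKrullDim (R ⧸ p) ≤ Module.supportDim R (QuotSMulTop a M) := by
          have hpr := hp.isPrime
          have hs : (⟨p, hpr⟩ : PrimeSpectrum R) ∈ Module.support R (QuotSMulTop a M) := by
            rw [Module.support_quotSMulTop]
            refine ⟨?_, by simpa using hap⟩
            rw [Module.mem_support_iff_of_finite]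
            rw [← Submodule.annihilator_top]; exact hp.annihilator_le
          rw [Module.mem_support_iff_of_finite] at hs
          rw [Module.supportDim_eq_ringKrullDim_quotient_annihilator]
          exact ringKrullDim_le_of_surjective (Ideal.Quotient.factor hs)
            (Ideal.Quotient.factor_surjective hs)
        have h5 : (n : WithBot ℕ∞) + 1 ≤ n := le_trans (by gcongr; exact h3.trans h4) h2
        norm_cast at h5
        omega
      have := biUnion_associatedPrimes_eq_zero_divisors R M
      rw [isSMulRegular_iff_right_eq_zero_of_smul]
      intro x hx
      by_contra hx0
      have hmem : a ∈ { r : R | ∃ x : M, x ≠ 0 ∧ r • x = 0 } := ⟨x, hx0, hx⟩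
      rw [← this] at hmem
      simp only [Set.mem_iUnion] at hmem
      obtain ⟨p, hp, hap⟩ := hmem
      exact key p hp hap
    rw [isWeaklyRegular_cons_iff]
    refine ⟨hreg, ?_⟩
    cases n with
    | zero =>
      exfalso
      have h6 : (0 : WithBot ℕ∞) ≤ Module.supportDim R (QuotSMulTop a M) := by
        rw [Module.supportDim_eq_ringKrullDim_quotient_annihilator]
        have : Nontrivial (R ⧸ Module.annihilator R (QuotSMulTop a M)) := by
          rw [Ideal.Quotient.nontrivial_iff, Ne, Module.annihilator_eq_top_iff]
          exact not_subsingleton _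
        exact ringKrullDim_nonneg_of_nontrivial
      have h7 : (0 : WithBot ℕ∞) + 1 ≤ (0 : ℕ) := le_trans (by gcongr) h2
      norm_cast at h7
    | succ n =>
      apply ih n (QuotSMulTop a M) has (dep_quot M n hd a ha hreg)
      push_cast at h
      first
        | exact ENat.WithBot.add_le_add_one_right_iff.1 h
        | (rw [add_right_comm] at h
           exact ENat.WithBot.add_le_add_one_right_iff.1 h)

theorem cm_lemma (n : ℕ) (hR : RegMax R n) (as : List R) (hm : ∀ r ∈ as, r ∈ maximalIdeal R)
    (h : ringKrullDim (R ⧸ Ideal.ofList as) + as.length ≤ n) : IsRegular R as := by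
  rw [IsLocalRing.isRegular_iff_isWeaklyRegular_of_subset_maximalIdeal hm]
  obtain ⟨rs, h1, h2, h3⟩ := hR
  have hrm : ∀ r ∈ rs, r ∈ maximalIdeal R := fun r hr => h2 ▸ Ideal.subset_span hr
  refine cm_main as n R hm ⟨rs, h3, hrm,
    (IsLocalRing.isRegular_iff_isWeaklyRegular_of_subset_maximalIdeal hrm).2 h1⟩ ?_
  refine le_trans (le_of_eq ?_) h
  congr 1
  have : (Ideal.ofList as • ⊤ : Submodule R R) = Ideal.ofList as := by simp
  rw [this]
  exact Module.supportDim_quotient_eq_ringKrullDim _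
end cm
end CIT

namespace CIT
set_option linter.unusedSectionVars false
open TensorProduct RingTheory.Sequence

section koszul
variable {A : Type u} [CommRing A] {F F1 F2 : Type u} [AddCommGroup F] [Module A F]
  [AddCommGroup F1] [Module A F1] [AddCommGroup F2] [Module A F2]

/-- Koszul boundaries in degree one for a linear form. -/
def Bd (φ : F →ₗ[A] A) : Submodule A F :=
  Submodule.span A {w | ∃ f g, w = φ g • f - φ f • g}

/-- First Koszul homology of a linear form. -/
abbrev KH (φ : F →ₗ[A] A) : Type u := (LinearMap.ker φ) ⧸ (Bd φ).submoduleOf (LinearMap.ker φ)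

/-- class of a cycle -/
def kcl (φ : F →ₗ[A] A) : LinearMap.ker φ →ₗ[A] KH φ := Submodule.mkQ _

theorem kcl_surj (φ : F →ₗ[A] A) : Function.Surjective (kcl φ) := Submodule.mkQ_surjective _

theorem kcl_eq_zero (φ : F →ₗ[A] A) (z : LinearMap.ker φ) : kcl φ z = 0 ↔ z.1 ∈ Bd φ := by
  rw [kcl, Submodule.mkQ_apply, Submodule.Quotient.mk_eq_zero]
  rfl

theorem mem_Bd (φ : F →ₗ[A] A) (f g : F) : φ g • f - φ f • g ∈ Bd φ :=
  Submodule.subset_span ⟨f, g, rfl⟩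

theorem Bd_le (φ : F →ₗ[A] A) (N : Submodule A F) (h : ∀ f g, φ g • f - φ f • g ∈ N) : Bd φ ≤ N := by
  refine Submodule.span_le.2 ?_
  rintro _ ⟨f, g, rfl⟩
  exact h f g

theorem Bd_le_ker (φ : F →ₗ[A] A) : Bd φ ≤ LinearMap.ker φ := by
  refine Bd_le _ _ fun f g => ?_
  simp [mul_comm]

theorem KH_equiv (φ : F →ₗ[A] A) {Y : Type u} [AddCommGroup Y] [Module A Y]
    (T : LinearMap.ker φ →ₗ[A] Y) (hT : Function.Surjective T) (h : ∀ z, T z = 0 ↔ z.1 ∈ Bd φ) :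
    ∃ e : KH φ ≃ₗ[A] Y, ∀ z, e (kcl φ z) = T z := by
  have hk : LinearMap.ker T = (Bd φ).submoduleOf (LinearMap.ker φ) := by
    ext z; exact h z
  refine ⟨(Submodule.quotEquivOfEq _ _ hk.symm) ≪≫ₗ (T.quotKerEquivOfSurjective hT), fun z => rfl⟩

theorem KH_smul (φ : F →ₗ[A] A) (a : A) (ha : a ∈ LinearMap.range φ) (z : KH φ) : a • z = 0 := by
  obtain ⟨g, rfl⟩ := ha
  obtain ⟨w, rfl⟩ := kcl_surj φ z
  rw [← map_smul, kcl_eq_zero]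
  have := mem_Bd φ w.1 g
  rwa [show φ w.1 = 0 from w.2, zero_smul, sub_zero] at this

theorem Bd_congr (e : F1 ≃ₗ[A] F2) (φ1 : F1 →ₗ[A] A) (φ2 : F2 →ₗ[A] A)
    (h : ∀ f, φ2 (e f) = φ1 f) (w : F1) : e w ∈ Bd φ2 ↔ w ∈ Bd φ1 := by
  have key : ∀ {F1 F2 : Type u} [AddCommGroup F1] [Module A F1] [AddCommGroup F2] [Module A F2]
    (e : F1 ≃ₗ[A] F2) (φ1 : F1 →ₗ[A] A) (φ2 : F2 →ₗ[A] A)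
    (h : ∀ f, φ2 (e f) = φ1 f) (w : F1), w ∈ Bd φ1 → e w ∈ Bd φ2 := by
    intro F1 F2 _ _ _ _ e φ1 φ2 h w hw
    have : Bd φ1 ≤ (Bd φ2).comap e.toLinearMap := by
      refine Bd_le _ _ fun f g => ?_
      simp only [Submodule.mem_comap, LinearEquiv.coe_coe, map_sub, map_smul]
      rw [← h, ← h]
      exact mem_Bd _ _ _
    exact this hw
  refine ⟨fun hw => ?_, key e φ1 φ2 h w⟩
  simpa using key e.symm φ2 φ1 (fun f => by rw [← h]; simp) _ hw

theorem KH_congr (e : F1 ≃ₗ[A] F2) (φ1 : F1 →ₗ[A] A) (φ2 : F2 →ₗ[A] A)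
    (h : ∀ f, φ2 (e f) = φ1 f) : Nonempty (KH φ1 ≃ₗ[A] KH φ2) := by
  let g : LinearMap.ker φ1 →ₗ[A] LinearMap.ker φ2 := LinearMap.restrict e.toLinearMap
    (fun z hz => by rw [LinearMap.mem_ker] at hz ⊢; rw [← hz, ← h]; rfl)
  have hs : Function.Surjective (kcl φ2 ∘ₗ g) := by
    refine (kcl_surj φ2).comp ?_
    intro z
    refine ⟨⟨e.symm z.1, ?_⟩, ?_⟩
    · rw [LinearMap.mem_ker, ← h]; simp
    · apply Subtype.ext; simp [g]
  have hk : ∀ z, (kcl φ2 ∘ₗ g) z = 0 ↔ z.1 ∈ Bd φ1 := by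
    intro z
    rw [LinearMap.comp_apply, kcl_eq_zero]
    exact Bd_congr e φ1 φ2 h z.1
  obtain ⟨E, -⟩ := KH_equiv φ1 (kcl φ2 ∘ₗ g) hs hk
  exact ⟨E⟩

theorem exists_theta [IsLocalRing A] [Module.Free A F2] [Module.Finite A F2] :
    ∃ θ : F2 →ₗ[A] (Fin (Module.finrank A F2) → ResidueField A), Function.Surjective θ ∧
      ∀ f, θ f = 0 ↔ f ∈ maximalIdeal A • (⊤ : Submodule A F2) := by
  let b := Module.finBasis A F2
  let ρ : (Fin (Module.finrank A F2) → A) →ₗ[A] (Fin (Module.finrank A F2) → ResidueField A) :=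
    LinearMap.pi fun i => (Algebra.linearMap A (ResidueField A)) ∘ₗ LinearMap.proj i
  refine ⟨ρ ∘ₗ b.equivFun.toLinearMap, ?_, ?_⟩
  · intro y
    choose x hx using fun i => residue_surjective (y i)
    exact ⟨b.equivFun.symm x, by
      rw [LinearMap.comp_apply, LinearEquiv.coe_coe, LinearEquiv.apply_symm_apply]
      exact funext hx⟩
  · intro f
    constructor
    · intro h
      rw [← b.sum_equivFun f]
      refine Submodule.sum_mem _ fun i _ => Submodule.smul_mem_smul ?_ trivial
      exact (residue_eq_zero_iff _).1 (congrFun h i)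
    · intro h
      have : maximalIdeal A • (⊤ : Submodule A F2) ≤ LinearMap.ker (ρ ∘ₗ b.equivFun.toLinearMap) := by
        rw [Submodule.smul_le]
        intro a ha f _
        rw [LinearMap.mem_ker, map_smul]
        funext i
        have : residue A a = 0 := (residue_eq_zero_iff a).2 ha
        rw [Pi.smul_apply, Pi.zero_apply, Algebra.smul_def]
        rw [show algebraMap A (ResidueField A) a = 0 from this, zero_mul]
      exact this h

theorem length_coprod_zero [IsLocalRing A] [Module.Free A F2] [Module.Finite A F2]
    (φ : F1 →ₗ[A] A) (hφ : LinearMap.range φ = maximalIdeal A) :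
    Module.length A (KH (φ.coprod (0 : F2 →ₗ[A] A))) =
      Module.length A (KH φ) + Module.finrank A F2 := by
  obtain ⟨θ, hθ, hθ0⟩ := exists_theta (A := A) (F2 := F2)
  set Φ := φ.coprod (0 : F2 →ₗ[A] A) with hΦ
  have hΦa : ∀ f, Φ f = φ f.1 := fun f => by simp [Φ]
  let p : LinearMap.ker Φ →ₗ[A] LinearMap.ker φ := LinearMap.restrict (LinearMap.fst A F1 F2)
    (fun z hz => by rw [LinearMap.mem_ker] at hz ⊢; rw [← hz, hΦa]; rfl)
  let T : LinearMap.ker Φ →ₗ[A] KH φ × (Fin (Module.finrank A F2) → ResidueField A) :=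
    (kcl φ ∘ₗ p).prod (θ ∘ₗ (LinearMap.snd A F1 F2) ∘ₗ (LinearMap.ker Φ).subtype)
  have hs : Function.Surjective T := by
    rintro ⟨y1, y2⟩
    obtain ⟨z, rfl⟩ := kcl_surj φ y1
    obtain ⟨f, rfl⟩ := hθ y2
    refine ⟨⟨(z.1, f), ?_⟩, ?_⟩
    · rw [LinearMap.mem_ker, hΦa]; exact z.2
    · rfl
  have hk : ∀ z, T z = 0 ↔ z.1 ∈ Bd Φ := by
    rintro ⟨⟨z1, z2⟩, hz⟩
    have hz1 : φ z1 = 0 := by rw [← hΦa (z1, z2)]; exact hz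
    have e : T ⟨⟨z1, z2⟩, hz⟩ = (kcl φ ⟨z1, hz1⟩, θ z2) := rfl
    rw [e, Prod.mk_eq_zero, kcl_eq_zero, hθ0]
    constructor
    · rintro ⟨h1, h2⟩
      have e2 : ((z1, z2) : F1 × F2) = LinearMap.inl A F1 F2 z1 + LinearMap.inr A F1 F2 z2 := by simp
      show ((z1, z2) : F1 × F2) ∈ Bd Φ
      rw [e2]
      refine add_mem ?_ ?_
      · have : Bd φ ≤ (Bd Φ).comap (LinearMap.inl A F1 F2) := by
          refine Bd_le _ _ fun f g => ?_
          rw [Submodule.mem_comap, map_sub, map_smul, map_smul]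
          have := mem_Bd Φ (LinearMap.inl A F1 F2 f) (LinearMap.inl A F1 F2 g)
          rwa [hΦa, hΦa] at this
        exact this h1
      · have : maximalIdeal A • (⊤ : Submodule A F2) ≤ (Bd Φ).comap (LinearMap.inr A F1 F2) := by
          rw [Submodule.smul_le]
          intro a ha f _
          rw [← hφ] at ha
          obtain ⟨g, rfl⟩ := ha
          rw [Submodule.mem_comap, map_smul]
          have := mem_Bd Φ (LinearMap.inr A F1 F2 f) (LinearMap.inl A F1 F2 g)
          rw [hΦa, hΦa] at this
          simpa using this
        exact this h2
    · intro h
      have : Bd Φ ≤ (Bd φ).prod (maximalIdeal A • (⊤ : Submodule A F2)) := by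
        refine Bd_le _ _ fun f g => ?_
        rw [hΦa, hΦa]
        refine ⟨mem_Bd φ f.1 g.1, sub_mem ?_ ?_⟩
        · exact Submodule.smul_mem_smul (hφ ▸ LinearMap.mem_range_self _ _) trivial
        · exact Submodule.smul_mem_smul (hφ ▸ LinearMap.mem_range_self _ _) trivial
      exact this h
  obtain ⟨E, -⟩ := KH_equiv Φ T hs hk
  · rw [E.length_eq, Module.length_prod, Module.length_pi_of_fintype]
    congr 1
    have : Module.length A (ResidueField A) = 1 := by
      rw [Module.length_eq_one_iff]
      have : IsSimpleModule A (A ⧸ maximalIdeal A) :=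
        isSimpleModule_iff_isCoatom.2 (maximalIdeal.isMaximal A).out
      exact this
    simp [this]

theorem length_coprod [IsLocalRing A] [Module.Free A F2] [Module.Finite A F2]
    (φ1 : F1 →ₗ[A] A) (hφ : LinearMap.range φ1 = maximalIdeal A) (φ2 : F2 →ₗ[A] A)
    (h2 : LinearMap.range φ2 ≤ maximalIdeal A) :
    Module.length A (KH (φ1.coprod φ2)) = Module.length A (KH φ1) + Module.finrank A F2 := by
  rw [← length_coprod_zero φ1 hφ]
  obtain ⟨σ, hσ⟩ := Module.projective_lifting_property φ1.rangeRestrict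
    (φ2.codRestrict (LinearMap.range φ1) (fun f => by
      rw [hφ]; exact h2 (LinearMap.mem_range_self _ _))) φ1.surjective_rangeRestrict
  have hσ' : ∀ f, φ1 (σ f) = φ2 f := fun f => congrArg Subtype.val (LinearMap.congr_fun hσ f)
  let e : (F1 × F2) ≃ₗ[A] F1 × F2 := LinearEquiv.ofLinearMap
    ((LinearMap.fst A F1 F2 + σ ∘ₗ LinearMap.snd A F1 F2).prod (LinearMap.snd A F1 F2))
    ((LinearMap.fst A F1 F2 - σ ∘ₗ LinearMap.snd A F1 F2).prod (LinearMap.snd A F1 F2))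
    (by ext <;> simp) (by ext <;> simp)
  obtain ⟨E⟩ := KH_congr e (φ1.coprod φ2) (φ1.coprod (0 : F2 →ₗ[A] A)) (fun f => by
    simp [e, hσ'])
  exact E.length_eq

theorem length_indep [IsLocalRing A] [Module.Free A F2] [Module.Finite A F2] [Module.Free A F1]
    [Module.Finite A F1] (φ1 : F1 →ₗ[A] A) (h1 : LinearMap.range φ1 = maximalIdeal A)
    (φ2 : F2 →ₗ[A] A) (h2 : LinearMap.range φ2 = maximalIdeal A) :
    Module.length A (KH φ1) + Module.finrank A F2 =
      Module.length A (KH φ2) + Module.finrank A F1 := by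
  rw [← length_coprod φ1 h1 φ2 h2.le, ← length_coprod φ2 h2 φ1 h1.le]
  obtain ⟨E⟩ := KH_congr (LinearEquiv.prodComm A F1 F2) (φ1.coprod φ2) (φ2.coprod φ1) (fun f => by
    simp [add_comm])
  exact E.length_eq

end koszul
end CIT

namespace CIT
set_option linter.style.haveILetI false
set_option linter.unusedSectionVars false
open TensorProduct RingTheory.Sequence Pointwise

section koszul
variable {A : Type u} [CommRing A] {F F1 F2 : Type u} [AddCommGroup F] [Module A F]
  [AddCommGroup F1] [Module A F1] [AddCommGroup F2] [Module A F2]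

/-- generation of the first Koszul homology by `h` classes -/
def KGen (φ : F →ₗ[A] A) {h : ℕ} (z : Fin h → F) : Prop :=
  (∀ i, φ (z i) = 0) ∧ ∀ w, φ w = 0 → ∃ c : Fin h → A, w - ∑ i, c i • z i ∈ Bd φ

/-- the first Koszul homology is free of rank `h` over the quotient by the range -/
def KF (φ : F →ₗ[A] A) (h : ℕ) : Prop :=
  ∃ z : Fin h → F, KGen φ z ∧ ∀ c : Fin h → A, ∑ i, c i • z i ∈ Bd φ → ∀ i, c i ∈ LinearMap.range φ

theorem kh_surj (φ : F →ₗ[A] A) {h : ℕ} (z : Fin h → F) (hz : KGen φ z) :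
    ∃ T : (Fin h → A) →ₗ[A] KH φ, Function.Surjective T ∧
      ∀ c, T c = 0 ↔ ∑ i, c i • z i ∈ Bd φ := by
  let Z : Fin h → LinearMap.ker φ := fun i => ⟨z i, hz.1 i⟩
  have e : ∀ c : Fin h → A, ((∑ i, c i • Z i : LinearMap.ker φ) : F) = ∑ i, c i • z i := by
    intro c; simp [Z]
  refine ⟨kcl φ ∘ₗ Fintype.linearCombination A Z, ?_, ?_⟩
  · intro y
    obtain ⟨w, rfl⟩ := kcl_surj φ y
    obtain ⟨c, hc⟩ := hz.2 w.1 w.2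
    refine ⟨c, ?_⟩
    rw [LinearMap.comp_apply, Fintype.linearCombination_apply, eq_comm, ← sub_eq_zero, ← map_sub,
      kcl_eq_zero]
    rw [Submodule.coe_sub, e]; exact hc
  · intro c
    rw [LinearMap.comp_apply, Fintype.linearCombination_apply, kcl_eq_zero, e]

theorem length_residue_pi [IsLocalRing A] (h : ℕ) :
    Module.length A (Fin h → ResidueField A) = h := by
  rw [Module.length_pi_of_fintype]
  have : Module.length A (ResidueField A) = 1 := by
    rw [Module.length_eq_one_iff]
    have : IsSimpleModule A (A ⧸ maximalIdeal A) :=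
      isSimpleModule_iff_isCoatom.2 (maximalIdeal.isMaximal A).out
    exact this
  simp [this]

theorem KGen_length [IsLocalRing A] (φ : F →ₗ[A] A) (hφ : LinearMap.range φ = maximalIdeal A)
    {h : ℕ} (z : Fin h → F) (hz : KGen φ z) : Module.length A (KH φ) ≤ h := by
  obtain ⟨T, hT, -⟩ := kh_surj φ z hz
  obtain ⟨θ, hθ, hθ0⟩ := exists_theta (A := A) (F2 := Fin h → A)
  have hle : LinearMap.ker θ ≤ LinearMap.ker T := by
    intro f hf
    have : f ∈ maximalIdeal A • (⊤ : Submodule A (Fin h → A)) := (hθ0 f).1 hf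
    revert this; apply Submodule.smul_le.2
    intro a ha g _
    rw [LinearMap.mem_ker, map_smul]
    exact KH_smul φ a (hφ ▸ ha) _
  have h1 : Function.Surjective ((LinearMap.ker θ).liftQ T hle) := by
    intro y; obtain ⟨x, rfl⟩ := hT y; exact ⟨Submodule.Quotient.mk x, rfl⟩
  have h2 := Module.length_le_of_surjective _ h1
  rw [(θ.quotKerEquivOfSurjective hθ).length_eq, length_residue_pi] at h2
  simpa using h2

theorem KF_length [IsLocalRing A] (φ : F →ₗ[A] A) (hφ : LinearMap.range φ = maximalIdeal A)
    {h : ℕ} (hz : KF φ h) : Module.length A (KH φ) = h := by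
  obtain ⟨z, hz, hi⟩ := hz
  obtain ⟨T, hT, hT0⟩ := kh_surj φ z hz
  refine le_antisymm (KGen_length φ hφ z hz) ?_
  let ρ : (Fin h → A) →ₗ[A] (Fin h → ResidueField A) :=
    LinearMap.pi fun i => (Algebra.linearMap A (ResidueField A)) ∘ₗ LinearMap.proj i
  have hρ : Function.Surjective ρ := by
    intro y
    choose x hx using fun i => residue_surjective (y i)
    exact ⟨x, funext hx⟩
  have hle : LinearMap.ker T ≤ LinearMap.ker ρ := by
    intro c hc
    have h1 := hi c ((hT0 c).1 hc)
    refine funext fun i => ?_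
    exact (residue_eq_zero_iff _).2 (hφ ▸ h1 i)
  have h1 : Function.Surjective ((LinearMap.ker T).liftQ ρ hle) := by
    intro y; obtain ⟨x, rfl⟩ := hρ y; exact ⟨Submodule.Quotient.mk x, rfl⟩
  have h2 := Module.length_le_of_surjective _ h1
  rwa [(T.quotKerEquivOfSurjective hT).length_eq, length_residue_pi] at h2

theorem exists_KF [IsLocalRing A] [IsNoetherianRing A] [Module.Finite A F] (φ : F →ₗ[A] A)
    (hφ : LinearMap.range φ = maximalIdeal A) : ∃ h, KF φ h := by
  have htor : Module.IsTorsionBySet A (KH φ) (maximalIdeal A) := by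
    intro x a
    exact KH_smul φ a.1 (by rw [hφ]; exact a.2) x
  letI := htor.module
  letI : Field (A ⧸ maximalIdeal A) := Ideal.Quotient.field _
  haveI : IsScalarTower A (A ⧸ maximalIdeal A) (KH φ) := htor.isScalarTower
  haveI : Module.Finite (A ⧸ maximalIdeal A) (KH φ) := Module.Finite.of_restrictScalars_finite A _ _
  let b := Module.finBasis (A ⧸ maximalIdeal A) (KH φ)
  choose z hz using fun i => kcl_surj φ (b i)
  have e : ∀ c : Fin _ → A, kcl φ (∑ i, c i • z i) =
      ∑ i, (Ideal.Quotient.mk (maximalIdeal A) (c i)) • b i := by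
    intro c
    rw [map_sum]
    refine Finset.sum_congr rfl fun i _ => ?_
    rw [map_smul, hz]; rfl
  refine ⟨_, fun i => (z i).1, ⟨fun i => (z i).2, ?_⟩, ?_⟩
  · intro w hw
    choose c hc using fun i => Ideal.Quotient.mk_surjective (b.repr (kcl φ ⟨w, hw⟩) i)
    refine ⟨c, ?_⟩
    have : kcl φ (⟨w, hw⟩ - ∑ i, c i • z i) = 0 := by
      rw [map_sub, e, sub_eq_zero]
      simp_rw [hc]
      exact (b.sum_repr _).symm
    rw [kcl_eq_zero] at this
    simpa using this
  · intro c hc i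
    have : kcl φ (∑ i, c i • z i) = 0 := by
      rw [kcl_eq_zero]; simpa using hc
    rw [e] at this
    have := Fintype.linearIndependent_iff.1 b.linearIndependent _ this i
    rw [hφ]
    exact Ideal.Quotient.eq_zero_iff_mem.1 this

theorem KF_congr (e : F1 ≃ₗ[A] F2) (φ1 : F1 →ₗ[A] A) (φ2 : F2 →ₗ[A] A)
    (h : ∀ f, φ2 (e f) = φ1 f) {n : ℕ} (hk : KF φ1 n) : KF φ2 n := by
  obtain ⟨z, ⟨h0, h1⟩, h2⟩ := hk
  have hB := Bd_congr e φ1 φ2 h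
  refine ⟨fun i => e (z i), ⟨fun i => by rw [h, h0], fun w hw => ?_⟩, fun c hc i => ?_⟩
  · obtain ⟨w, rfl⟩ := e.surjective w
    obtain ⟨c, hc⟩ := h1 w (by rw [← h, hw])
    refine ⟨c, ?_⟩
    rw [← hB] at hc
    simpa using hc
  · obtain ⟨f, hf⟩ := h2 c (by rw [← hB]; simpa using hc) i
    exact ⟨e f, by rw [h, hf]⟩

/-- adjoin one more element -/
def addOne (φ : F →ₗ[A] A) (y : A) : (F × A) →ₗ[A] A :=
  φ.coprod (LinearMap.toSpanSingleton A A y)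

theorem addOne_apply (φ : F →ₗ[A] A) (y : A) (f : F × A) : addOne φ y f = φ f.1 + f.2 * y := by
  simp [addOne]

theorem range_addOne (φ : F →ₗ[A] A) (y : A) :
    LinearMap.range (addOne φ y) = LinearMap.range φ ⊔ Ideal.span {y} := by
  rw [addOne, LinearMap.range_coprod, LinearMap.range_toSpanSingleton]

theorem mem_Bd_addOne (φ : F →ₗ[A] A) (y : A) (f : F × A) :
    f ∈ Bd (addOne φ y) ↔ ∃ b ∈ Bd φ, ∃ w, f = (b + y • w, - φ w) := by
  constructor
  · let N : Submodule A (F × A) :=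
      { carrier := {f | ∃ b ∈ Bd φ, ∃ w, f = (b + y • w, - φ w)}
        add_mem' := by
          rintro _ _ ⟨b, hb, w, rfl⟩ ⟨b', hb', w', rfl⟩
          refine ⟨b + b', add_mem hb hb', w + w', ?_⟩
          ext
          · simp only [Prod.mk_add_mk, smul_add]; abel
          · simp only [Prod.mk_add_mk, map_add]; ring
        zero_mem' := ⟨0, zero_mem _, 0, by simp; rfl⟩
        smul_mem' := by
          rintro a _ ⟨b, hb, w, rfl⟩
          refine ⟨a • b, Submodule.smul_mem _ _ hb, a • w, ?_⟩
          ext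
          · simp only [Prod.smul_mk, smul_add, smul_comm a y]
          · simp }
    intro h
    have : Bd (addOne φ y) ≤ N := by
      refine Bd_le _ _ ?_
      rintro ⟨f, a⟩ ⟨g, b⟩
      refine ⟨_, mem_Bd φ f g, b • f - a • g, ?_⟩
      rw [addOne_apply, addOne_apply]
      ext
      · simp only [Prod.fst_sub, Prod.smul_fst]; module
      · simp only [Prod.snd_sub, Prod.smul_snd, map_sub, map_smul, smul_eq_mul]; ring
    exact this h
  · rintro ⟨b, hb, w, rfl⟩
    have h1 : Bd φ ≤ (Bd (addOne φ y)).comap (LinearMap.inl A F A) := by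
      refine Bd_le _ _ fun f g => ?_
      rw [Submodule.mem_comap, map_sub, map_smul, map_smul]
      have := mem_Bd (addOne φ y) (LinearMap.inl A F A f) (LinearMap.inl A F A g)
      simpa [addOne_apply] using this
    have h2 := mem_Bd (addOne φ y) (w, 0) (0, 1)
    have h3 := add_mem (Submodule.mem_comap.1 (h1 hb)) h2
    simpa [addOne_apply] using h3

theorem KF_addOne (φ : F →ₗ[A] A) (y : A)
    (hy : ∀ a, a * y ∈ LinearMap.range φ → a ∈ LinearMap.range φ) {h : ℕ} (hk : KF φ h) :
    KF (addOne φ y) h := by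
  obtain ⟨z, ⟨h0, h1⟩, h2⟩ := hk
  have e : ∀ c : Fin h → A, ∑ i, c i • ((z i, 0) : F × A) = (∑ i, c i • z i, 0) := by
    intro c
    ext <;> simp [Prod.fst_sum, Prod.snd_sum]
  refine ⟨fun i => (z i, 0), ⟨fun i => by simp [addOne_apply, h0], ?_⟩, ?_⟩
  · rintro ⟨w, a⟩ hw
    rw [addOne_apply] at hw
    obtain ⟨u, hu⟩ := hy a ⟨-w, by rw [map_neg]; linear_combination -hw⟩
    obtain ⟨c, hc⟩ := h1 (w + y • u) (by rw [map_add, map_smul, hu, smul_eq_mul]; linear_combination hw)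
    refine ⟨c, ?_⟩
    rw [e, mem_Bd_addOne]
    refine ⟨_, hc, -u, ?_⟩
    ext
    · simp only [Prod.fst_sub, smul_neg]; abel
    · simp [hu]
  · intro c hc i
    rw [e, mem_Bd_addOne] at hc
    obtain ⟨b, hb, w, hw⟩ := hc
    rw [Prod.mk.injEq] at hw
    obtain ⟨d, hd⟩ := h1 w (by simpa using hw.2.symm)
    have : ∑ i, (c i - y * d i) • z i ∈ Bd φ := by
      have : ∑ i, (c i - y * d i) • z i = b + y • (w - ∑ i, d i • z i) := by
        simp_rw [sub_smul, mul_smul]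
        rw [Finset.sum_sub_distrib, ← Finset.smul_sum, hw.1]; module
      rw [this]
      exact add_mem hb (Submodule.smul_mem _ _ hd)
    have h3 := h2 _ this i
    rw [range_addOne]
    have h4 : c i = (c i - y * d i) + y * d i := by ring
    rw [h4]
    exact add_mem (Submodule.mem_sup_left h3)
      (Submodule.mem_sup_right (Ideal.mul_mem_right _ _ (Ideal.mem_span_singleton_self y)))

theorem KF_addList (ys : List A) : ∀ (F : Type u) [AddCommGroup F] [Module A F]
    [Module.Free A F] [Module.Finite A F] (φ : F →ₗ[A] A) (h : ℕ) (_ : KF φ h)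
    (_ : IsWeaklyRegular (A ⧸ (LinearMap.range φ : Ideal A)) ys) [Nontrivial A],
    ∃ (F' : Type u) (_ : AddCommGroup F') (_ : Module A F') (_ : Module.Free A F')
      (_ : Module.Finite A F') (φ' : F' →ₗ[A] A), KF φ' h ∧
      LinearMap.range φ' = LinearMap.range φ ⊔ Ideal.ofList ys ∧
      Module.finrank A F' = Module.finrank A F + ys.length := by
  induction ys with
  | nil =>
    intro F _ _ _ _ φ h hk _ _
    exact ⟨F, _, _, inferInstance, inferInstance, φ, hk, by simp [Ideal.ofList_nil], by simp⟩
  | cons y ys ih =>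
    intro F _ _ _ _ φ h hk hreg _
    rw [isWeaklyRegular_cons_iff] at hreg
    obtain ⟨hy, hreg⟩ := hreg
    have hy' : ∀ a, a * y ∈ LinearMap.range φ → a ∈ LinearMap.range φ := by
      intro a ha
      rw [← Submodule.Quotient.mk_eq_zero] at ha ⊢
      apply hy
      show y • _ = y • _
      rw [smul_zero, ← ha, ← Submodule.Quotient.mk_smul, smul_eq_mul, mul_comm]
    have hk' := KF_addOne φ y hy' hk
    have hreg' : IsWeaklyRegular (A ⧸ (LinearMap.range (addOne φ y) : Ideal A)) ys := by
      have e1 : Submodule.map (Submodule.mkQ (LinearMap.range φ : Ideal A)) (Ideal.span {y}) =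
          y • (⊤ : Submodule A (A ⧸ (LinearMap.range φ : Ideal A))) := by
        rw [← Ideal.submodule_span_eq, LinearMap.map_span, Set.image_singleton]
        ext x
        rw [Submodule.mem_span_singleton]
        constructor
        · rintro ⟨a, rfl⟩
          rw [← map_smul]
          exact ⟨Submodule.mkQ _ a, trivial, by
            rw [smul_eq_mul, mul_comm, ← smul_eq_mul, map_smul]; rfl⟩
        · rintro ⟨a, -, rfl⟩
          obtain ⟨a, rfl⟩ := Submodule.mkQ_surjective _ a
          exact ⟨a, by rw [← map_smul, smul_eq_mul, mul_comm, ← smul_eq_mul, map_smul]; rfl⟩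
      rw [range_addOne]
      refine (LinearEquiv.isWeaklyRegular_congr ?_ ys).1 hreg
      exact (Submodule.quotEquivOfEq _ _ e1.symm) ≪≫ₗ
        Submodule.quotientQuotientEquivQuotientSup _ _
    obtain ⟨F', i1, i2, i3, i4, φ', h1, h2, h3⟩ := ih (F × A) (addOne φ y) h hk' hreg'
    refine ⟨F', i1, i2, i3, i4, φ', h1, ?_, ?_⟩
    · rw [h2, range_addOne, Ideal.ofList_cons, sup_assoc]
    · rw [h3, Module.finrank_prod, Module.finrank_self, List.length_cons]; ring

end koszul
end CIT

namespace CIT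
set_option linter.style.haveILetI false
set_option linter.unusedSectionVars false
open TensorProduct RingTheory.Sequence Pointwise

section koszul
variable {A : Type u} [CommRing A] {F F1 F2 : Type u} [AddCommGroup F] [Module A F]
  [AddCommGroup F1] [Module A F1] [AddCommGroup F2] [Module A F2]
variable (B : Type u) [CommRing B] [Algebra A B]

theorem mem_ker_baseChange [Module.Flat A B] (l : F1 →ₗ[A] F2) (x : B ⊗[A] F1)
    (hx : l.baseChange B x = 0) : x ∈ (LinearMap.ker l).baseChange B := by
  have h := Module.Flat.lTensor_exact B (LinearMap.exact_subtype_ker_map l)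
  obtain ⟨y, rfl⟩ := (h x).1 hx
  induction y with
  | zero => simp
  | add y1 y2 h1 h2 => 
    rw [map_add]
    refine add_mem (h1 ?_) (h2 ?_)
    · exact (h _).2 ⟨_, rfl⟩
    · exact (h _).2 ⟨_, rfl⟩
  | tmul b f => 
    rw [LinearMap.lTensor_tmul]
    exact Submodule.tmul_mem_baseChange_of_mem b f.2

/-- base change of a linear form -/
noncomputable def bc (φ : F →ₗ[A] A) : (B ⊗[A] F) →ₗ[B] B :=
  (AlgebraTensorModule.rid A B B).toLinearMap ∘ₗ φ.baseChange B

theorem bc_tmul (φ : F →ₗ[A] A) (b : B) (f : F) : bc B φ (b ⊗ₜ f) = φ f • b := by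
  simp [bc]

theorem range_bc (φ : F →ₗ[A] A) :
    LinearMap.range (bc B φ) = Ideal.map (algebraMap A B) (LinearMap.range φ) := by
  apply le_antisymm
  · rintro _ ⟨x, rfl⟩
    induction x with
    | zero => simp
    | add y1 y2 h1 h2 => rw [map_add]; exact add_mem h1 h2
    | tmul b f =>
      rw [bc_tmul, Algebra.smul_def]
      exact Ideal.mul_mem_right _ _ (Ideal.mem_map_of_mem _ ⟨f, rfl⟩)
  · rw [Ideal.map_le_iff_le_comap]
    rintro _ ⟨f, rfl⟩
    exact ⟨1 ⊗ₜ f, by rw [bc_tmul, Algebra.smul_def, mul_one]⟩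

theorem Bd_bc (φ : F →ₗ[A] A) : Bd (bc B φ) = (Bd φ).baseChange B := by
  apply le_antisymm
  · refine Bd_le _ _ fun f g => ?_
    induction f with
    | zero => simp
    | add f1 f2 h1 h2 =>
      have := add_mem h1 h2
      convert this using 1
      rw [map_add]; module
    | tmul a f =>
      induction g with
      | zero => simp
      | add f1 f2 h1 h2 =>
        have := add_mem h1 h2
        convert this using 1
        rw [map_add]; module
      | tmul b g =>
        have : (a * b) ⊗ₜ[A] (φ g • f - φ f • g) ∈ (Bd φ).baseChange B :=
          Submodule.tmul_mem_baseChange_of_mem _ (mem_Bd φ f g)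
        convert this using 1
        rw [bc_tmul, bc_tmul, TensorProduct.tmul_sub, TensorProduct.tmul_smul,
          TensorProduct.tmul_smul, TensorProduct.smul_tmul', TensorProduct.smul_tmul',
          TensorProduct.smul_tmul', TensorProduct.smul_tmul', smul_eq_mul, smul_eq_mul,
          smul_mul_assoc, smul_mul_assoc, mul_comm b a]
  · rw [Submodule.baseChange_eq_span, Submodule.span_le]
    rintro _ ⟨b, hb, rfl⟩
    have : Bd φ ≤ ((Bd (bc B φ)).restrictScalars A).comap (TensorProduct.mk A B F 1) := by
      refine Bd_le _ _ fun f g => ?_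
      have := mem_Bd (bc B φ) ((1 : B) ⊗ₜ f) ((1 : B) ⊗ₜ g)
      rw [bc_tmul, bc_tmul] at this
      simpa [TensorProduct.tmul_sub] using this
    exact this hb

theorem KF_bc [Module.Flat A B] (φ : F →ₗ[A] A) {h : ℕ} (hk : KF φ h) : KF (bc B φ) h := by
  obtain ⟨z, ⟨h0, h1⟩, h2⟩ := hk
  refine ⟨fun i => 1 ⊗ₜ z i, ⟨fun i => by rw [bc_tmul, h0, zero_smul], ?_⟩, ?_⟩
  · intro w hw
    have h3 : φ.baseChange B w = 0 := by
      have : (AlgebraTensorModule.rid A B B) (φ.baseChange B w) = 0 := hw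
      simpa using this
    have h4 := mem_ker_baseChange B φ w h3
    have h5 : LinearMap.ker φ ≤ Submodule.span A (Set.range z) ⊔ Bd φ := by
      intro w hw
      obtain ⟨c, hc⟩ := h1 w hw
      have : w = ∑ i, c i • z i + (w - ∑ i, c i • z i) := by abel
      rw [this]
      refine add_mem (Submodule.mem_sup_left ?_) (Submodule.mem_sup_right hc)
      exact Submodule.sum_mem _ fun i _ => Submodule.smul_mem _ _ (Submodule.subset_span ⟨i, rfl⟩)
    have h6 : (LinearMap.ker φ).baseChange B ≤
        Submodule.span B (Set.range fun i => (1 : B) ⊗ₜ[A] z i) ⊔ Bd (bc B φ) := by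
      rw [Submodule.baseChange_eq_span, Submodule.span_le]
      rintro _ ⟨b, hb, rfl⟩
      have : Submodule.span A (Set.range z) ⊔ Bd φ ≤ ((Submodule.span B (Set.range fun i => (1 : B) ⊗ₜ[A] z i) ⊔ 
        Bd (bc B φ)).restrictScalars A).comap (TensorProduct.mk A B F 1) := by
        refine sup_le ?_ ?_
        · rw [Submodule.span_le]
          rintro _ ⟨i, rfl⟩
          exact Submodule.mem_sup_left (Submodule.subset_span ⟨i, rfl⟩)
        · intro b hb
          refine Submodule.mem_sup_right ?_
          rw [Bd_bc]
          exact Submodule.tmul_mem_baseChange_of_mem _ hb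
      exact this (h5 hb)
    obtain ⟨x, hx, y, hy, e⟩ := Submodule.mem_sup.1 (h6 h4)
    obtain ⟨c, hc⟩ := (Submodule.mem_span_range_iff_exists_fun B).1 hx
    refine ⟨c, ?_⟩
    rw [hc, ← e, add_sub_cancel_left]; exact hy
  · intro c hc i
    rw [Bd_bc] at hc
    let Z : (Fin h → A) →ₗ[A] F := Fintype.linearCombination A z
    let q : (Fin h → A) →ₗ[A] F ⧸ Bd φ := (Bd φ).mkQ ∘ₗ Z
    let x : B ⊗[A] (Fin h → A) := ∑ i, c i ⊗ₜ Pi.single i 1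
    have hx : Z.baseChange B x = ∑ i, c i • (1 : B) ⊗ₜ[A] z i := by
      simp [x, Z, TensorProduct.smul_tmul', Fintype.linearCombination_apply_single]
    have hq : q.baseChange B x = 0 := by
      have e : q.baseChange B x = (Bd φ).mkQ.baseChange B (Z.baseChange B x) := by
        rw [LinearMap.baseChange_comp]; rfl
      rw [e, hx]
      have : (Bd φ).baseChange B ≤ LinearMap.ker ((Bd φ).mkQ.baseChange B) := by
        rw [Submodule.baseChange_eq_span, Submodule.span_le]
        rintro _ ⟨b, hb, rfl⟩
        have : (Bd φ).mkQ b = 0 := by simpa using hb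
        show (Bd φ).mkQ.baseChange B (1 ⊗ₜ b) = 0
        rw [LinearMap.baseChange_tmul, this, TensorProduct.tmul_zero]
      exact this hc
    have h3 := mem_ker_baseChange B q x hq
    have h4 : (LinearMap.ker q).baseChange B ≤
        Submodule.comap ((AlgebraTensorModule.rid A B B).toLinearMap ∘ₗ
          (LinearMap.proj i : (Fin h → A) →ₗ[A] A).baseChange B) (LinearMap.range (bc B φ)) := by
      rw [Submodule.baseChange_eq_span, Submodule.span_le]
      rintro _ ⟨d, hd, rfl⟩
      have hd' : ∑ i, d i • z i ∈ Bd φ := by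
        have : (Bd φ).mkQ (∑ i, d i • z i) = 0 := hd
        rwa [Submodule.mkQ_apply, Submodule.Quotient.mk_eq_zero] at this
      have := h2 d hd' i
      rw [range_bc]
      have e : algebraMap A B (d i) ∈ Ideal.map (algebraMap A B) (LinearMap.range φ) :=
        Ideal.mem_map_of_mem _ this
      simpa [Algebra.smul_def] using e
    have h5 := h4 h3
    simpa [x, Pi.single_apply, Finset.sum_ite_eq] using h5

end koszul

section compare
variable {R A : Type u} [CommRing R] [CommRing A] (p : R →+* A) {G F : Type u} [AddCommGroup G]
  [Module R G] [AddCommGroup F] [Module A F] (π : G →ₛₗ[p] F) (ψ : G →ₗ[R] R) (φ : F →ₗ[A] A)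

theorem map_Bd (h : ∀ g, φ (π g) = p (ψ g)) (g : G) (hg : g ∈ Bd ψ) : π g ∈ Bd φ := by
  induction hg using Submodule.span_induction with
  | mem x hx =>
    obtain ⟨f, g, rfl⟩ := hx
    rw [map_sub, LinearMap.map_smulₛₗ, LinearMap.map_smulₛₗ, ← h, ← h]
    exact mem_Bd _ _ _
  | zero => rw [map_zero]; exact zero_mem _
  | add x y _ _ h1 h2 => rw [map_add]; exact add_mem h1 h2
  | smul a x _ h1 => rw [LinearMap.map_smulₛₗ]; exact Submodule.smul_mem _ _ h1

theorem lift_Bd (hp : Function.Surjective p) (hπ : Function.Surjective π)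
    (h : ∀ g, φ (π g) = p (ψ g)) (f : F) (hf : f ∈ Bd φ) : ∃ g ∈ Bd ψ, π g = f := by
  induction hf using Submodule.span_induction with
  | mem x hx =>
    obtain ⟨f, g, rfl⟩ := hx
    obtain ⟨f, rfl⟩ := hπ f
    obtain ⟨g, rfl⟩ := hπ g
    refine ⟨_, mem_Bd ψ f g, ?_⟩
    rw [map_sub, LinearMap.map_smulₛₗ, LinearMap.map_smulₛₗ, ← h, ← h]
  | zero => exact ⟨0, zero_mem _, map_zero _⟩
  | add x y _ _ h1 h2 =>
    obtain ⟨g1, h1, rfl⟩ := h1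
    obtain ⟨g2, h2, rfl⟩ := h2
    exact ⟨g1 + g2, add_mem h1 h2, map_add _ _ _⟩
  | smul a x _ h1 =>
    obtain ⟨g1, h1, rfl⟩ := h1
    obtain ⟨a, rfl⟩ := hp a
    exact ⟨a • g1, Submodule.smul_mem _ _ h1, LinearMap.map_smulₛₗ _ _ _⟩

theorem ker_gens [IsLocalRing R] [IsNoetherianRing R] (hp : Function.Surjective p)
    (hπ : Function.Surjective π)
    (h : ∀ g, φ (π g) = p (ψ g)) (hker : ∀ g, π g = 0 → g ∈ RingHom.ker p • (⊤ : Submodule R G))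
    (hψ : LinearMap.range ψ = maximalIdeal R) (hI : RingHom.ker p ≤ maximalIdeal R)
    {n : ℕ} (z : Fin n → F) (hz : KGen φ z) :
    ∃ as : List R, as.length = n ∧ Ideal.ofList as = RingHom.ker p := by
  choose g hg using fun i => hπ (z i)
  refine ⟨List.ofFn fun i => ψ (g i), by simp, ?_⟩
  have e : Ideal.ofList (List.ofFn fun i => ψ (g i)) = Ideal.span (Set.range fun i => ψ (g i)) := by
    unfold Ideal.ofList
    congr 1
    ext x
    simp [List.mem_ofFn]
  rw [e]
  have hle : Ideal.span (Set.range fun i => ψ (g i)) ≤ RingHom.ker p := by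
    rw [Ideal.span_le]
    rintro _ ⟨i, rfl⟩
    show p _ = 0
    rw [← h, hg, hz.1]
  refine le_antisymm hle ?_
  refine Submodule.le_of_le_smul_of_le_jacobson_bot (I := maximalIdeal R)
    (IsNoetherian.noetherian _) (IsLocalRing.maximalIdeal_le_jacobson _) ?_
  intro x hx
  obtain ⟨w, rfl⟩ : x ∈ LinearMap.range ψ := hψ ▸ hI hx
  obtain ⟨c, hc⟩ := hz.2 (π w) (by rw [h]; exact hx)
  choose d hd using fun i => hp (c i)
  obtain ⟨b, hb, hb'⟩ := lift_Bd p π ψ φ hp hπ h _ hc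
  have h1 := hker (w - ∑ i, d i • g i - b) (by
    rw [map_sub, map_sub, hb', map_sum]
    simp_rw [LinearMap.map_smulₛₗ, hd, hg]
    abel)
  have h2 : ψ (w - ∑ i, d i • g i - b) ∈ maximalIdeal R • RingHom.ker p := by
    have : RingHom.ker p • (⊤ : Submodule R G) ≤ Submodule.comap ψ (maximalIdeal R • RingHom.ker p : Ideal R) := by
      rw [Submodule.smul_le]
      intro a ha g _
      have e2 : ψ (a • g) = ψ g • a := by rw [map_smul, smul_eq_mul, smul_eq_mul, mul_comm]
      rw [Submodule.mem_comap, e2]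
      exact Submodule.smul_mem_smul (hψ ▸ ⟨g, rfl⟩) ha
    exact this h1
  have h3 : ψ b = 0 := LinearMap.mem_ker.1 (Bd_le_ker ψ hb)
  have h4 : ψ w = ∑ i, d i * ψ (g i) + ψ (w - ∑ i, d i • g i - b) := by
    rw [map_sub, map_sub, h3, map_sum]; simp
  rw [h4]
  refine add_mem (Submodule.mem_sup_left ?_) (Submodule.mem_sup_right h2)
  exact Submodule.sum_mem _ fun i _ => Ideal.mul_mem_left _ _ (Ideal.subset_span ⟨i, rfl⟩)

theorem gen_of_zero (hπ : Function.Surjective π)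
    (h : ∀ g, φ (π g) = p (ψ g)) (hI : RingHom.ker p ≤ LinearMap.range ψ) (hk : KF ψ 0)
    (as : List R) (has : Ideal.ofList as = RingHom.ker p) :
    ∃ z : Fin as.length → F, KGen φ z := by
  have h0 : ∀ i : Fin as.length, as.get i ∈ RingHom.ker p := fun i => by
    rw [← has]; exact Ideal.subset_span (List.get_mem _ _)
  choose u hu using fun i => hI (h0 i)
  refine ⟨fun i => π (u i), fun i => by rw [h, hu]; exact h0 i, ?_⟩
  intro w hw
  obtain ⟨g, rfl⟩ := hπ w
  have h1 : ψ g ∈ Ideal.ofList as := by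
    rw [has]; show p _ = 0; rw [← h, hw]
  have e : Ideal.ofList as = Ideal.span (Set.range as.get) := by
    unfold Ideal.ofList
    rw [Set.range_list_get]
  rw [e, Ideal.mem_span_range_iff_exists_fun] at h1
  obtain ⟨d, hd⟩ := h1
  refine ⟨fun i => p (d i), ?_⟩
  have : ψ (g - ∑ i, d i • u i) = 0 := by
    rw [map_sub, map_sum, ← hd]
    simp [hu]
  obtain ⟨z, ⟨-, h2⟩, -⟩ := hk
  obtain ⟨c, hc⟩ := h2 _ this
  have := map_Bd p π ψ φ h _ hc
  simpa [LinearMap.map_smulₛₗ] using this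

end compare
end CIT

namespace CIT
set_option linter.style.haveILetI false
set_option linter.unusedSectionVars false
open TensorProduct RingTheory.Sequence Pointwise

theorem reg_form {R : Type u} [CommRing R] [IsLocalRing R] [IsNoetherianRing R] {d : ℕ}
    (hR : RegMax R d) : ∃ ψ : (Fin d → R) →ₗ[R] R, LinearMap.range ψ = maximalIdeal R ∧ KF ψ 0 := by
  obtain ⟨rs, h1, h2, h3⟩ := hR
  have hk : KF (0 : PUnit.{u+1} →ₗ[R] R) 0 := by
    refine ⟨fun _ => 0, ⟨fun i => rfl, fun w _ => ⟨0, ?_⟩⟩, fun c hc i => i.elim0⟩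
    have : w - ∑ i : Fin 0, (0 : Fin 0 → R) i • (0 : PUnit.{u+1}) = 0 := Subsingleton.elim _ _
    rw [this]; exact zero_mem _
  have e0 : (LinearMap.range (0 : PUnit.{u+1} →ₗ[R] R)) = (⊥ : Ideal R) := LinearMap.range_zero
  have hreg : IsWeaklyRegular (R ⧸ (LinearMap.range (0 : PUnit.{u+1} →ₗ[R] R) : Ideal R)) rs := by
    rw [e0]
    exact (LinearEquiv.isWeaklyRegular_congr (Submodule.quotEquivOfEqBot _ rfl) rs).2 h1
  obtain ⟨F', i1, i2, i3, i4, φ', hk', hr, hf⟩ := KF_addList rs PUnit.{u+1} 0 0 hk hreg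
  rw [e0, bot_sup_eq, h2] at hr
  have hd : Module.finrank R F' = d := by
    rw [hf, h3, Module.finrank_zero_of_subsingleton, zero_add]
  let e : F' ≃ₗ[R] (Fin d → R) := (Module.finBasisOfFinrankEq R F' hd).equivFun
  refine ⟨φ' ∘ₗ e.symm.toLinearMap, ?_, KF_congr e φ' _ (fun f => by simp) hk'⟩
  rw [LinearMap.range_comp, LinearEquiv.range, Submodule.map_top, hr]

theorem quot_form {R A : Type u} [CommRing R] [CommRing A] (p : R →+* A)
    (hp : Function.Surjective p) {d : ℕ} (ψ : (Fin d → R) →ₗ[R] R) :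
    ∃ (φ : (Fin d → A) →ₗ[A] A) (π : (Fin d → R) →ₛₗ[p] (Fin d → A)), Function.Surjective π ∧
      (∀ g, φ (π g) = p (ψ g)) ∧
      (∀ g, π g = 0 → g ∈ RingHom.ker p • (⊤ : Submodule R (Fin d → R))) ∧
      LinearMap.range φ = Ideal.map p (LinearMap.range ψ) := by
  let π : (Fin d → R) →ₛₗ[p] (Fin d → A) :=
    { toFun := fun g i => p (g i)
      map_add' := fun x y => by ext; simp
      map_smul' := fun x y => by ext; simp }
  let φ : (Fin d → A) →ₗ[A] A := Fintype.linearCombination A (fun i => p (ψ (Pi.single i 1)))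
  have hπ : Function.Surjective π := by
    intro y
    choose x hx using fun i => hp (y i)
    exact ⟨x, funext hx⟩
  have hc : ∀ g, φ (π g) = p (ψ g) := by
    intro g
    have : ψ g = ∑ i, g i * ψ (Pi.single i 1) := by
      conv_lhs => rw [pi_eq_sum_univ' g]
      rw [map_sum]
      refine Finset.sum_congr rfl fun i _ => ?_
      rw [map_smul, smul_eq_mul]
    rw [this, map_sum]
    simp [φ, π, Fintype.linearCombination_apply]
  refine ⟨φ, π, hπ, hc, ?_, ?_⟩
  · intro g hg
    rw [pi_eq_sum_univ' g]
    refine Submodule.sum_mem _ fun i _ => Submodule.smul_mem_smul ?_ trivial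
    exact congrFun hg i
  · apply le_antisymm
    · rintro _ ⟨x, rfl⟩
      obtain ⟨g, rfl⟩ := hπ x
      rw [hc]
      exact Ideal.mem_map_of_mem _ ⟨g, rfl⟩
    · rw [Ideal.map_le_iff_le_comap]
      rintro _ ⟨g, rfl⟩
      exact ⟨π g, hc g⟩

theorem dev_upper {R A : Type u} [CommRing R] [IsLocalRing R] [IsNoetherianRing R]
    [CommRing A] [IsLocalRing A] {d : ℕ} (hR : RegMax R d) (p : R →+* A)
    (hp : Function.Surjective p) :
    ∃ φ : (Fin d → A) →ₗ[A] A, LinearMap.range φ = maximalIdeal A ∧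
      (∀ as : List R, Ideal.ofList as = RingHom.ker p → Module.length A (KH φ) ≤ as.length) ∧
      (∀ h, KF φ h → ∃ as : List R, as.length = h ∧ Ideal.ofList as = RingHom.ker p) := by
  obtain ⟨ψ, hψ, hk⟩ := reg_form hR
  obtain ⟨φ, π, hπ, hc, hker, hr⟩ := quot_form p hp ψ
  have hI : RingHom.ker p ≤ maximalIdeal R := IsLocalRing.le_maximalIdeal (RingHom.ker_ne_top p)
  have hr' : LinearMap.range φ = maximalIdeal A := by
    rw [hr, hψ]
    haveI : IsLocalHom p := hp.isLocalHom p
    exact (IsLocalRing.map_maximalIdeal_of_surjective p hp)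
  refine ⟨φ, hr', ?_, ?_⟩
  · intro as has
    obtain ⟨z, hz⟩ := gen_of_zero p π ψ φ hπ hc (hψ ▸ hI) hk as has
    exact KGen_length φ hr' z hz
  · rintro h ⟨z, hz, -⟩
    exact ker_gens p π ψ φ hp hπ hc hker hψ hI z hz

theorem exists_form (A : Type u) [CommRing A] [IsLocalRing A] [IsNoetherianRing A] :
    ∃ (n : ℕ) (φ : (Fin n → A) →ₗ[A] A), LinearMap.range φ = maximalIdeal A := by
  obtain ⟨n, s, hs⟩ := Submodule.fg_iff_exists_fin_generating_family.1
    (IsNoetherian.noetherian (maximalIdeal A))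
  refine ⟨n, Fintype.linearCombination A s, ?_⟩
  rw [Fintype.range_linearCombination, hs]

theorem fiber_form {A : Type u} [CommRing A] [IsLocalRing A] [IsNoetherianRing A]
    (B : Type u) [CommRing B] [IsLocalRing B] [Algebra A B] [Module.Flat A B]
    (J : Ideal B) (hJ : Ideal.map (algebraMap A B) (maximalIdeal A) = J) [IsLocalRing (B ⧸ J)]
    {n h r : ℕ} (φ : (Fin n → A) →ₗ[A] A) (hφ : LinearMap.range φ = maximalIdeal A) (hk : KF φ h)
    (hr : RegMax (B ⧸ J) r) :
    ∃ (F' : Type u) (_ : AddCommGroup F') (_ : Module B F') (_ : Module.Free B F')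
      (_ : Module.Finite B F') (φ' : F' →ₗ[B] B), KF φ' h ∧
      LinearMap.range φ' = maximalIdeal B ∧ Module.finrank B F' = n + r := by
  obtain ⟨ys, h1, h2, h3⟩ := hr
  obtain ⟨xs, rfl⟩ : ∃ xs : List B, xs.map (Ideal.Quotient.mk J) = ys :=
    List.map_surjective_iff.2 Ideal.Quotient.mk_surjective ys
  have hx : IsWeaklyRegular (B ⧸ J) xs :=
    (isWeaklyRegular_map_algebraMap_iff (B ⧸ J) (B ⧸ J) xs).1 h1
  have hr := range_bc B φ
  rw [hφ, hJ] at hr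
  obtain ⟨F', i1, i2, i3, i4, φ', hk', hr', hf⟩ := KF_addList xs (B ⊗[A] (Fin n → A)) (bc B φ) h
    (KF_bc B φ hk) (by rw [hr]; exact hx)
  refine ⟨F', i1, i2, i3, i4, φ', hk', ?_, ?_⟩
  · rw [hr', hr]
    have e1 : Ideal.map (Ideal.Quotient.mk J) (Ideal.ofList xs) = maximalIdeal (B ⧸ J) := by
      rw [Ideal.map_ofList, h2]
    have e2 := congrArg (Ideal.comap (Ideal.Quotient.mk J)) e1
    haveI : IsLocalHom (Ideal.Quotient.mk J) := Ideal.Quotient.mk_surjective.isLocalHom _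
    rw [Ideal.comap_map_of_surjective _ Ideal.Quotient.mk_surjective, 
      IsLocalRing.maximalIdeal_comap, ← RingHom.ker_eq_comap_bot, Ideal.mk_ker, sup_comm] at e2
    exact e2
  · rw [hf, Module.finrank_baseChange, Module.finrank_fin_fun, ← h3, List.length_map]

end CIT

namespace CIT
set_option linter.style.haveILetI false
set_option linter.unusedSectionVars false
open TensorProduct RingTheory.Sequence Pointwise

theorem dim_flat (A B : Type u) [CommRing A] [IsLocalRing A] [IsNoetherianRing A]
    [CommRing B] [IsLocalRing B] [IsNoetherianRing B] [Algebra A B] [Module.Flat A B]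
    [IsLocalHom (algebraMap A B)]
    (J : Ideal B) (hJ : Ideal.map (algebraMap A B) (maximalIdeal A) = J) [IsLocalRing (B ⧸ J)] :
    ringKrullDim B = ringKrullDim A + ringKrullDim (B ⧸ J) := by
  subst hJ
  haveI : (maximalIdeal B).LiesOver (maximalIdeal A) :=
    ⟨(IsLocalRing.maximalIdeal_comap (algebraMap A B)).symm⟩
  have := Ideal.height_eq_height_add_of_liesOver_of_hasGoingDown (maximalIdeal A) (maximalIdeal B)
  have e : Ideal.map (Ideal.Quotient.mk (Ideal.map (algebraMap A B) (maximalIdeal A)))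
      (maximalIdeal B) = maximalIdeal _ := 
    IsLocalRing.map_maximalIdeal_of_surjective _ Ideal.Quotient.mk_surjective
  rw [e] at this
  rw [← maximalIdeal_height_eq_ringKrullDim, ← maximalIdeal_height_eq_ringKrullDim,
    ← maximalIdeal_height_eq_ringKrullDim, this]
  rfl

theorem numerics {A B Q : Type u} [CommRing A] [IsLocalRing A] [IsNoetherianRing A]
    [CommRing B] [IsLocalRing B] [IsNoetherianRing B] [Algebra A B] [Module.Flat A B]
    [IsLocalHom (algebraMap A B)]
    (J : Ideal B) (hJ : Ideal.map (algebraMap A B) (maximalIdeal A) = J) [IsLocalRing (B ⧸ J)]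
    [CommRing Q] [IsLocalRing Q] [IsNoetherianRing Q] {r d : ℕ} (hr : RegMax (B ⧸ J) r)
    (hd : RegMax Q d) (f : Q →+* B) (hf : Function.Surjective f) (zs : List Q)
    (hzs : IsRegular Q zs) (hker : RingHom.ker f = Ideal.ofList zs)
    {n h : ℕ} (φ : (Fin n → A) →ₗ[A] A) (hφ : LinearMap.range φ = maximalIdeal A) (hk : KF φ h) :
    ringKrullDim A + h ≤ n := by
  obtain ⟨F', i1, i2, i3, i4, φ1, hk1, hr1, hn1⟩ := fiber_form B J hJ φ hφ hk hr
  obtain ⟨φ2, hr2, h2, -⟩ := dev_upper hd f hf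
  have h2 := h2 zs hker.symm
  have h3 := length_indep φ1 hr1 φ2 hr2
  rw [KF_length φ1 hr1 hk1, hn1, Module.finrank_fin_fun] at h3
  have h4 : (h + d : ℕ∞) ≤ zs.length + (n + r : ℕ) := by
    rw [h3]; gcongr
  have h5 : h + d ≤ zs.length + (n + r) := by exact_mod_cast h4
  have d1 := dim_flat A B J hJ
  rw [hr.dim] at d1
  have d2 := ringKrullDim_add_length_eq_ringKrullDim_of_isRegular zs hzs
  rw [hd.dim] at d2
  have d3 : ringKrullDim (Q ⧸ Ideal.ofList zs) = ringKrullDim B := by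
    rw [← hker]
    exact ringKrullDim_eq_of_ringEquiv (RingHom.quotientKerEquivOfSurjective hf)
  rw [d3, d1] at d2
  rw [← maximalIdeal_height_eq_ringKrullDim] at d2 ⊢
  have hfin : (maximalIdeal A).height ≠ ⊤ := Ideal.height_ne_top (Ideal.IsPrime.ne_top inferInstance)
  obtain ⟨m, hm⟩ := ENat.ne_top_iff_exists.1 hfin
  rw [← hm] at d2 ⊢
  have d4 : m + r + zs.length = d := by exact_mod_cast d2
  have : m + h ≤ n := by omega
  exact_mod_cast this

theorem ci_of_cohen {A R : Type u} [CommRing A] [IsLocalRing A] [IsNoetherianRing A]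
    [CommRing R] [IsLocalRing R] [IsNoetherianRing R] {N : ℕ} (hR : RegMax R N)
    (p : R →+* AdicCompletion (maximalIdeal A) A) (hp : Function.Surjective p)
    {n h : ℕ} (φ : (Fin n → A) →ₗ[A] A) (hφ : LinearMap.range φ = maximalIdeal A) (hk : KF φ h)
    (hle : ringKrullDim A + h ≤ n) : IsCompleteIntersectionLocalRing A := by
  haveI : IsNoetherianRing (AdicCompletion (maximalIdeal A) A) :=
    isNoetherianRing_of_surjective _ _ p hp
  set B := AdicCompletion (maximalIdeal A) A with hB
  have hJ : Ideal.map (algebraMap A B) (maximalIdeal A) = maximalIdeal B :=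
    (AdicCompletion.maximalIdeal_eq_map).symm
  letI : Field (B ⧸ maximalIdeal B) := Ideal.Quotient.field _
  have d1 := dim_flat A B (maximalIdeal B) hJ
  rw [ringKrullDim_eq_zero_of_field, add_zero] at d1
  have hk1 := KF_bc B φ hk
  have hr1 := range_bc B φ
  rw [hφ, hJ] at hr1
  obtain ⟨φ2, hr2, -, h2⟩ := dev_upper hR p hp
  obtain ⟨h', hk2⟩ := exists_KF φ2 hr2
  obtain ⟨as, has, hker⟩ := h2 h' hk2
  have h3 := length_indep (bc B φ) hr1 φ2 hr2
  rw [KF_length _ hr1 hk1, KF_length _ hr2 hk2, Module.finrank_baseChange, Module.finrank_fin_fun,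
    Module.finrank_fin_fun] at h3
  have h4 : h + N = h' + n := by exact_mod_cast h3
  have d3 : ringKrullDim (R ⧸ Ideal.ofList as) = ringKrullDim B := by
    rw [hker]
    exact ringKrullDim_eq_of_ringEquiv (RingHom.quotientKerEquivOfSurjective hp)
  have hI : RingHom.ker p ≤ maximalIdeal R := IsLocalRing.le_maximalIdeal (RingHom.ker_ne_top p)
  have hreg : IsRegular R as := by
    refine cm_lemma N hR as (fun r hr => ?_) ?_
    · exact hI (hker ▸ Ideal.subset_span hr)
    · rw [d3, d1, has]
      rw [← maximalIdeal_height_eq_ringKrullDim] at hle ⊢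
      have hfin : (maximalIdeal A).height ≠ ⊤ := Ideal.height_ne_top (Ideal.IsPrime.ne_top inferInstance)
      obtain ⟨m, hm⟩ := ENat.ne_top_iff_exists.1 hfin
      rw [← hm] at hle ⊢
      have : m + h ≤ n := by exact_mod_cast hle
      have : m + h' ≤ N := by omega
      exact_mod_cast this
  exact ⟨R, inferInstance, hR.isRegularLocal, p, hp, as, hreg, hker.symm⟩

end CIT

namespace CIT
open RingTheory.Sequence
theorem main_of_cohen (A : Type u) [CommRing A] [IsLocalRing A] [IsNoetherianRing A]
    (M : Type u) [AddCommGroup M] [Module A M] [Module.Finite A M] [Nontrivial M]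
    (htest : IsTestModule A M) (hdim : CIStarDimFinite A M)
    (hcohen : ∃ (R : Type u) (_ : CommRing R) (_ : IsLocalRing R) (_ : IsNoetherianRing R) (N : ℕ)
      (_ : RegMax R N) (p : R →+* AdicCompletion (maximalIdeal A) A), Function.Surjective p) :
    IsCompleteIntersectionLocalRing A := by
  obtain ⟨R, _, _, _, N, hR, p, hp⟩ := hcohen
  obtain ⟨A', _, _, _, _, ⟨hloc, hflat, hreg⟩, Q, _, _, _, f, ⟨hf, rs, hrs, hker⟩, n, hpd⟩ := hdim
  haveI : IsLocalRing (A' ⧸ Ideal.map (algebraMap A A') (maximalIdeal A)) := hreg.2.1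
  obtain ⟨r, -, -, hr⟩ := regularLocal_iff _ hreg
  have hr' := hr
  obtain ⟨ys, hy1, hy2, -⟩ := hr'
  obtain ⟨m, hm⟩ := test_step A M htest A' hloc ys hy1 hy2 Q f hf rs hrs.toIsWeaklyRegular hker
    _ (LinearEquiv.refl A' _) n hpd
  obtain ⟨d, hd⟩ := serre _ Q le_rfl m hm
  obtain ⟨k, φ, hφ⟩ := exists_form A
  obtain ⟨h, hk⟩ := exists_KF φ hφ
  exact ci_of_cohen hR p hp φ hφ hk (numerics _ rfl hr hd f hf rs hrs hker φ hφ hk)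

end CIT

set_option linter.style.haveILetI false
namespace CIT
open Polynomial

theorem split_p {E k : Type u} [CommRing E] [Field k] (π : E →+* k) (hπ : Function.Surjective π)
    (hI : ∀ x y, π x = 0 → π y = 0 → x * y = 0) (p : ℕ) (hp : p.Prime) (hpE : (p : E) = 0) :
    ∃ s : k →+* E, ∀ a, π (s a) = a := by
  haveI : Fact p.Prime := ⟨hp⟩
  haveI : Nontrivial E := π.domain_nontrivial
  haveI : CharP E p := ringChar.of_eq (CharP.ringChar_of_prime_eq_zero hp hpE)
  have hpk : (p : k) = 0 := by rw [← map_natCast π, hpE, map_zero]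
  haveI : CharP k p := ringChar.of_eq (CharP.ringChar_of_prime_eq_zero hp hpk)
  have hwd : ∀ x y, π x = π y → x ^ p = y ^ p := by
    intro x y h
    have h1 : π (x - y) = 0 := by rw [map_sub, h, sub_self]
    have h2 : (x - y) ^ p = 0 := by
      obtain ⟨m, rfl⟩ : ∃ m, p = m + 2 := ⟨p - 2, by have := hp.two_le; omega⟩
      rw [pow_add, pow_two (x - y), hI _ _ h1 h1, mul_zero]
    rw [sub_pow_char] at h2
    exact sub_eq_zero.mp h2
  obtain ⟨g, hg⟩ := hπ.hasRightInverse
  let φ : k →+* E :=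
    { toFun := fun a => g a ^ p
      map_one' := by rw [hwd (g 1) 1 (by rw [hg, map_one]), one_pow]
      map_zero' := by rw [hwd (g 0) 0 (by rw [hg, map_zero]), zero_pow hp.ne_zero]
      map_mul' := fun a b => by
        rw [hwd (g (a * b)) (g a * g b) (by rw [map_mul, hg, hg, hg]), mul_pow]
      map_add' := fun a b => by
        rw [hwd (g (a + b)) (g a + g b) (by rw [map_add, hg, hg, hg]), add_pow_char] }
  have hφ : ∀ x, φ (π x) = x ^ p := fun x => hwd _ _ (hg _)
  have hπφ : ∀ a, π (φ a) = a ^ p := fun a => by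
    change π (g a ^ p) = _
    rw [map_pow, hg]
  let P : Set (Subring E) := {S | φ.range ≤ S ∧ ∀ x ∈ S, π x = 0 → x = 0}
  have hP0 : φ.range ∈ P := by
    refine ⟨le_rfl, ?_⟩
    rintro _ ⟨a, rfl⟩ h
    rw [hπφ] at h
    rw [eq_zero_of_pow_eq_zero h, map_zero]
  obtain ⟨S, -, hS⟩ := zorn_le_nonempty₀ P (by
    intro c hc hch y hy
    refine ⟨sSup c, ⟨(hc hy).1.trans (le_sSup hy), ?_⟩, fun z hz => le_sSup hz⟩
    intro x hx hx0
    obtain ⟨T, hT, hxT⟩ := (Subring.mem_sSup_of_directedOn ⟨y, hy⟩ hch.directedOn).mp hx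
    exact (hc hT).2 x hxT hx0) _ hP0
  have hS1 : φ.range ≤ S := hS.prop.1
  have hS2 : ∀ x ∈ S, π x = 0 → x = 0 := hS.prop.2
  let L : Subfield k :=
    { S.map π with
      inv_mem' := by
        rintro _ ⟨x, hx, rfl⟩
        by_cases h0 : π x = 0
        · exact ⟨0, S.zero_mem, by simp [h0]⟩
        refine ⟨x ^ (p - 1) * φ ((π x)⁻¹), S.mul_mem (S.pow_mem hx _) (hS1 ⟨_, rfl⟩), ?_⟩
        rw [map_mul, hπφ, map_pow]
        obtain ⟨m, rfl⟩ : ∃ m, p = m + 1 := ⟨p - 1, by have := hp.pos; omega⟩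
        rw [Nat.add_sub_cancel, pow_succ, ← mul_assoc, ← mul_pow, mul_inv_cancel₀ h0, one_pow,
          one_mul] }
  have hL : ∀ a, a ∈ L := by
    by_contra! hex
    obtain ⟨a, ha⟩ := hex
    let ι : S →+* L := (π.comp S.subtype).codRestrict L (fun x => ⟨x, x.2, rfl⟩)
    have hιinj : Function.Injective ι := by
      rw [injective_iff_map_eq_zero]
      intro x hx
      have : π x = 0 := congrArg Subtype.val hx
      exact Subtype.ext (hS2 _ x.2 this)
    let c : S := ⟨φ a, hS1 ⟨a, rfl⟩⟩
    have hιc : (ι c : k) = a ^ p := hπφ a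
    have hirr : Irreducible (X ^ p - C (ι c) : L[X]) := by
      apply X_pow_sub_C_irreducible_of_prime hp
      intro b hb
      apply ha
      have h1 : (b : k) ^ p = a ^ p := by rw [← hιc, ← hb]; rfl
      have h2 : ((b : k) - a) ^ p = 0 := by rw [sub_pow_char, h1, sub_self]
      rw [← sub_eq_zero.mp (eq_zero_of_pow_eq_zero h2)]
      exact b.2
    have hmin : X ^ p - C (ι c) = minpoly L a := by
      apply minpoly.eq_of_irreducible_of_monic hirr
      · rw [map_sub, map_pow, aeval_X, aeval_C, sub_eq_zero]
        exact hιc.symm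
      · exact monic_X_pow_sub_C _ hp.ne_zero
    have hmon : (X ^ p - C c : S[X]).Monic := monic_X_pow_sub_C _ hp.ne_zero
    let ev : S[X] →+* E := eval₂RingHom S.subtype (g a)
    have hev : ev (X ^ p - C c) = 0 := by
      simp only [ev, map_sub, map_pow, coe_eval₂RingHom, eval₂_X, eval₂_C]
      exact sub_self _
    have hT : ev.range ∈ P := by
      have hle : S ≤ ev.range := fun x hx => ⟨C ⟨x, hx⟩, by simp [ev]⟩
      refine ⟨hS1.trans hle, ?_⟩
      rintro _ ⟨f, rfl⟩ h0
      have h1 : ev f = ev (f %ₘ (X ^ p - C c)) := by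
        conv_lhs => rw [← modByMonic_add_div f (X ^ p - C c)]
        rw [map_add, map_mul, hev, zero_mul, add_zero]
      set r := f %ₘ (X ^ p - C c) with hr
      have hdeg : r.degree < p := by
        have := degree_modByMonic_lt f hmon
        rwa [degree_X_pow_sub_C hp.pos] at this
      have h2 : aeval a (r.map ι) = 0 := by
        rw [h1] at h0
        rw [← h0, aeval_def, eval₂_map]
        simp only [ev, coe_eval₂RingHom]
        rw [hom_eval₂, hg]
        rfl
      have h3 : r.map ι = 0 := by
        refine eq_zero_of_dvd_of_degree_lt (minpoly.dvd L a h2) ?_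
        rw [← hmin, degree_X_pow_sub_C hp.pos]
        exact (degree_map_le).trans_lt hdeg
      have h4 : r = 0 := (Polynomial.map_eq_zero_iff hιinj).mp h3
      rw [h1, h4, map_zero]
    have hle : S ≤ ev.range := fun x hx => ⟨C ⟨x, hx⟩, by simp [ev]⟩
    have := hS.le_of_ge hT hle
    have hga : g a ∈ S := this ⟨X, by simp [ev]⟩
    exact ha ⟨g a, hga, hg a⟩
  have hbij : Function.Bijective (π.comp S.subtype) := by
    constructor
    · rw [injective_iff_map_eq_zero]
      exact fun x hx => Subtype.ext (hS2 _ x.2 hx)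
    · intro a
      obtain ⟨x, hx, h⟩ := hL a
      exact ⟨⟨x, hx⟩, h⟩
  let e := RingEquiv.ofBijective _ hbij
  exact ⟨S.subtype.comp e.symm.toRingHom, fun a => e.apply_symm_apply a⟩

theorem split_0 {E k : Type u} [CommRing E] [Field k] [CharZero k] (π : E →+* k)
    (hπ : Function.Surjective π)
    (hI : ∀ x y, π x = 0 → π y = 0 → x * y = 0) :
    ∃ s : k →+* E, ∀ a, π (s a) = a := by
  have hu : ∀ y : nonZeroDivisors ℤ, IsUnit (Int.castRingHom E y) := by
    rintro ⟨n, hn⟩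
    have hn0 : n ≠ 0 := nonZeroDivisors.ne_zero hn
    obtain ⟨y, hy⟩ := hπ ((n : k)⁻¹)
    have hk : (n : k) ≠ 0 := by exact_mod_cast hn0
    have h1 : π (1 - n * y) = 0 := by simp [hy, hk]
    have h2 := hI _ _ h1 h1
    refine IsUnit.of_mul_eq_one (2 * y - n * y * y) ?_
    change (n : E) * _ = 1
    linear_combination h2 * (-1)
  letI : Algebra ℚ E := (IsLocalization.lift (M := nonZeroDivisors ℤ) (S := ℚ) hu).toAlgebra
  obtain ⟨s, hs⟩ := exists_isTranscendenceBasis ℚ k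
  haveI : Algebra.IsAlgebraic (IntermediateField.adjoin ℚ (Set.range ((↑) : s → k))) k :=
    hs.isAlgebraic_field
  haveI : Algebra.FormallySmooth ℚ k :=
    .of_algebraicIndependent_of_isSeparable hs.1
  have hcom : ∀ r : ℚ, π (algebraMap ℚ E r) = algebraMap ℚ k r := fun r => by
    change (π.comp (algebraMap ℚ E)) r = _
    congr 1
    exact Subsingleton.elim _ _
  let π' : E →ₐ[ℚ] k := { π with commutes' := hcom }
  have hn : IsNilpotent (RingHom.ker (π' : E →+* k)) := ⟨2, by
    rw [pow_two, Ideal.zero_eq_bot, eq_bot_iff, Ideal.mul_le]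
    exact fun x hx y hy => hI x y hx hy⟩
  refine ⟨(Algebra.FormallySmooth.liftOfSurjective (AlgHom.id ℚ k) π' hπ hn : k →ₐ[ℚ] E), fun a => ?_⟩
  exact Algebra.FormallySmooth.liftOfSurjective_apply (AlgHom.id ℚ k) π' hπ hn a

theorem section_S {E B k : Type u} [CommRing E] [CommRing B] [Field k] (f : E →+* B)
    (hf : Function.Surjective f) (p : ℕ) (hJ : ∀ x y, f x = 0 → f y = 0 → x * y = 0)
    (hJp : ∀ x, f (p * x) = 0 → p * x = 0) (q : B →+* k) (hqs : Function.Surjective q)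
    (hq : ∀ b, q b = 0 → ∃ c, b = p * c) (hpk : (p : k) = 0)
    (hc : p.Prime ∨ (p = 0 ∧ CharZero k)) :
    ∃ s : B →+* E, ∀ b, f (s b) = b := by
  let I : Ideal E := Ideal.span {(p : E)}
  let π : E ⧸ I →+* k := Ideal.Quotient.lift I (q.comp f) (by
    intro a ha
    obtain ⟨c, rfl⟩ := Ideal.mem_span_singleton'.mp ha
    simp [hpk])
  have hπmk : ∀ x, π (Ideal.Quotient.mk I x) = q (f x) := fun x => rfl
  have hπs : Function.Surjective π := by
    intro a
    obtain ⟨b, rfl⟩ := hqs a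
    obtain ⟨e, rfl⟩ := hf b
    exact ⟨Ideal.Quotient.mk I e, rfl⟩
  have hpI : ∀ y, Ideal.Quotient.mk I (p * y) = 0 := fun y =>
    Ideal.Quotient.eq_zero_iff_mem.mpr (Ideal.mul_mem_right _ _ (Ideal.mem_span_singleton_self _))
  have hrep : ∀ z, π z = 0 → ∃ x, f x = 0 ∧ z = Ideal.Quotient.mk I x := by
    intro z hz
    obtain ⟨x, rfl⟩ := Ideal.Quotient.mk_surjective z
    obtain ⟨c, hc⟩ := hq _ hz
    obtain ⟨y, rfl⟩ := hf c
    refine ⟨x - p * y, by simp [hc], ?_⟩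
    rw [map_sub, hpI, sub_zero]
  have hI : ∀ x y, π x = 0 → π y = 0 → x * y = 0 := by
    intro x y hx hy
    obtain ⟨x', hx', rfl⟩ := hrep x hx
    obtain ⟨y', hy', rfl⟩ := hrep y hy
    rw [← map_mul, hJ x' y' hx' hy', map_zero]
  obtain ⟨s, hs⟩ : ∃ s : k →+* E ⧸ I, ∀ a, π (s a) = a := by
    rcases hc with hp | ⟨-, h0⟩
    · refine split_p π hπs hI p hp ?_
      have := hpI 1
      simpa using this
    · exact split_0 π hπs hI
  let S : Subring E := s.range.comap (Ideal.Quotient.mk I)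
  have hbij : Function.Bijective (f.comp S.subtype) := by
    constructor
    · rw [injective_iff_map_eq_zero]
      rintro ⟨x, a, ha⟩ hx
      have hx : f x = 0 := hx
      have h1 : a = 0 := by rw [← hs a, ha, hπmk, hx, map_zero]
      rw [h1, map_zero] at ha
      obtain ⟨c, hc⟩ := Ideal.mem_span_singleton'.mp (Ideal.Quotient.eq_zero_iff_mem.mp ha.symm)
      rw [mul_comm] at hc
      rw [← hc] at hx
      apply Subtype.ext
      change x = 0
      rw [← hc, hJp c hx]
    · intro b
      obtain ⟨e, rfl⟩ := hf b
      obtain ⟨x, hx⟩ := Ideal.Quotient.mk_surjective (s (q (f e)))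
      have h1 : q (f e - f x) = 0 := by
        rw [map_sub, ← hπmk x, hx, hs, sub_self]
      obtain ⟨c, hc⟩ := hq _ h1
      obtain ⟨y, rfl⟩ := hf c
      refine ⟨⟨x + p * y, q (f e), ?_⟩, ?_⟩
      · rw [map_add, hpI, add_zero, hx]
      · change f (x + p * y) = f e
        rw [map_add, map_mul, map_natCast, ← hc]
        ring
  let e := RingEquiv.ofBijective _ hbij
  exact ⟨S.subtype.comp e.symm.toRingHom, fun a => e.apply_symm_apply a⟩

end CIT

set_option linter.style.haveILetI false
namespace CIT

/-- The stages of the construction of a Cohen ring inside a ring with perfect residue field. -/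
structure Stage {W K : Type u} [CommRing W] [Field K] (κ : W →+* K) (k0 : Subfield K) (p m : ℕ)
    (D : Subring W) : Prop where
  le : ∀ x ∈ D, κ x ∈ k0
  surj : ∀ a ∈ k0, ∃ y ∈ D, κ y = a
  pow_mem : ∀ w, κ w ∈ k0 → (p : W) ^ m * w ∈ D
  sat : ∀ w, (p : W) ^ m * w ∈ D → κ w ∈ k0
  div : ∀ w, (p : W) * w ∈ D → ∃ d ∈ D, ∃ v, w = d + (p : W) ^ m * v

theorem Stage.step {W K : Type u} [CommRing W] [Field K] (κ : W →+* K) (k0 : Subfield K) (p : ℕ)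
    (hp : p.Prime) (hker : ∀ w, κ w = 0 ↔ ∃ v, w = p * v) (hnz : ∀ w, (p : W) * w = 0 → w = 0)
    {m : ℕ} {D : Subring W} (h : Stage κ k0 p m D) :
    ∃ D' : Subring W, Stage κ k0 p (m + 1) D' ∧ D' ≤ D ∧
      (∀ x ∈ D, ∃ y ∈ D', ∃ w, x = y + (p : W) ^ (m + 1) * w) ∧
      (∀ w, (p : W) * w ∈ D' → w ∈ D) := by
  have hκp : κ (p : W) = 0 := (hker _).mpr ⟨1, by rw [mul_one]⟩
  have hpk : (p : K) = 0 := by rw [← map_natCast κ, hκp]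
  have hnzp : ∀ n w, (p : W) ^ n * w = 0 → w = 0 := by
    intro n
    induction n with
    | zero => intro w hw; simpa using hw
    | succ n ih => intro w hw; rw [pow_succ, mul_assoc] at hw; exact hnz _ (ih _ hw)
  have hinj : ∀ n w v, (p : W) ^ n * w = (p : W) ^ n * v → w = v := by
    intro n w v hwv
    exact sub_eq_zero.mp (hnzp n _ (by rw [mul_sub, hwv, sub_self]))
  have hpD : ∀ w, (p : W) ^ (m + 1) * w ∈ D := by
    intro w
    rw [pow_succ, mul_assoc]
    apply h.pow_mem
    rw [map_mul, hκp, zero_mul]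
    exact k0.zero_mem
  let I : Ideal D :=
    { carrier := {x | ∃ d, κ d ∈ k0 ∧ (x : W) = (p : W) ^ (m + 1) * d}
      add_mem' := by
        rintro x y ⟨d, hd, hx⟩ ⟨e, he, hy⟩
        exact ⟨d + e, by rw [map_add]; exact k0.add_mem hd he, by
          rw [Subring.coe_add, hx, hy, mul_add]⟩
      zero_mem' := ⟨0, by rw [map_zero]; exact k0.zero_mem, by simp⟩
      smul_mem' := by
        rintro c x ⟨d, hd, hx⟩
        refine ⟨c * d, ?_, ?_⟩
        · rw [map_mul]; exact k0.mul_mem (h.le _ c.2) hd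
        · rw [smul_eq_mul, Subring.coe_mul, hx]; ring }
  let J : Ideal D :=
    { carrier := {x | ∃ d, (x : W) = (p : W) ^ (m + 1) * d}
      add_mem' := by
        rintro x y ⟨d, hx⟩ ⟨e, hy⟩
        exact ⟨d + e, by rw [Subring.coe_add, hx, hy, mul_add]⟩
      zero_mem' := ⟨0, by simp⟩
      smul_mem' := by
        rintro c x ⟨d, hx⟩
        refine ⟨c * d, ?_⟩
        rw [smul_eq_mul, Subring.coe_mul, hx]; ring }
  have hIJ : I ≤ J := by
    rintro x ⟨d, -, hx⟩
    exact ⟨d, hx⟩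
  let f : D ⧸ I →+* D ⧸ J := Ideal.Quotient.factor hIJ
  have hf : Function.Surjective f := Ideal.Quotient.factor_surjective hIJ
  have hfmk : ∀ x, f (Ideal.Quotient.mk I x) = Ideal.Quotient.mk J x := fun x => rfl
  have hf0 : ∀ x, f (Ideal.Quotient.mk I x) = 0 → ∃ d, (x : W) = (p : W) ^ (m + 1) * d :=
    fun x hx => Ideal.Quotient.eq_zero_iff_mem.mp hx
  let q0 : D →+* k0 := (κ.comp D.subtype).codRestrict k0 (fun x => h.le _ x.2)
  have hq0 : ∀ x, (q0 x : K) = κ x := fun x => rfl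
  let q : D ⧸ J →+* k0 := Ideal.Quotient.lift J q0 (by
    rintro x ⟨d, hx⟩
    apply Subtype.ext
    rw [hq0, hx, map_mul, map_pow, hκp, zero_pow (by omega), zero_mul]
    rfl)
  have hqmk : ∀ x, (q (Ideal.Quotient.mk J x) : K) = κ x := fun x => rfl
  obtain ⟨s, hs⟩ := section_S f hf p (by
      intro x y hx hy
      obtain ⟨x, rfl⟩ := Ideal.Quotient.mk_surjective x
      obtain ⟨y, rfl⟩ := Ideal.Quotient.mk_surjective y
      obtain ⟨d, hd⟩ := hf0 _ hx
      obtain ⟨e, he⟩ := hf0 _ hy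
      rw [← map_mul]
      refine Ideal.Quotient.eq_zero_iff_mem.mpr ⟨(p : W) ^ (m + 1) * (d * e), ?_, ?_⟩
      · rw [map_mul, map_pow, hκp, zero_pow (by omega), zero_mul]
        exact k0.zero_mem
      · rw [Subring.coe_mul, hd, he]; ring) (by
      intro x hx
      obtain ⟨x, rfl⟩ := Ideal.Quotient.mk_surjective x
      have e1 : (p : D ⧸ I) * Ideal.Quotient.mk I x = Ideal.Quotient.mk I (p * x) := by
        rw [map_mul, map_natCast]
      rw [e1] at hx ⊢
      obtain ⟨d, hd⟩ := hf0 _ hx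
      rw [Subring.coe_mul, Subring.coe_natCast] at hd
      refine Ideal.Quotient.eq_zero_iff_mem.mpr ⟨d, ?_, by
        rw [Subring.coe_mul, Subring.coe_natCast, hd]⟩
      apply h.sat
      have : (x : W) = (p : W) ^ m * d := by
        apply hinj 1
        rw [pow_one, hd]; ring
      rw [← this]; exact x.2) q (by
      rintro ⟨a, ha⟩
      obtain ⟨y, hy, rfl⟩ := h.surj a ha
      exact ⟨Ideal.Quotient.mk J ⟨y, hy⟩, rfl⟩) (by
      intro b hb
      obtain ⟨x, rfl⟩ := Ideal.Quotient.mk_surjective b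
      have hb : κ x = 0 := by rw [← hqmk, hb]; rfl
      obtain ⟨w, hw⟩ := (hker _).mp hb
      obtain ⟨d, hd, v, hv⟩ := h.div w (by rw [← hw]; exact x.2)
      refine ⟨Ideal.Quotient.mk J ⟨d, hd⟩, ?_⟩
      rw [← map_natCast (Ideal.Quotient.mk J), ← map_mul, Ideal.Quotient.eq]
      refine ⟨v, ?_⟩
      rw [AddSubgroupClass.coe_sub, Subring.coe_mul, Subring.coe_natCast, hw, hv]
      ring) (by apply Subtype.ext; simpa using hpk) (Or.inl hp)
  let D' : Subring W := (s.range.comap (Ideal.Quotient.mk I)).map D.subtype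
  have hD'mem : ∀ x : D, (x : W) ∈ D' ↔ Ideal.Quotient.mk I x ∈ s.range := by
    intro x
    constructor
    · rintro ⟨y, hy, hyx⟩
      rw [← (Subtype.ext hyx : y = x)]; exact hy
    · intro hx; exact ⟨x, hx, rfl⟩
  have hD'D : D' ≤ D := by
    rintro _ ⟨y, -, rfl⟩
    exact y.2
  have hpow : ∀ w, κ w ∈ k0 → (p : W) ^ (m + 1) * w ∈ D' := by
    intro w hw
    refine (hD'mem ⟨_, hpD w⟩).mpr ?_
    have : Ideal.Quotient.mk I ⟨_, hpD w⟩ = 0 := Ideal.Quotient.eq_zero_iff_mem.mpr ⟨w, hw, rfl⟩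
    rw [this]; exact s.range.zero_mem
  have happ : ∀ x ∈ D, ∃ y ∈ D', ∃ w, x = y + (p : W) ^ (m + 1) * w := by
    intro x hx
    obtain ⟨y, hy⟩ := Ideal.Quotient.mk_surjective (s (Ideal.Quotient.mk J ⟨x, hx⟩))
    have h1 : Ideal.Quotient.mk J ⟨x, hx⟩ = Ideal.Quotient.mk J y := by
      rw [← hs (Ideal.Quotient.mk J ⟨x, hx⟩), ← hy, hfmk]
    obtain ⟨w, hw⟩ := Ideal.Quotient.eq.mp h1
    refine ⟨y, (hD'mem y).mpr (hy ▸ ⟨_, rfl⟩), w, ?_⟩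
    rw [← hw, AddSubgroupClass.coe_sub]; ring
  have hsat : ∀ w, (p : W) ^ (m + 1) * w ∈ D' → κ w ∈ k0 := by
    intro w hw
    obtain ⟨b, hb⟩ := (hD'mem ⟨_, hpD w⟩).mp hw
    have h1 : b = 0 := by
      rw [← hs b, hb, hfmk]
      exact Ideal.Quotient.eq_zero_iff_mem.mpr ⟨w, rfl⟩
    rw [h1, map_zero] at hb
    obtain ⟨d, hd, hwd⟩ := Ideal.Quotient.eq_zero_iff_mem.mp hb.symm
    rw [hinj _ _ _ hwd]; exact hd
  have hpW2 : ∀ u, (p : W) ^ (m + 2) * u ∈ D' := by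
    intro u
    rw [pow_succ, mul_assoc]
    apply hpow
    rw [map_mul, hκp, zero_mul]; exact k0.zero_mem
  have hdiv : ∀ w, (p : W) * w ∈ D' → w ∈ D := by
    intro w hw
    obtain ⟨d, hd, v, rfl⟩ := h.div w (hD'D hw)
    obtain ⟨d', hd', u, rfl⟩ := happ d hd
    have h1 : (p : W) ^ (m + 1) * v ∈ D' := by
      have := D'.sub_mem (D'.sub_mem hw (D'.mul_mem (natCast_mem D' p) hd')) (hpW2 u)
      convert this using 1
      ring
    exact D.add_mem hd (h.pow_mem _ (hsat _ h1))
  refine ⟨D', ⟨fun x hx => h.le x (hD'D hx), ?_, hpow, hsat, ?_⟩, hD'D, happ, hdiv⟩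
  · intro a ha
    obtain ⟨x, hx, rfl⟩ := h.surj a ha
    obtain ⟨y, hy, w, rfl⟩ := happ x hx
    refine ⟨y, hy, ?_⟩
    rw [map_add, map_mul, map_pow, hκp, zero_pow (by omega), zero_mul, add_zero]
  · intro w hw
    exact happ w (hdiv w hw)
end CIT

set_option linter.style.haveILetI false
namespace CIT

theorem mem_span_pow_iff {W : Type u} [CommRing W] (p : W) (n : ℕ) (x y : W) :
    x ≡ y [SMOD (Ideal.span {p} ^ n • ⊤ : Submodule W W)] ↔ ∃ v, x - y = p ^ n * v := by
  rw [SModEq.sub_mem, smul_eq_mul, Ideal.mul_top, Ideal.span_singleton_pow,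
    Ideal.mem_span_singleton]
  rfl

theorem exists_cohen_sub {W K : Type u} [CommRing W] [Field K] (κ : W →+* K)
    (hκ : Function.Surjective κ) (k0 : Subfield K) (p : ℕ)
    (hp : p.Prime) (hker : ∀ w, κ w = 0 ↔ ∃ v, w = p * v) (hnz : ∀ w, (p : W) * w = 0 → w = 0)
    (hprec : IsPrecomplete (Ideal.span {(p : W)}) W) :
    ∃ C : Subring W, (∀ x ∈ C, κ x ∈ k0) ∧ (∀ a ∈ k0, ∃ y ∈ C, κ y = a) ∧
      (∀ w, (p : W) * w ∈ C → w ∈ C) ∧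
      (∀ w, (∀ n, ∃ c ∈ C, ∃ v, w = c + (p : W) ^ n * v) → w ∈ C) := by
  have hκp : κ (p : W) = 0 := (hker _).mpr ⟨1, by rw [mul_one]⟩
  have h0 : Stage κ k0 p 0 (k0.toSubring.comap κ) := by
    refine ⟨fun x hx => hx, ?_, ?_, ?_, ?_⟩
    · intro a ha
      obtain ⟨y, rfl⟩ := hκ a
      exact ⟨y, ha, rfl⟩
    · intro w hw
      rw [pow_zero, one_mul]; exact hw
    · intro w hw
      rw [pow_zero, one_mul] at hw; exact hw
    · intro w _
      exact ⟨0, Subring.zero_mem _, w, by simp⟩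
  have hstep := fun m (d : {D : Subring W // Stage κ k0 p m D}) =>
    Stage.step κ k0 p hp hker hnz d.2
  choose F hF1 hF2 hF3 hF4 using hstep
  let S : (m : ℕ) → {D : Subring W // Stage κ k0 p m D} := fun m =>
    Nat.rec ⟨_, h0⟩ (fun m d => ⟨F m d, hF1 m d⟩) m
  have hS : ∀ m, (S (m + 1)).1 = F m (S m) := fun m => rfl
  have hmono : ∀ m, (S (m + 1)).1 ≤ (S m).1 := fun m => hF2 m (S m)
  have hpS : ∀ m w, (p : W) ^ (m + 1) * w ∈ (S m).1 := by
    intro m w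
    rw [pow_succ, mul_assoc]
    apply (S m).2.pow_mem
    rw [map_mul, hκp, zero_mul]; exact k0.zero_mem
  refine ⟨⨅ m, (S m).1, ?_, ?_, ?_, ?_⟩
  · intro x hx
    exact (S 0).2.le x ((Subring.mem_iInf.mp hx) 0)
  · intro a ha
    obtain ⟨y0, hy0, hy0a⟩ := (S 0).2.surj a ha
    have hn := fun m (x : (S m).1) => hF3 m (S m) x x.2
    choose G hG1 w hG2 using hn
    let y : (m : ℕ) → (S m).1 := fun m => Nat.rec ⟨y0, hy0⟩ (fun m x => ⟨G m x, hG1 m x⟩) m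
    have hy : ∀ m, (y m).1 = (y (m + 1)).1 + (p : W) ^ (m + 1) * w m (y m) := fun m => hG2 m (y m)
    have hdiff : ∀ m i, ∃ v, (y m).1 - (y (m + i)).1 = (p : W) ^ (m + 1) * v := by
      intro m i
      induction i with
      | zero => exact ⟨0, by simp⟩
      | succ i ih =>
        obtain ⟨v, hv⟩ := ih
        refine ⟨v + p ^ i * w (m + i) (y (m + i)), ?_⟩
        have := hy (m + i)
        rw [mul_add, ← hv]
        rw [← add_assoc m i 1]
        linear_combination this
    obtain ⟨L, hL⟩ := hprec.prec (f := fun m => (y m).1) (by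
      intro m n hmn
      rw [mem_span_pow_iff]
      obtain ⟨i, rfl⟩ := Nat.exists_eq_add_of_le hmn
      obtain ⟨v, hv⟩ := hdiff m i
      exact ⟨p * v, by rw [hv]; ring⟩)
    refine ⟨L, Subring.mem_iInf.mpr fun m => ?_, ?_⟩
    · obtain ⟨v, hv⟩ := (mem_span_pow_iff _ _ _ _).mp (hL (m + 1))
      have e : L = (y (m + 1)).1 - p ^ (m + 1) * v := by rw [← hv]; ring
      rw [e]
      exact Subring.sub_mem _ (hmono m (y (m + 1)).2) (hpS m v)
    · obtain ⟨v, hv⟩ := (mem_span_pow_iff _ _ _ _).mp (hL 1)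
      have e : L = (y 1).1 - p ^ 1 * v := by rw [← hv]; ring
      have e0 := hy 0
      have : L = y0 - p * (v + w 0 (y 0)) := by
        rw [e]
        have : (y 0).1 = y0 := rfl
        rw [this] at e0
        linear_combination - e0
      rw [this, map_sub, map_mul, hκp, zero_mul, sub_zero, hy0a]
  · intro w hw
    rw [Subring.mem_iInf] at hw ⊢
    intro m
    exact hF4 m (S m) w (hw (m + 1))
  · intro w hw
    rw [Subring.mem_iInf]
    intro m
    obtain ⟨c, hc, v, rfl⟩ := hw (m + 1)
    exact Subring.add_mem _ (Subring.mem_iInf.mp hc m) (hpS m v)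

end CIT

set_option linter.style.haveILetI false
namespace CIT
open RingTheory.Sequence

theorem exists_cohen_ring (k : Type u) [Field k] :
    ∃ (C : Type u) (_ : CommRing C) (_ : IsLocalRing C) (_ : IsNoetherianRing C) (N : ℕ)
      (_ : RegMax C N) (p : ℕ) (q : C →+* k), Function.Surjective q ∧
      (∀ c, q c = 0 → ∃ d, c = p * d) ∧ (p : k) = 0 ∧
      ((p.Prime ∧ ∀ c : C, p * c = 0 → c = 0) ∨ (p = 0 ∧ CharZero k)) := by
  obtain ⟨p, hpk⟩ := CharP.exists k
  rcases CharP.char_is_prime_or_zero k p with hp | rfl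
  swap
  · refine ⟨k, inferInstance, inferInstance, inferInstance, 0, ?_, 0, RingHom.id k,
      Function.surjective_id, ?_, by simp, Or.inr ⟨rfl, CharP.charP_to_charZero k⟩⟩
    · exact regMax_zero (IsLocalRing.maximalIdeal_eq_bot)
    · intro c hc
      exact ⟨0, by simpa using hc⟩
  haveI : Fact p.Prime := ⟨hp⟩
  let K := PerfectClosure k p
  let W := WittVector p K
  let κ : W →+* K := WittVector.constantCoeff
  have hker : ∀ w, κ w = 0 ↔ ∃ v, w = p * v := by
    intro w
    rw [← RingHom.mem_ker, WittVector.ker_constantCoeff, Ideal.mem_span_singleton]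
    rfl
  have hnz : ∀ w, (p : W) * w = 0 → w = 0 := fun w hw =>
    WittVector.eq_zero_of_p_mul_eq_zero w (by rw [mul_comm]; exact hw)
  let j := PerfectClosure.of k p
  obtain ⟨C, hC1, hC2, hC3, hC4⟩ := exists_cohen_sub κ
    (WittVector.constantCoeff_surjective p)
    j.fieldRange p hp hker hnz inferInstance
  let e : k ≃+* j.fieldRange := RingEquiv.ofBijective j.rangeRestrictField
    ⟨j.rangeRestrictField.injective, fun ⟨x, y, h⟩ => ⟨y, Subtype.ext h⟩⟩
  let q0 : C →+* j.fieldRange := (κ.comp C.subtype).codRestrict j.fieldRange (fun x => hC1 _ x.2)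
  let q : C →+* k := e.symm.toRingHom.comp q0
  have hq : ∀ x, q x = 0 ↔ κ x = 0 := by
    intro x
    change e.symm (q0 x) = 0 ↔ _
    rw [EmbeddingLike.map_eq_zero_iff]
    exact Subtype.ext_iff
  have hqs : Function.Surjective q := by
    intro a
    obtain ⟨y, hy, h⟩ := hC2 (e a) (e a).2
    refine ⟨⟨y, hy⟩, ?_⟩
    change e.symm (q0 _) = a
    rw [RingEquiv.symm_apply_eq]
    exact Subtype.ext h
  have hqp : ∀ c, q c = 0 → ∃ d, c = p * d := by
    intro c hc
    obtain ⟨v, hv⟩ := (hker _).mp ((hq c).mp hc)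
    exact ⟨⟨v, hC3 v (by rw [← hv]; exact c.2)⟩, Subtype.ext hv⟩
  have hnzC : ∀ c : C, p * c = 0 → c = 0 := by
    intro c hc
    exact Subtype.ext (hnz c (congrArg Subtype.val hc))
  have hpk0 : (p : k) = 0 := CharP.cast_eq_zero k p
  have hunit1 : ∀ c : C, IsUnit (1 - p * c) := by
    intro c
    have h1 : IsUnit (1 - p * (c : W)) := by
      apply WittVector.isUnit_of_coeff_zero_ne_zero
      change κ (1 - p * (c : W)) ≠ 0
      rw [map_sub, map_one, (hker (p * (c : W))).mpr ⟨_, rfl⟩, sub_zero]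
      exact one_ne_zero
    obtain ⟨u, hu⟩ := h1.exists_right_inv
    have huC : u ∈ C := by
      apply hC4
      intro n
      have hgeo : ∃ d ∈ C, u = d + (p * c) ^ n * u := by
        induction n with
        | zero => exact ⟨0, C.zero_mem, by simp⟩
        | succ n ih =>
          obtain ⟨d, hd, h⟩ := ih
          refine ⟨d + (p * c) ^ n, C.add_mem hd (C.pow_mem (C.mul_mem (natCast_mem C p) c.2) n), ?_⟩
          linear_combination h + (p * (c : W)) ^ n * hu
      obtain ⟨d, hd, h⟩ := hgeo
      exact ⟨d, hd, c ^ n * u, by rw [← mul_assoc, ← mul_pow]; exact h⟩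
    exact IsUnit.of_mul_eq_one ⟨u, huC⟩ (Subtype.ext hu)
  haveI hloc : IsLocalHom q := by
    constructor
    intro c hc
    obtain ⟨y, hy⟩ := hqs (q c)⁻¹
    have h1 : q (1 - c * y) = 0 := by
      rw [map_sub, map_mul, hy, map_one, mul_inv_cancel₀ hc.ne_zero, sub_self]
    obtain ⟨d, hd⟩ := hqp _ h1
    have h2 : c * y = 1 - p * d := by rw [← hd]; ring
    exact isUnit_of_mul_isUnit_left (h2 ▸ hunit1 d)
  haveI : IsLocalRing C := RingHom.domain_isLocalRing q
  have hmax : maximalIdeal C = Ideal.span {(p : C)} := by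
    ext x
    rw [mem_maximalIdeal, mem_nonunits_iff, Ideal.mem_span_singleton]
    constructor
    · intro hx
      exact hqp x (by_contra fun h => hx (isUnit_of_map_unit q x (isUnit_iff_ne_zero.mpr h)))
    · rintro ⟨d, rfl⟩ hx
      have := hx.map q
      rw [map_mul, map_natCast, hpk0, zero_mul] at this
      exact not_isUnit_zero this
  have hirr : Irreducible (p : C) := by
    have hpr : Prime (p : C) := by
      rw [← Ideal.span_singleton_prime, ← hmax]
      · infer_instance
      · intro h0
        exact one_ne_zero (hnzC 1 (by rw [h0, zero_mul]))
    exact hpr.irreducible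
  haveI : IsDiscreteValuationRing C := by
    apply IsDiscreteValuationRing.ofHasUnitMulPowIrreducibleFactorization
    refine ⟨p, hirr, ?_⟩
    intro x hx
    obtain ⟨n, u, hu⟩ := WittVector.exists_eq_pow_p_mul' (x : W) (by
      intro h; exact hx (Subtype.ext h))
    have hmem : ∀ n (w : W), (p : W) ^ n * w ∈ C → w ∈ C := by
      intro n
      induction n with
      | zero => intro w hw; simpa using hw
      | succ n ih =>
        intro w hw
        rw [pow_succ, mul_assoc] at hw
        exact hC3 _ (ih _ hw)
    have huC : (u : W) ∈ C := hmem n _ (by rw [← hu]; exact x.2)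
    have hu' : IsUnit (⟨u, huC⟩ : C) := by
      apply isUnit_of_map_unit q
      rw [isUnit_iff_ne_zero, Ne, hq]
      exact (u.isUnit.map κ).ne_zero
    refine ⟨n, hu'.unit, ?_⟩
    apply Subtype.ext
    rw [hu]
    change (p : W) ^ n * (u : W) = _
    rfl
  refine ⟨C, inferInstance, inferInstance, inferInstance, 1, ?_, p, q, hqs, hqp, hpk0,
    Or.inl ⟨hp, hnzC⟩⟩
  refine ⟨[(p : C)], ?_, ?_, rfl⟩
  · rw [isWeaklyRegular_singleton_iff]
    intro a b hab
    have : (p : C) * (a - b) = 0 := by rw [mul_sub, sub_eq_zero]; exact hab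
    exact sub_eq_zero.mp (hnzC _ this)
  · rw [hmax, Ideal.ofList_singleton]

end CIT

set_option linter.style.haveILetI false
namespace CIT

theorem lift_step {C R0 R1 k : Type u} [CommRing C] [CommRing R0] [CommRing R1] [Field k]
    (φ : R1 →+* R0) (hφ : Function.Surjective φ) (p : ℕ)
    (hJ : ∀ x y, φ x = 0 → φ y = 0 → x * y = 0) (hJp : ∀ x, φ x = 0 → p * x = 0)
    (q : C →+* k) (hqs : Function.Surjective q)
    (hq : ∀ c, q c = 0 → ∃ d, c = p * d) (hpk : (p : k) = 0)
    (hc : (p.Prime ∧ ∀ c : C, p * c = 0 → c = 0) ∨ (p = 0 ∧ CharZero k))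
    (g : C →+* R0) : ∃ g' : C →+* R1, φ.comp g' = g := by
  let E : Subring (C × R1) :=
    RingHom.eqLocus (g.comp (RingHom.fst C R1)) (φ.comp (RingHom.snd C R1))
  have hE : ∀ x : E, g x.1.1 = φ x.1.2 := fun x => x.2
  let f : E →+* C := (RingHom.fst C R1).comp E.subtype
  have hf0 : ∀ x : E, f x = 0 → x.1.1 = 0 ∧ φ x.1.2 = 0 := by
    intro x hx
    have hx : x.1.1 = 0 := hx
    exact ⟨hx, by rw [← hE, hx, map_zero]⟩
  obtain ⟨s, hs⟩ := section_S f (by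
      intro c
      obtain ⟨r, hr⟩ := hφ (g c)
      exact ⟨⟨(c, r), hr.symm⟩, rfl⟩) p (by
      intro x y hx hy
      apply Subtype.ext
      apply Prod.ext
      · change x.1.1 * y.1.1 = 0
        rw [(hf0 x hx).1, zero_mul]
      · exact hJ _ _ (hf0 x hx).2 (hf0 y hy).2) (by
      intro x hx
      rcases hc with ⟨-, hc⟩ | ⟨rfl, -⟩
      · rw [map_mul, map_natCast] at hx
        have h1 := hf0 x (hc _ hx)
        apply Subtype.ext
        apply Prod.ext
        · change (p : C) * x.1.1 = 0
          rw [h1.1, mul_zero]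
        · change (p : R1) * x.1.2 = 0
          exact hJp _ h1.2
      · simp) q hqs hq hpk (hc.imp (fun h => h.1) id)
  refine ⟨(RingHom.snd C R1).comp (E.subtype.comp s), ?_⟩
  ext c
  change φ (s c).1.2 = g c
  rw [← hE]
  exact congrArg g (hs c)

theorem lift_cohen {C B : Type u} [CommRing C] [CommRing B] [IsLocalRing B]
    [IsAdicComplete (maximalIdeal B) B] (p : ℕ)
    (q : C →+* ResidueField B) (hqs : Function.Surjective q)
    (hq : ∀ c, q c = 0 → ∃ d, c = p * d) (hpk : (p : ResidueField B) = 0)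
    (hc : (p.Prime ∧ ∀ c : C, p * c = 0 → c = 0) ∨ (p = 0 ∧ CharZero (ResidueField B))) :
    ∃ σ : C →+* B, ∀ c, residue B (σ c) = q c := by
  have hpm : (p : B) ∈ maximalIdeal B := by
    rw [← residue_eq_zero_iff, map_natCast, hpk]
  have hstep : ∀ (n : ℕ) (g : C →+* B ⧸ maximalIdeal B ^ (n + 1)),
      ∃ g' : C →+* B ⧸ maximalIdeal B ^ (n + 1 + 1),
        (Ideal.Quotient.factorPow (maximalIdeal B) (Nat.le_succ (n + 1))).comp g' = g := by
    intro n g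
    have hmem : ∀ x : B, Ideal.Quotient.factorPow (maximalIdeal B) (Nat.le_succ (n + 1))
        (Ideal.Quotient.mk _ x) = 0 → x ∈ maximalIdeal B ^ (n + 1) := by
      intro x hx
      exact Ideal.Quotient.eq_zero_iff_mem.mp hx
    refine lift_step _ (Ideal.Quotient.factor_surjective _) p ?_ ?_ q hqs hq hpk hc g
    · intro x y hx hy
      obtain ⟨x, rfl⟩ := Ideal.Quotient.mk_surjective x
      obtain ⟨y, rfl⟩ := Ideal.Quotient.mk_surjective y
      rw [← map_mul, Ideal.Quotient.eq_zero_iff_mem]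
      have := Ideal.mul_mem_mul (hmem x hx) (hmem y hy)
      rw [← pow_add] at this
      exact Ideal.pow_le_pow_right (by omega) this
    · intro x hx
      obtain ⟨x, rfl⟩ := Ideal.Quotient.mk_surjective x
      rw [← map_natCast (Ideal.Quotient.mk (maximalIdeal B ^ (n + 1 + 1))), ← map_mul,
        Ideal.Quotient.eq_zero_iff_mem, pow_succ' _ (n + 1)]
      exact Ideal.mul_mem_mul hpm (hmem x hx)
  choose F hF using hstep
  have h01 : maximalIdeal B ≤ maximalIdeal B ^ (0 + 1) := by simp
  let g0 : C →+* B ⧸ maximalIdeal B ^ (0 + 1) :=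
    (Ideal.Quotient.factor h01).comp q
  let g : (n : ℕ) → C →+* B ⧸ maximalIdeal B ^ (n + 1) := fun n => Nat.rec g0 (fun n h => F n h) n
  have hg : ∀ n, (Ideal.Quotient.factorPow (maximalIdeal B) (Nat.le_succ (n + 1))).comp
    (g (n + 1)) = g n := fun n => hF n (g n)
  have hg' : ∀ n i, (Ideal.Quotient.factorPow (maximalIdeal B)
      (show n + 1 ≤ n + i + 1 by omega)).comp (g (n + i)) = g n := by
    intro n i
    induction i with
    | zero => ext c; simp
    | succ i ih =>
      rw [← ih, ← hg (n + i), ← RingHom.comp_assoc]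
      congr 1
      ext x
      rfl
  let f : (n : ℕ) → C →+* B ⧸ maximalIdeal B ^ n := fun n =>
    (Ideal.Quotient.factorPow (maximalIdeal B) (Nat.le_succ n)).comp (g n)
  have hf : ∀ {m n : ℕ} (hle : m ≤ n),
      (Ideal.Quotient.factorPow (maximalIdeal B) hle).comp (f n) = f m := by
    intro m n hle
    obtain ⟨i, rfl⟩ := Nat.exists_eq_add_of_le hle
    simp only [f]
    rw [← hg' m i, ← RingHom.comp_assoc, ← RingHom.comp_assoc]
    congr 1
    ext x
    rfl
  refine ⟨IsAdicComplete.liftRingHom (maximalIdeal B) f hf, fun c => ?_⟩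
  have h1 := IsAdicComplete.mk_liftRingHom (maximalIdeal B) f hf 1 c
  have h2 : f 1 = g0 := by
    simp only [f]
    exact hg 0
  rw [h2] at h1
  obtain ⟨b, hb⟩ := residue_surjective (q c)
  rw [← hb]
  have h3 : g0 c = Ideal.Quotient.mk _ b := by
    change Ideal.Quotient.factor h01 (q c) = _
    rw [← hb]
    rfl
  rw [h3, Ideal.Quotient.eq, pow_one] at h1
  exact Ideal.Quotient.eq.mpr h1

end CIT

set_option linter.style.haveILetI false
namespace CIT
open RingTheory.Sequence

theorem RegMax.of_equiv {Q Q' : Type u} [CommRing Q] [IsLocalRing Q] [CommRing Q'] [IsLocalRing Q']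
    (e : Q ≃+* Q') {n : ℕ} (h : RegMax Q n) : RegMax Q' n := by
  obtain ⟨rs, h1, h2, h3⟩ := h
  refine ⟨rs.map e, ?_, ?_, by simpa using h3⟩
  · refine (AddEquiv.isWeaklyRegular_congr (e := e.toAddEquiv) ?_).mp h1
    refine List.forall₂_map_right_iff.mpr (List.forall₂_same.mpr fun r _ x => ?_)
    exact map_mul e r x
  · have : Ideal.ofList (rs.map e) = (Ideal.ofList rs).map (e : Q →+* Q') :=
      (Ideal.map_ofList (e : Q →+* Q') rs).symm
    rw [this, h2]
    have hs : Function.Surjective (e : Q →+* Q') := e.surjective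
    have : IsLocalHom (e : Q →+* Q') := hs.isLocalHom _
    rw [← (IsLocalRing.maximalIdeal_comap (e : Q →+* Q')), Ideal.map_comap_of_surjective _ hs]

theorem regMax_powerSeries {R : Type u} [CommRing R] [IsLocalRing R] {n : ℕ} (h : RegMax R n) :
    RegMax (PowerSeries R) (n + 1) := by
  have hX : (PowerSeries.X : PowerSeries R) ∈ maximalIdeal (PowerSeries R) := by
    rw [mem_maximalIdeal, mem_nonunits_iff, PowerSeries.isUnit_iff_constantCoeff]
    simp
  haveI : IsLocalRing (PowerSeries R ⧸ Ideal.span {(PowerSeries.X : PowerSeries R)}) :=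
    local_quot (span_singleton_le_max hX)
  have hk : RingHom.ker (PowerSeries.constantCoeff (R := R)) =
      Ideal.span {(PowerSeries.X : PowerSeries R)} := by
    ext f
    rw [RingHom.mem_ker, Ideal.mem_span_singleton, PowerSeries.X_dvd_iff]
  let e : PowerSeries R ⧸ Ideal.span {(PowerSeries.X : PowerSeries R)} ≃+* R :=
    (Ideal.quotEquivOfEq hk.symm).trans
      (RingHom.quotientKerEquivOfSurjective (f := PowerSeries.constantCoeff (R := R))
        PowerSeries.constantCoeff_surj)
  refine regMax_cons hX ?_ (RegMax.of_equiv e.symm h)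
  intro a b hab
  exact PowerSeries.X_mul_cancel hab

/-- evaluation of power series in a complete local ring -/
theorem exists_eval {R B : Type u} [CommRing R] [CommRing B] [IsLocalRing B]
    [IsAdicComplete (maximalIdeal B) B] (σ : R →+* B) (x : B) (hx : x ∈ maximalIdeal B) :
    ∃ ev : PowerSeries R →+* B, ∀ n f, ev f -
      ∑ i ∈ Finset.range n, σ (PowerSeries.coeff i f) * x ^ i ∈ maximalIdeal B ^ n := by
  have hxn : ∀ n, Ideal.Quotient.mk (maximalIdeal B ^ n) x ^ n = 0 := fun n => by
    rw [← map_pow, Ideal.Quotient.eq_zero_iff_mem]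
    exact Ideal.pow_mem_pow hx n
  -- truncation of polynomials does not change the value modulo powers
  have htr : ∀ n (P : Polynomial R), Ideal.Quotient.mk (maximalIdeal B ^ n)
      (Polynomial.eval₂ σ x (PowerSeries.trunc n (P : PowerSeries R))) =
      Ideal.Quotient.mk (maximalIdeal B ^ n) (Polynomial.eval₂ σ x P) := by
    intro n P
    have hd : Polynomial.X ^ n ∣ P - PowerSeries.trunc n (P : PowerSeries R) := by
      rw [Polynomial.X_pow_dvd_iff]
      intro d hd
      rw [Polynomial.coeff_sub, PowerSeries.coeff_trunc, if_pos hd, Polynomial.coeff_coe, sub_self]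
    obtain ⟨T, hT⟩ := hd
    rw [eq_comm, ← sub_eq_zero, ← map_sub, ← Polynomial.eval₂_sub, hT, Polynomial.eval₂_mul,
      Polynomial.eval₂_X_pow, map_mul, map_pow, hxn, zero_mul]
  let f : (n : ℕ) → PowerSeries R →+* B ⧸ maximalIdeal B ^ n := fun n =>
    { toFun := fun g => Ideal.Quotient.mk (maximalIdeal B ^ n)
        (Polynomial.eval₂ σ x (PowerSeries.trunc n g))
      map_one' := by
        have := htr n 1
        rw [Polynomial.coe_one] at this
        rw [this, Polynomial.eval₂_one, map_one]
      map_zero' := by simp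
      map_add' := fun a b => by
        rw [map_add, Polynomial.eval₂_add, map_add]
      map_mul' := fun a b => by
        rw [← map_mul, ← Polynomial.eval₂_mul, ← htr n (_ * _), Polynomial.coe_mul,
          PowerSeries.trunc_trunc_mul_trunc] }
  have hfs : ∀ n g, f n g = Ideal.Quotient.mk (maximalIdeal B ^ n)
      (∑ i ∈ Finset.range n, σ (PowerSeries.coeff i g) * x ^ i) := by
    intro n g
    change Ideal.Quotient.mk (maximalIdeal B ^ n)
      (Polynomial.eval₂ σ x (PowerSeries.trunc n g)) = _
    rw [PowerSeries.eval₂_trunc_eq_sum_range]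
  have hf : ∀ {m n : ℕ} (hle : m ≤ n),
      (Ideal.Quotient.factorPow (maximalIdeal B) hle).comp (f n) = f m := by
    intro m n hle
    ext g
    rw [RingHom.comp_apply, hfs, hfs]
    change Ideal.Quotient.mk (maximalIdeal B ^ m) _ = _
    rw [← Finset.sum_range_add_sum_Ico _ hle, map_add, add_eq_left,
      Ideal.Quotient.eq_zero_iff_mem]
    refine Ideal.sum_mem _ fun i hi => Ideal.mul_mem_left _ _ ?_
    exact Ideal.pow_le_pow_right (Finset.mem_Ico.mp hi).1 (Ideal.pow_mem_pow hx i)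
  refine ⟨IsAdicComplete.liftRingHom (maximalIdeal B) f hf, fun n g => ?_⟩
  rw [← Ideal.Quotient.eq, IsAdicComplete.mk_liftRingHom, hfs]

theorem eq_of_sub_mem_pow {B : Type u} [CommRing B] [IsLocalRing B]
    [IsHausdorff (maximalIdeal B) B] {x y : B} (h : ∀ n, x - y ∈ maximalIdeal B ^ n) : x = y := by
  rw [← sub_eq_zero]
  refine IsHausdorff.haus ‹_› (x - y) fun n => ?_
  rw [SModEq.sub_mem, sub_zero, smul_eq_mul, Ideal.mul_top]
  exact h n

/-- sums of `x`-adic series with coefficients in a finitely generated ideal stay in the ideal -/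
theorem eval_mem {B : Type u} [CommRing B] [IsLocalRing B]
    [IsAdicComplete (maximalIdeal B) B] (x : B) (ev : PowerSeries B →+* B)
    (hev : ∀ n f, ev f -
      ∑ i ∈ Finset.range n, PowerSeries.coeff i f * x ^ i ∈ maximalIdeal B ^ n) (ys : List B) :
    ∀ (z : ℕ → B), (∀ i, z i ∈ Ideal.ofList ys) → ev (PowerSeries.mk z) ∈ Ideal.ofList ys := by
  have hC : ∀ y, ev (PowerSeries.C y) = y := by
    intro y
    apply eq_of_sub_mem_pow
    intro n
    have := hev (n + 1) (PowerSeries.C y)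
    rw [Finset.sum_range_succ'] at this
    simp only [PowerSeries.coeff_C, Nat.add_eq_zero_iff, one_ne_zero, and_false, if_false, zero_mul,
      Finset.sum_const_zero, if_true, pow_zero, mul_one, zero_add] at this
    exact Ideal.pow_le_pow_right (Nat.le_succ n) this
  induction ys with
  | nil =>
    intro z hz
    have : PowerSeries.mk z = 0 := by
      ext i
      have := hz i
      rw [Ideal.ofList_nil, Ideal.mem_bot] at this
      simpa using this
    rw [this, map_zero]
    exact Ideal.zero_mem _
  | cons y ys ih =>
    intro z hz
    have : ∀ i, ∃ c, ∃ w ∈ Ideal.ofList ys, c * y + w = z i := by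
      intro i
      have := hz i
      rw [Ideal.ofList_cons] at this
      exact Ideal.mem_span_singleton_sup.mp this
    choose c w hw hz' using this
    have e : PowerSeries.mk z = PowerSeries.C y * PowerSeries.mk c + PowerSeries.mk w := by
      ext i
      simp [← hz', mul_comm]
    rw [e, map_add, map_mul, hC, Ideal.ofList_cons]
    refine Ideal.add_mem _ (Ideal.mem_sup_left ?_) (Ideal.mem_sup_right (ih w hw))
    exact Ideal.mul_mem_right _ _ (Ideal.mem_span_singleton_self y)

theorem cohen_induct {B : Type u} [CommRing B] [IsLocalRing B]
    [IsAdicComplete (maximalIdeal B) B] (xs : List B) (hxs : ∀ x ∈ xs, x ∈ maximalIdeal B) :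
    ∀ (R : Type u) [CommRing R] [IsLocalRing R] [IsNoetherianRing R] (N : ℕ) (_ : RegMax R N)
      (σ : R →+* B) (_ : ∀ b, ∃ r, b - σ r ∈ Ideal.ofList xs),
      ∃ (R : Type u) (_ : CommRing R) (_ : IsLocalRing R) (_ : IsNoetherianRing R) (N : ℕ)
        (_ : RegMax R N) (p : R →+* B), Function.Surjective p := by
  induction xs with
  | nil =>
    intro R _ _ _ N hR σ hσ
    refine ⟨R, inferInstance, inferInstance, inferInstance, N, hR, σ, fun b => ?_⟩
    obtain ⟨r, hr⟩ := hσ b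
    rw [Ideal.ofList_nil, Ideal.mem_bot, sub_eq_zero] at hr
    exact ⟨r, hr.symm⟩
  | cons x xs ih =>
    intro R _ _ _ N hR σ hσ
    have hx : x ∈ maximalIdeal B := hxs x (by simp)
    obtain ⟨ev, hev⟩ := exists_eval σ x hx
    obtain ⟨evB, hevB⟩ := exists_eval (RingHom.id B) x hx
    refine ih (fun y hy => hxs y (by simp [hy])) (PowerSeries R) (N + 1) (regMax_powerSeries hR)
      ev fun b => ?_
    have hstep : ∀ b : B, ∃ r c, ∃ w ∈ Ideal.ofList xs, b = σ r + x * c + w := by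
      intro b
      obtain ⟨r, hr⟩ := hσ b
      rw [Ideal.ofList_cons] at hr
      obtain ⟨c, w, hw, h⟩ := Ideal.mem_span_singleton_sup.mp hr
      exact ⟨r, c, w, hw, by linear_combination - h⟩
    choose r c w hw hb using hstep
    let bs : ℕ → B := fun n => c^[n] b
    have hbs : ∀ n, bs (n + 1) = c (bs n) := fun n => Function.iterate_succ_apply' c n b
    refine ⟨PowerSeries.mk fun n => r (bs n), ?_⟩
    have hsum : ∀ n, b = ∑ i ∈ Finset.range n, σ (r (bs i)) * x ^ i +
        ∑ i ∈ Finset.range n, w (bs i) * x ^ i + x ^ n * bs n := by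
      intro n
      induction n with
      | zero => simp [bs]
      | succ n ih' =>
        rw [Finset.sum_range_succ, Finset.sum_range_succ, hbs]
        have := hb (bs n)
        linear_combination ih' + x ^ n * this
    have key : b - ev (PowerSeries.mk fun n => r (bs n)) = evB (PowerSeries.mk fun n => w (bs n)) := by
      apply eq_of_sub_mem_pow
      intro n
      have h1 := hev n (PowerSeries.mk fun n => r (bs n))
      have h2 := hevB n (PowerSeries.mk fun n => w (bs n))
      have h3 : x ^ n * bs n ∈ maximalIdeal B ^ n :=
        Ideal.mul_mem_right _ _ (Ideal.pow_mem_pow hx n)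
      simp only [PowerSeries.coeff_mk, RingHom.id_apply] at h1 h2
      have h4 := Ideal.sub_mem _ (Ideal.sub_mem _ h3 h1) h2
      convert h4 using 1
      linear_combination hsum n
    rw [key]
    exact eval_mem x evB (fun n f => by simpa using hevB n f) xs _ fun i => hw _

theorem exists_cohen (B : Type u) [CommRing B] [IsLocalRing B]
    [IsAdicComplete (maximalIdeal B) B] (hfg : (maximalIdeal B).FG) :
    ∃ (R : Type u) (_ : CommRing R) (_ : IsLocalRing R) (_ : IsNoetherianRing R) (N : ℕ)
      (_ : RegMax R N) (p : R →+* B), Function.Surjective p := by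
  obtain ⟨C, _, _, _, N, hC, p, q, hqs, hq, hpk, hc⟩ := exists_cohen_ring (ResidueField B)
  obtain ⟨σ, hσ⟩ := lift_cohen p q hqs hq hpk hc
  obtain ⟨s, hs⟩ := hfg
  have hl : Ideal.ofList s.toList = maximalIdeal B := by
    rw [← hs, Ideal.ofList]
    congr 1
    ext x
    simp
  refine cohen_induct s.toList ?_ C N hC σ ?_
  · intro x hx
    rw [← hl]
    exact Ideal.subset_span hx
  · intro b
    obtain ⟨c, hc⟩ := hqs (residue B b)
    refine ⟨c, ?_⟩
    rw [hl, ← residue_eq_zero_iff, map_sub, hσ, hc, sub_self]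

end CIT

set_option linter.style.haveILetI false
namespace CIT

theorem main_thm (A : Type u) [CommRing A] [IsLocalRing A] [IsNoetherianRing A]
    (M : Type u) [AddCommGroup M] [Module A M] [Module.Finite A M] [Nontrivial M]
    (htest : IsTestModule A M) (hdim : CIStarDimFinite A M) :
    IsCompleteIntersectionLocalRing A := by
  refine main_of_cohen A M htest hdim (exists_cohen _ ?_)
  rw [AdicCompletion.maximalIdeal_eq_map]
  exact Ideal.FG.map (IsNoetherian.noetherian (maximalIdeal A)) _

end CIT

/-- Theorem `ci` of the paper. Let `(A, m, k)` be a noetherian local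
ring and `M` a test module for `A`. If `CI*-dim_A(M) < ∞` then `A` is a complete
intersection ring. -/
theorem complete_intersection_of_test_module_of_finite_upper_CI_dim
    (A : Type u) [CommRing A] [IsLocalRing A] [IsNoetherianRing A]
    (M : Type u) [AddCommGroup M] [Module A M] [Module.Finite A M] [Nontrivial M]
    (htest : IsTestModule A M) (hdim : CIStarDimFinite A M) :
    IsCompleteIntersectionLocalRing A := by
  exact CIT.main_thm A M htest hdim
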